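/- (C^{1,1} estimate) Let f₀ ∈ Ẇ^{1,∞}(ℝ²) with ‖∇_x f₀‖_{L∞} < 1/√5 and f₀ ∈ C^{1,1}, and let f : [0,T]×ℝ² → ℝ be a sufficiently smooth solution (f ∈ C([0,T]; C³₀(ℝ²))) of the 3D Muskat equation with initial data f₀. Then there is a constant C depending only on ‖∇_x f₀‖_{L∞} such that for all t ∈ (0,T], ‖D²_x f(t,·)‖_{L∞(ℝ²)} ≤ C · min{ ‖D²_x f₀‖_{L∞(ℝ²)}, 1/t }. -/

import Mathlib

open MeasureTheory Filter Set
open scoped RealInnerProductSpace Topology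

noncomputable section

/-- The horizontal slice `ℝ²` (the interface variable space for the 3D Muskat problem). -/
abbrev E2 := EuclideanSpace ℝ (Fin 2)

/-- The integrand of the `d`-dimensional Muskat equation:
`(δ_h g(x) − ∇g(x)·h) / (δ_h g(x)² + |h|²)^{d/2}`. -/
def muskatIntegrand (d : ℕ) {n : ℕ} (g : EuclideanSpace ℝ (Fin n) → ℝ)
    (x h : EuclideanSpace ℝ (Fin n)) : ℝ :=
  (g (x + h) - g x - ⟪gradient g x, h⟫) /
    ((g (x + h) - g x) ^ 2 + ‖h‖ ^ 2) ^ ((d : ℝ) / 2)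

/-- Principal value (over symmetric annuli `1/R < ‖h‖ < R` as `R → ∞`) of the integral of `F`. -/
def HasPV {n : ℕ} (F : EuclideanSpace ℝ (Fin n) → ℝ) (I : ℝ) : Prop :=
  Tendsto (fun R : ℝ => ∫ h in {h : EuclideanSpace ℝ (Fin n) | R⁻¹ < ‖h‖ ∧ ‖h‖ < R}, F h)
    atTop (𝓝 I)

/-- A sufficiently smooth, decaying solution of the 3D Muskat equation on `[0,T]`:
`f ∈ C([0,T]; C³₀(ℝ²))` (continuity in time in the `C³` sup norms, with all derivatives up
to order 3 vanishing at infinity), differentiable in time, and solving the Muskat equation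
in the principal value sense on `(0,T)`. -/
def SmoothDecaySol (T : ℝ) (f : ℝ → E2 → ℝ) : Prop :=
  (∀ t ∈ Icc 0 T, ContDiff ℝ 3 (f t)) ∧
  (∀ t ∈ Icc 0 T, ∀ i : ℕ, i ≤ 3 →
    Tendsto (fun x : E2 => ‖iteratedFDeriv ℝ i (f t) x‖) (cocompact E2) (𝓝 0)) ∧
  (∀ t₁ ∈ Icc 0 T, ∀ ε > (0 : ℝ), ∃ δ > (0 : ℝ), ∀ t ∈ Icc 0 T, |t - t₁| < δ →
    ∀ i : ℕ, i ≤ 3 → ∀ x : E2,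
      ‖iteratedFDeriv ℝ i (f t) x - iteratedFDeriv ℝ i (f t₁) x‖ ≤ ε) ∧
  (∀ t ∈ Ioo 0 T, ∀ x : E2, DifferentiableAt ℝ (fun s => f s x) t) ∧
  (∀ t ∈ Ioo 0 T, ∀ x : E2, HasPV (muskatIntegrand 3 (f t) x) (deriv (fun s => f s x) t))

section Part1
namespace Muskat

/-- reciprocal of the distance `√(a² + r²)` -/
def II (a r : ℝ) : ℝ := (Real.sqrt (a ^ 2 + r ^ 2))⁻¹
def KK (a r : ℝ) : ℝ := II a r ^ 3
def kk (a c r : ℝ) : ℝ := II a r ^ 3 - 3 * (a - c) * a * II a r ^ 5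

lemma sqrt_pos' (a : ℝ) {r : ℝ} (hr : 0 < r) : 0 < Real.sqrt (a ^ 2 + r ^ 2) := by
  apply Real.sqrt_pos.2; positivity

lemma II_pos (a : ℝ) {r : ℝ} (hr : 0 < r) : 0 < II a r := inv_pos.2 (sqrt_pos' a hr)

lemma le_S (a : ℝ) {r : ℝ} (_hr : 0 < r) : r ≤ Real.sqrt (a ^ 2 + r ^ 2) := by
  apply Real.le_sqrt_of_sq_le; nlinarith [sq_nonneg a]

lemma II_le (a : ℝ) {r : ℝ} (hr : 0 < r) : II a r ≤ r⁻¹ := by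
  unfold II; gcongr; exact le_S a hr

lemma II_sq (a : ℝ) {r : ℝ} (hr : 0 < r) : II a r ^ 2 * (a ^ 2 + r ^ 2) = 1 := by
  unfold II
  rw [inv_pow, Real.sq_sqrt (by positivity)]
  apply inv_mul_cancel₀; positivity

lemma S_diff (a₁ a₂ r : ℝ) (hr : 0 < r) :
    |Real.sqrt (a₁ ^ 2 + r ^ 2) - Real.sqrt (a₂ ^ 2 + r ^ 2)| ≤ |a₁ - a₂| := by
  have h1 := Real.sq_sqrt (show 0 ≤ a₁ ^ 2 + r ^ 2 by positivity)
  have h2 := Real.sq_sqrt (show 0 ≤ a₂ ^ 2 + r ^ 2 by positivity)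
  have p1 := sqrt_pos' a₁ hr
  have p2 := sqrt_pos' a₂ hr
  set s₁ := Real.sqrt (a₁ ^ 2 + r ^ 2)
  set s₂ := Real.sqrt (a₂ ^ 2 + r ^ 2)
  rw [← sq_le_sq]
  have : a₁ * a₂ + r ^ 2 ≤ s₁ * s₂ := by
    apply le_of_sq_le_sq _ (by positivity)
    have : (s₁ * s₂) ^ 2 = (a₁ ^ 2 + r ^ 2) * (a₂ ^ 2 + r ^ 2) := by rw [mul_pow, h1, h2]
    rw [this]; nlinarith [sq_nonneg (r * (a₁ - a₂))]
  nlinarith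

lemma II_diff (a₁ a₂ r : ℝ) (hr : 0 < r) : |II a₁ r - II a₂ r| ≤ |a₁ - a₂| / r ^ 2 := by
  have p1 := sqrt_pos' a₁ hr
  have p2 := sqrt_pos' a₂ hr
  have e : II a₁ r - II a₂ r = (Real.sqrt (a₂ ^ 2 + r ^ 2) - Real.sqrt (a₁ ^ 2 + r ^ 2)) *
      (II a₁ r * II a₂ r) := by
    unfold II; field_simp
  rw [e, abs_mul, abs_of_pos (mul_pos (II_pos _ hr) (II_pos _ hr)), div_eq_mul_inv,
    show (r ^ 2)⁻¹ = r⁻¹ * r⁻¹ by rw [sq, mul_inv]]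
  have := S_diff a₂ a₁ r hr
  rw [abs_sub_comm a₂ a₁] at this
  have q1 := II_pos a₁ hr
  have q2 := II_pos a₂ hr
  gcongr
  · exact II_le _ hr
  · exact II_le _ hr

lemma KK_diff (a₁ a₂ r : ℝ) (hr : 0 < r) : |KK a₁ r - KK a₂ r| ≤ 3 * |a₁ - a₂| / r ^ 4 := by
  unfold KK
  have e : II a₁ r ^ 3 - II a₂ r ^ 3 = (II a₁ r - II a₂ r) *
    (II a₁ r ^ 2 + II a₁ r * II a₂ r + II a₂ r ^ 2) := by ring
  have q1 := II_pos a₁ hr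
  have q2 := II_pos a₂ hr
  have l1 := II_le a₁ hr
  have l2 := II_le a₂ hr
  rw [e, abs_mul, abs_of_pos (show 0 < II a₁ r ^ 2 + II a₁ r * II a₂ r + II a₂ r ^ 2 by positivity)]
  calc _ ≤ |a₁ - a₂| / r ^ 2 * (r⁻¹ ^ 2 + r⁻¹ * r⁻¹ + r⁻¹ ^ 2) := by
        gcongr
        exact II_diff a₁ a₂ r hr
    _ = _ := by field_simp; ring

lemma I5_diff (a₁ a₂ r : ℝ) (hr : 0 < r) :
    |II a₁ r ^ 5 - II a₂ r ^ 5| ≤ 5 * |a₁ - a₂| / r ^ 6 := by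
  have e : II a₁ r ^ 5 - II a₂ r ^ 5 = (II a₁ r - II a₂ r) *
    (II a₁ r ^ 4 + II a₁ r ^ 3 * II a₂ r + II a₁ r ^ 2 * II a₂ r ^ 2 +
      II a₁ r * II a₂ r ^ 3 + II a₂ r ^ 4) := by ring
  have q1 := II_pos a₁ hr
  have q2 := II_pos a₂ hr
  have l1 := II_le a₁ hr
  have l2 := II_le a₂ hr
  rw [e, abs_mul, abs_of_pos (show 0 < (II a₁ r ^ 4 + II a₁ r ^ 3 * II a₂ r +
    II a₁ r ^ 2 * II a₂ r ^ 2 + II a₁ r * II a₂ r ^ 3 + II a₂ r ^ 4) by positivity)]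
  calc _ ≤ |a₁ - a₂| / r ^ 2 * (r⁻¹ ^ 4 + r⁻¹ ^ 3 * r⁻¹ + r⁻¹ ^ 2 * r⁻¹ ^ 2 +
            r⁻¹ * r⁻¹ ^ 3 + r⁻¹ ^ 4) := by
        gcongr
        exact II_diff a₁ a₂ r hr
    _ = _ := by field_simp; ring

lemma KK_zero {r : ℝ} (hr : 0 < r) : KK 0 r = 1 / r ^ 3 := by
  unfold KK II
  rw [show (0:ℝ) ^ 2 + r ^ 2 = r ^ 2 by ring, Real.sqrt_sq hr.le]; field_simp

lemma KK_le (a : ℝ) {r : ℝ} (hr : 0 < r) : KK a r ≤ 1 / r ^ 3 := by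
  unfold KK
  calc _ ≤ r⁻¹ ^ 3 := by
        have := II_pos a hr
        gcongr; exact II_le a hr
    _ = _ := by field_simp

lemma KK_nonneg (a : ℝ) {r : ℝ} (hr : 0 < r) : 0 ≤ KK a r := by
  unfold KK; have := II_pos a hr; positivity

lemma I5_le (a : ℝ) {r : ℝ} (hr : 0 < r) : II a r ^ 5 ≤ 1 / r ^ 5 := by
  calc _ ≤ r⁻¹ ^ 5 := by
        have := II_pos a hr
        gcongr; exact II_le a hr
    _ = _ := by field_simp

lemma kk_eq (a c : ℝ) {r : ℝ} (hr : 0 < r) :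
    kk a c r = II a r ^ 5 * (r ^ 2 - 2 * a ^ 2 + 3 * c * a) := by
  unfold kk
  have := II_sq a hr
  calc _ = II a r ^ 3 * 1 - 3 * (a - c) * a * II a r ^ 5 := by ring
    _ = _ := by rw [← this]; ring

lemma kk_upper (a c : ℝ) {r : ℝ} (hr : 0 < r) (hc : |c| ≤ r) (_ha : |a| ≤ r) :
    kk a c r ≤ 3 / r ^ 3 := by
  rw [kk_eq a c hr]
  have h5 := I5_le a hr
  have hp : 0 ≤ II a r ^ 5 := by have := II_pos a hr; positivity
  have hc2 : c ^ 2 ≤ r ^ 2 := by rw [← sq_abs c]; gcongr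
  calc _ ≤ II a r ^ 5 * (3 * r ^ 2) := by
        gcongr; nlinarith [sq_nonneg (4 * a - 3 * c)]
    _ ≤ 1 / r ^ 5 * (3 * r ^ 2) := by gcongr
    _ = _ := by field_simp

lemma kk_lower (M a c : ℝ) {r : ℝ} (hr : 0 < r) (hM : 0 ≤ M) (hM5 : 5 * M ^ 2 < 1)
    (hc : |c| ≤ M * r) (ha : |a| ≤ M * r) :
    (1 - 5 * M ^ 2) / 2 / r ^ 3 ≤ kk a c r := by
  rw [kk_eq a c hr]
  have hp := II_pos a hr
  have ha2 : a ^ 2 ≤ M ^ 2 * r ^ 2 := by rw [← sq_abs a, ← mul_pow]; gcongr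
  have hc2 : |c * a| ≤ M ^ 2 * r ^ 2 := by
    rw [abs_mul, show M ^ 2 * r ^ 2 = (M * r) * (M * r) by ring]; gcongr
  have h1 : (1 - 5 * M ^ 2) * r ^ 2 ≤ r ^ 2 - 2 * a ^ 2 + 3 * c * a := by
    nlinarith [neg_abs_le (c * a)]
  have hS : Real.sqrt (a ^ 2 + r ^ 2) ≤ 1.1 * r := by
    rw [Real.sqrt_le_left (by positivity)]
    nlinarith [sq_pos_of_pos hr]
  have hI : (1.1 * r)⁻¹ ≤ II a r := by
    unfold II; gcongr
  have h5 : 1 / 2 / r ^ 5 ≤ II a r ^ 5 := by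
    calc (1:ℝ) / 2 / r ^ 5 ≤ (1.1 * r)⁻¹ ^ 5 := by
          rw [mul_inv, mul_pow, div_eq_mul_inv, ← inv_pow]
          gcongr; norm_num
      _ ≤ _ := by gcongr
  calc _ = 1 / 2 / r ^ 5 * ((1 - 5 * M ^ 2) * r ^ 2) := by field_simp
    _ ≤ _ := by
      apply mul_le_mul h5 h1 _ (by positivity)
      have : 0 ≤ 1 - 5 * M ^ 2 := by linarith
      positivity

lemma kk_diff (a₁ c₁ a₂ c₂ r w : ℝ) (hr : 0 < r) (hc2 : |c₂| ≤ r)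
    (ha1 : |a₁| ≤ r) (ha2 : |a₂| ≤ r) (hA : |a₁ - a₂| ≤ w * r) (hC : |c₁ - c₂| ≤ w * r) :
    |kk a₁ c₁ r - kk a₂ c₂ r| ≤ 45 * w / r ^ 3 := by
  have hw : 0 ≤ w * r := (abs_nonneg _).trans hA
  have hK := KK_diff a₁ a₂ r hr
  have h5 := I5_diff a₁ a₂ r hr
  have hI5 := I5_le a₁ hr
  have hI5p : 0 ≤ II a₁ r ^ 5 := by have := II_pos a₁ hr; positivity
  have hN2 : |a₂ - c₂| ≤ 2 * r := by
    calc _ ≤ |a₂| + |c₂| := abs_sub _ _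
      _ ≤ _ := by linarith
  have hND : |(a₁ - c₁) - (a₂ - c₂)| ≤ 2 * (w * r) := by
    calc _ = |(a₁ - a₂) - (c₁ - c₂)| := by ring_nf
      _ ≤ |a₁ - a₂| + |c₁ - c₂| := abs_sub _ _
      _ ≤ _ := by linarith
  have e : kk a₁ c₁ r - kk a₂ c₂ r = (KK a₁ r - KK a₂ r)
     - 3 * (((a₁ - c₁) - (a₂ - c₂)) * a₁ + (a₂ - c₂) * (a₁ - a₂)) * II a₁ r ^ 5
     - 3 * ((a₂ - c₂) * a₂) * (II a₁ r ^ 5 - II a₂ r ^ 5) := by unfold kk KK; ring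
  rw [e]
  have t1 : |KK a₁ r - KK a₂ r| ≤ 3 * (w * r) / r ^ 4 := hK.trans (by gcongr)
  have t2 : |3 * (((a₁ - c₁) - (a₂ - c₂)) * a₁ + (a₂ - c₂) * (a₁ - a₂)) * II a₁ r ^ 5| ≤
      3 * (2 * (w * r) * r + 2 * r * (w * r)) * (1 / r ^ 5) := by
    rw [abs_mul, abs_mul, abs_of_nonneg hI5p, abs_of_pos (show (0:ℝ) < 3 by norm_num)]
    gcongr
    calc _ ≤ |((a₁ - c₁) - (a₂ - c₂)) * a₁| + |(a₂ - c₂) * (a₁ - a₂)| := abs_add_le _ _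
      _ ≤ _ := by rw [abs_mul, abs_mul]; gcongr
  have t3 : |3 * ((a₂ - c₂) * a₂) * (II a₁ r ^ 5 - II a₂ r ^ 5)| ≤
      3 * (2 * r * r) * (5 * (w * r) / r ^ 6) := by
    rw [abs_mul, abs_mul, abs_mul, abs_of_pos (show (0:ℝ) < 3 by norm_num)]
    gcongr
    exact h5.trans (by gcongr)
  calc _ ≤ |KK a₁ r - KK a₂ r| +
      |3 * (((a₁ - c₁) - (a₂ - c₂)) * a₁ + (a₂ - c₂) * (a₁ - a₂)) * II a₁ r ^ 5| +
      |3 * ((a₂ - c₂) * a₂) * (II a₁ r ^ 5 - II a₂ r ^ 5)| :=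
        (abs_sub _ _).trans (by gcongr; exact abs_sub _ _)
    _ ≤ 3 * (w * r) / r ^ 4 + 3 * (2 * (w * r) * r + 2 * r * (w * r)) * (1 / r ^ 5) +
       3 * (2 * r * r) * (5 * (w * r) / r ^ 6) := by gcongr
    _ = 45 * w / r ^ 3 := by field_simp; ring
end Muskat
end Part1

section Part2
namespace Muskat

lemma finrank_E2 : Module.finrank ℝ E2 = 2 := by simp

lemma vol_ball_one : (volume : Measure E2).real (Metric.ball 0 1) = Real.pi := by
  rw [Measure.real, EuclideanSpace.volume_ball_fin_two]
  simp [Real.pi_pos.le]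

def near (ρ : ℝ) : Set E2 := {h | ‖h‖ < ρ}
def far (ρ : ℝ) : Set E2 := {h | ρ ≤ ‖h‖}

lemma near_meas (ρ : ℝ) : MeasurableSet (near ρ) :=
  measurableSet_lt measurable_norm measurable_const
lemma far_meas (ρ : ℝ) : MeasurableSet (far ρ) :=
  measurableSet_le measurable_const measurable_norm
lemma near_compl (ρ : ℝ) : (near ρ)ᶜ = far ρ := by
  ext h; simp [near, far]

lemma near_rpow {ρ s : ℝ} (hρ : 0 < ρ) (hs : -2 < s) :
    IntegrableOn (fun h : E2 => ‖h‖ ^ s) (near ρ) ∧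
    ∫ h in near ρ, ‖h‖ ^ s = 2 * Real.pi * (ρ ^ (s + 2) / (s + 2)) := by
  have e : (near ρ).indicator (fun h : E2 => ‖h‖ ^ s) =
      fun h : E2 => (Iio ρ).indicator (fun r : ℝ => r ^ s) ‖h‖ := by
    ext h; by_cases hh : ‖h‖ < ρ <;> simp [near, indicator, hh]
  have e2 : ∀ y ∈ Ioi (0:ℝ), y ^ (Module.finrank ℝ E2 - 1) • (Iio ρ).indicator (fun r : ℝ => r ^ s) y
      = (Iio ρ).indicator (fun r : ℝ => r ^ (s + 1)) y := by
    intro y hy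
    have hy : 0 < y := hy
    rw [finrank_E2]
    by_cases h : y < ρ
    · simp [h, Real.rpow_add hy, mul_comm]
    · simp [h]
  have hintg : IntervalIntegrable (fun r : ℝ => r ^ (s + 1)) volume 0 ρ :=
    intervalIntegral.intervalIntegrable_rpow' (by linarith)
  have h3 : Iio ρ ∩ Ioi 0 = Ioo 0 ρ := by ext; simp [and_comm]
  constructor
  · rw [← integrable_indicator_iff (near_meas ρ), e,
      integrable_fun_norm_addHaar (volume : Measure E2) (f := (Iio ρ).indicator (fun r : ℝ => r ^ s))]
    rw [integrableOn_congr_fun e2 measurableSet_Ioi, IntegrableOn,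
      integrable_indicator_iff measurableSet_Iio, IntegrableOn,
      Measure.restrict_restrict measurableSet_Iio, h3]
    exact ((intervalIntegrable_iff_integrableOn_Ioo_of_le hρ.le).1 hintg)
  · rw [← integral_indicator (near_meas ρ), e,
      integral_fun_norm_addHaar (volume : Measure E2) ((Iio ρ).indicator (fun r : ℝ => r ^ s)),
      setIntegral_congr_fun measurableSet_Ioi e2, vol_ball_one, finrank_E2,
      setIntegral_indicator measurableSet_Iio, inter_comm, h3, ← integral_Ioc_eq_integral_Ioo,
      ← intervalIntegral.integral_of_le hρ.le, integral_rpow (Or.inl (by linarith))]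
    rw [show s + 1 + 1 = s + 2 by ring, Real.zero_rpow (by linarith)]
    simp; ring

lemma far_rpow {ρ s : ℝ} (hρ : 0 < ρ) (hs : s < -2) :
    IntegrableOn (fun h : E2 => ‖h‖ ^ s) (far ρ) ∧
    ∫ h in far ρ, ‖h‖ ^ s = 2 * Real.pi * (ρ ^ (s + 2) / (-(s + 2))) := by
  have e : (far ρ).indicator (fun h : E2 => ‖h‖ ^ s) =
      fun h : E2 => (Ici ρ).indicator (fun r : ℝ => r ^ s) ‖h‖ := by
    ext h; by_cases hh : ρ ≤ ‖h‖ <;> simp [far, indicator, hh]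
  have e2 : ∀ y ∈ Ioi (0:ℝ), y ^ (Module.finrank ℝ E2 - 1) • (Ici ρ).indicator (fun r : ℝ => r ^ s) y
      = (Ici ρ).indicator (fun r : ℝ => r ^ (s + 1)) y := by
    intro y hy
    have hy : 0 < y := hy
    rw [finrank_E2]
    by_cases h : ρ ≤ y
    · simp [h, Real.rpow_add hy, mul_comm]
    · simp [h]
  have h3 : Ici ρ ∩ Ioi 0 = Ici ρ := by
    ext y; simp; intro h; linarith
  constructor
  · rw [← integrable_indicator_iff (far_meas ρ), e,
      integrable_fun_norm_addHaar (volume : Measure E2) (f := (Ici ρ).indicator (fun r : ℝ => r ^ s))]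
    rw [integrableOn_congr_fun e2 measurableSet_Ioi, IntegrableOn,
      integrable_indicator_iff measurableSet_Ici, IntegrableOn,
      Measure.restrict_restrict measurableSet_Ici, h3]
    refine (integrableOn_Ici_iff_integrableOn_Ioi (by simp)).2 (integrableOn_Ioi_rpow_of_lt (by linarith) hρ)
  · rw [← integral_indicator (far_meas ρ), e,
      integral_fun_norm_addHaar (volume : Measure E2) ((Ici ρ).indicator (fun r : ℝ => r ^ s)),
      setIntegral_congr_fun measurableSet_Ioi e2, vol_ball_one, finrank_E2,
      setIntegral_indicator measurableSet_Ici, inter_comm, h3, integral_Ici_eq_integral_Ioi,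
      integral_Ioi_rpow_of_lt (by linarith) hρ]
    rw [show s + 1 + 1 = s + 2 by ring, div_neg, neg_div]
    simp; ring

lemma near1 {ρ : ℝ} (hρ : 0 < ρ) : IntegrableOn (fun h : E2 => 1 / ‖h‖) (near ρ) ∧
    ∫ h in near ρ, 1 / ‖h‖ = 2 * Real.pi * ρ := by
  have := near_rpow hρ (show (-2:ℝ) < -1 by norm_num)
  have e : (fun h : E2 => 1 / ‖h‖) = fun h : E2 => ‖h‖ ^ (-1 : ℝ) := by
    ext h; rw [Real.rpow_neg_one, one_div]
  rw [e]
  refine ⟨this.1, this.2.trans ?_⟩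
  norm_num

lemma near32 {ρ : ℝ} (hρ : 0 < ρ) : IntegrableOn (fun h : E2 => √‖h‖ / ‖h‖ ^ 2) (near ρ) ∧
    ∫ h in near ρ, √‖h‖ / ‖h‖ ^ 2 = 4 * Real.pi * √ρ := by
  have := near_rpow hρ (show (-2:ℝ) < -(3/2) by norm_num)
  have e : (fun h : E2 => √‖h‖ / ‖h‖ ^ 2) = fun h : E2 => ‖h‖ ^ (-(3/2) : ℝ) := by
    ext h
    rcases eq_or_ne h 0 with rfl | hh
    · simp
    have : 0 < ‖h‖ := norm_pos_iff.2 hh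
    rw [show (-(3/2) : ℝ) = 1/2 - (2:ℕ) by norm_num, Real.rpow_sub_natCast this.ne', Real.sqrt_eq_rpow]
  rw [e]
  refine ⟨this.1, this.2.trans ?_⟩
  rw [Real.sqrt_eq_rpow]; norm_num; ring

lemma far52 {ρ : ℝ} (hρ : 0 < ρ) : IntegrableOn (fun h : E2 => √‖h‖ / ‖h‖ ^ 3) (far ρ) ∧
    ∫ h in far ρ, √‖h‖ / ‖h‖ ^ 3 = 4 * Real.pi / √ρ := by
  have := far_rpow hρ (show (-(5/2):ℝ) < -2 by norm_num)
  have e : (fun h : E2 => √‖h‖ / ‖h‖ ^ 3) = fun h : E2 => ‖h‖ ^ (-(5/2) : ℝ) := by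
    ext h
    rcases eq_or_ne h 0 with rfl | hh
    · simp
    have : 0 < ‖h‖ := norm_pos_iff.2 hh
    rw [show (-(5/2) : ℝ) = 1/2 - (3:ℕ) by norm_num, Real.rpow_sub_natCast this.ne', Real.sqrt_eq_rpow]
  rw [e]
  refine ⟨this.1, this.2.trans ?_⟩
  rw [Real.sqrt_eq_rpow, show (-(5/2) + 2 : ℝ) = -(1/2) by norm_num, Real.rpow_neg hρ.le]
  field_simp; norm_num

lemma far3 {ρ : ℝ} (hρ : 0 < ρ) : IntegrableOn (fun h : E2 => 1 / ‖h‖ ^ 3) (far ρ) ∧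
    ∫ h in far ρ, 1 / ‖h‖ ^ 3 = 2 * Real.pi / ρ := by
  have := far_rpow hρ (show (-3:ℝ) < -2 by norm_num)
  have e : (fun h : E2 => 1 / ‖h‖ ^ 3) = fun h : E2 => ‖h‖ ^ (-3 : ℝ) := by
    ext h
    rw [Real.rpow_neg (norm_nonneg _), one_div]; norm_cast
  rw [e]
  refine ⟨this.1, this.2.trans ?_⟩
  rw [show (-3 + 2 : ℝ) = -1 by norm_num, Real.rpow_neg_one]
  field_simp

/-- dominating function -/
def dom (ρ : ℝ) (h : E2) : ℝ := if ‖h‖ < ρ then 1 / ‖h‖ else 1 / ‖h‖ ^ 3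

lemma dom_int {ρ : ℝ} (hρ : 0 < ρ) : Integrable (dom ρ) := by
  rw [← integrableOn_univ, ← union_compl_self (near ρ), near_compl]
  apply IntegrableOn.union
  · refine (near1 hρ).1.congr_fun (fun h hh => ?_) (near_meas ρ)
    have : ‖h‖ < ρ := hh
    simp [dom, this]
  · refine (far3 hρ).1.congr_fun (fun h hh => ?_) (far_meas ρ)
    have : ρ ≤ ‖h‖ := hh
    simp [dom, this.not_gt]

lemma ae_ne_zero : ∀ᵐ h : E2, h ≠ 0 := by
  simp [ae_iff]
end Muskat
end Part2

section Part3
namespace Muskat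

/-- The basic modulus of continuity: its derivative is `(1 + √u)⁻²`. -/
def psi (u : ℝ) : ℝ := 2 * (Real.log (1 + √u) - √u / (1 + √u))
def dpsi (u : ℝ) : ℝ := 1 / (1 + √u) ^ 2

lemma psi_zero : psi 0 = 0 := by simp [psi]

lemma one_sqrt_pos (u : ℝ) : 0 < 1 + √u := by positivity

lemma psi_cont : Continuous psi := by
  unfold psi
  have h : ∀ u : ℝ, 1 + √u ≠ 0 := fun u => (one_sqrt_pos u).ne'
  fun_prop (disch := assumption)

lemma psi_deriv {u : ℝ} (hu : 0 < u) : HasDerivAt psi (dpsi u) u := by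
  have h1 : HasDerivAt (fun u : ℝ => 1 + √u) (1 / (2 * √u)) u :=
    (Real.hasDerivAt_sqrt hu.ne').const_add 1
  have h2 := h1.log (one_sqrt_pos u).ne'
  have h3 := (Real.hasDerivAt_sqrt hu.ne').div h1 (one_sqrt_pos u).ne'
  have h4 := (h2.sub h3).const_mul 2
  refine h4.congr_deriv ?_
  have := Real.sqrt_pos.2 hu
  have := one_sqrt_pos u
  unfold dpsi
  field_simp
  ring

lemma dpsi_pos (u : ℝ) : 0 < dpsi u := by unfold dpsi; have := one_sqrt_pos u; positivity

lemma dpsi_anti {a b : ℝ} (hab : a ≤ b) : dpsi b ≤ dpsi a := by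
  unfold dpsi
  have := one_sqrt_pos a
  gcongr

lemma psi_mono {a b : ℝ} (ha : 0 ≤ a) (hab : a ≤ b) : psi a ≤ psi b := by
  have : MonotoneOn psi (Ici 0) := by
    apply monotoneOn_of_deriv_nonneg (convex_Ici 0) psi_cont.continuousOn
    · intro x hx; rw [interior_Ici] at hx
      exact (psi_deriv hx).differentiableAt.differentiableWithinAt
    · intro x hx; rw [interior_Ici] at hx
      rw [(psi_deriv hx).deriv]; exact (dpsi_pos x).le
  exact this ha (ha.trans hab) hab

lemma psi_quad {u r R c : ℝ} (hu : 0 < u) (hr : 0 ≤ r) (hrR : r ≤ R)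
    (H : ∀ a b, 0 ≤ a → a ≤ b → b ≤ R ∨ b ≤ u → c * (b - a) ≤ dpsi a - dpsi b) :
    psi r ≤ psi u + dpsi u * (r - u) - c / 2 * (r - u) ^ 2 := by
  set F : ℝ → ℝ := fun r => psi r - dpsi u * (r - u) + c / 2 * (r - u) ^ 2 with hF
  have hFc : Continuous F := by
    have := psi_cont
    fun_prop
  have hFd : ∀ w, 0 < w → HasDerivAt F (dpsi w - dpsi u + c * (w - u)) w := by
    intro w hw
    have h1 : HasDerivAt (fun r : ℝ => dpsi u * (r - u)) (dpsi u) w := by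
      simpa using ((hasDerivAt_id w).sub_const u).const_mul (dpsi u)
    have h2 : HasDerivAt (fun r : ℝ => c / 2 * (r - u) ^ 2) (c * (w - u)) w := by
      refine ((((hasDerivAt_id w).sub_const u).pow 2).const_mul (c / 2)).congr_deriv ?_
      simp; ring
    exact ((psi_deriv hw).sub h1).add h2
  have key : F r ≤ F u := by
    rcases le_total r u with h | h
    · have : MonotoneOn F (Icc 0 u) := by
        apply monotoneOn_of_deriv_nonneg (convex_Icc 0 u) hFc.continuousOn
        · intro x hx; rw [interior_Icc] at hx
          exact (hFd x hx.1).differentiableAt.differentiableWithinAt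
        · intro x hx; rw [interior_Icc] at hx
          rw [(hFd x hx.1).deriv]
          have := H x u hx.1.le hx.2.le (Or.inr le_rfl)
          linarith
      exact this ⟨hr, h⟩ ⟨hu.le, le_rfl⟩ h
    · have : AntitoneOn F (Icc u r) := by
        apply antitoneOn_of_deriv_nonpos (convex_Icc u r) hFc.continuousOn
        · intro x hx; rw [interior_Icc] at hx
          exact (hFd x (hu.trans hx.1)).differentiableAt.differentiableWithinAt
        · intro x hx; rw [interior_Icc] at hx
          rw [(hFd x (hu.trans hx.1)).deriv]
          have := H u x hu.le hx.1.le (Or.inl (hx.2.le.trans hrR))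
          linarith
      exact this ⟨le_rfl, h⟩ ⟨h, le_rfl⟩ h
  simp only [hF] at key
  linarith [key]

lemma psi_tangent {u r : ℝ} (hu : 0 < u) (hr : 0 ≤ r) :
    psi r ≤ psi u + dpsi u * (r - u) := by
  have := psi_quad (c := 0) hu hr le_rfl (fun a b _ hab _ => by
    have := dpsi_anti hab; linarith)
  simpa using this

lemma psi_strict {u v : ℝ} (hu : 0 < u) (hv : |v| ≤ u) :
    psi (u + v) ≤ psi u + dpsi u * v - 1 / (√(2 * u) * (1 + √(2 * u)) ^ 3) / 2 * v ^ 2 := by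
  have hv' := abs_le.1 hv
  have := psi_quad (u := u) (r := u + v) (R := 2 * u)
    (c := 1 / (√(2 * u) * (1 + √(2 * u)) ^ 3)) hu (by linarith) (by linarith) ?_
  · simpa using this
  intro a b ha hab hb
  have hb : b ≤ 2 * u := by rcases hb with h | h <;> linarith
  unfold dpsi
  have sa := Real.sq_sqrt ha
  have sb := Real.sq_sqrt (ha.trans hab)
  have ha' := Real.sqrt_nonneg a
  have hab' := Real.sqrt_le_sqrt hab
  have hb' := Real.sqrt_le_sqrt hb
  have hB : 0 < √(2 * u) := Real.sqrt_pos.2 (by linarith)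
  set p := √a
  set q := √b
  set B := √(2 * u)
  rw [← sa, ← sb]
  have hq : 0 ≤ q := ha'.trans hab'
  rw [show 1 / (1 + p) ^ 2 - 1 / (1 + q) ^ 2 = (q - p) * (2 + p + q) / ((1 + p) ^ 2 * (1 + q) ^ 2) by
    field_simp; ring]
  rw [show 1 / (B * (1 + B) ^ 3) * (q ^ 2 - p ^ 2) = (q - p) * (p + q) / (B * (1 + B) ^ 3) by
    field_simp; ring]
  rw [div_le_div_iff₀ (by positivity) (by positivity), mul_assoc, mul_assoc]
  apply mul_le_mul_of_nonneg_left _ (by linarith)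
  calc (p + q) * ((1 + p) ^ 2 * (1 + q) ^ 2)
      ≤ (p + q) * ((1 + B) ^ 2 * (1 + B) ^ 2) := by
        have : p ≤ B := hab'.trans hb'
        gcongr
    _ = ((p + q) * (1 + B)) * (1 + B) ^ 3 := by ring
    _ ≤ ((2 + p + q) * B) * (1 + B) ^ 3 := by
        have : p ≤ B := hab'.trans hb'
        refine mul_le_mul_of_nonneg_right ?_ (by positivity)
        nlinarith
    _ = _ := by ring

lemma dpsi_le_one (u : ℝ) : dpsi u ≤ 1 := by
  unfold dpsi
  have := Real.sqrt_nonneg u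
  rw [div_le_one (by positivity)]; nlinarith

lemma mul_dpsi_le {u : ℝ} (hu : 0 ≤ u) : u * dpsi u ≤ 1 := by
  unfold dpsi
  have h := Real.sqrt_nonneg u
  have h2 := Real.sq_sqrt hu
  rw [mul_one_div, div_le_one (by positivity)]; nlinarith

lemma mul_dpsi_le_psi {u : ℝ} (hu : 0 ≤ u) : u * dpsi u ≤ psi u := by
  rcases hu.eq_or_lt with h | h
  · rw [← h]; simp [psi_zero]
  have := psi_tangent h le_rfl
  rw [psi_zero] at this; linarith

lemma psi_cmp {u v : ℝ} (hu : 0 ≤ u) (hv : 0 ≤ v) (G dG : ℝ → ℝ)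
    (hG : Continuous G) (hdG : ∀ w, 0 < w → HasDerivAt G (dG w) w)
    (h : ∀ w, 0 < w → w ≤ v → dpsi (u + w) ≤ dG w) : psi (u + v) - psi u ≤ G v - G 0 := by
  have : AntitoneOn (fun w => psi (u + w) - G w) (Icc 0 v) := by
    have hd : ∀ w, 0 < w → HasDerivAt (fun w => psi (u + w) - G w) (dpsi (u + w) - dG w) w := by
      intro w hw
      have := (psi_deriv (show 0 < u + w by linarith)).comp w ((hasDerivAt_id w).const_add u)
      simp only [mul_one] at this
      exact this.sub (hdG w hw)
    have := psi_cont
    apply antitoneOn_of_deriv_nonpos (convex_Icc 0 v) (by fun_prop)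
    · intro x hx; rw [interior_Icc] at hx
      exact (hd x hx.1).differentiableAt.differentiableWithinAt
    · intro x hx; rw [interior_Icc] at hx
      rw [(hd x hx.1).deriv]
      linarith [h x hx.1 hx.2.le]
  have := this ⟨le_rfl, hv⟩ ⟨hv, le_rfl⟩ hv
  simp only [add_zero] at this
  linarith

lemma psi_le {u : ℝ} (hu : 0 ≤ u) : psi u ≤ u := by
  have := psi_cmp le_rfl hu (fun w => w) (fun _ => 1) (by fun_prop)
    (fun w _ => hasDerivAt_id w) (fun w _ _ => dpsi_le_one _)
  simpa [psi_zero] using this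

lemma psi_add_le {u v : ℝ} (hu : 0 ≤ u) (hv : 0 ≤ v) : psi (u + v) - psi u ≤ √v / 2 := by
  have := psi_cmp hu hv (fun w => √w / 2) (fun w => 1 / (2 * √w) / 2) (by fun_prop)
    (fun w hw => (Real.hasDerivAt_sqrt hw.ne').div_const 2) (fun w hw _ => by
      unfold dpsi
      have h1 := Real.sqrt_le_sqrt (show w ≤ u + w by linarith)
      have h2 := Real.sqrt_pos.2 hw
      rw [div_div]
      apply one_div_le_one_div_of_le (by positivity)
      nlinarith [sq_nonneg (1 - √(u + w))])
  simpa using this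

lemma psi_add_le' {u v : ℝ} (hu : 0 < u) (hv : 0 ≤ v) : psi (u + v) - psi u ≤ √v / √u := by
  have h3 := Real.sqrt_pos.2 hu
  have := psi_cmp hu.le hv (fun w => √w / √u) (fun w => 1 / (2 * √w) / √u) (by fun_prop)
    (fun w hw => (Real.hasDerivAt_sqrt hw.ne').div_const _) (fun w hw _ => by
      unfold dpsi
      have h1 := Real.sq_sqrt (show 0 ≤ u + w by linarith)
      have h2 := Real.sqrt_pos.2 hw
      have h4 := Real.sq_sqrt hu.le
      have h5 := Real.sq_sqrt hw.le
      have h6 := Real.sqrt_nonneg (u + w)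
      rw [div_div]
      apply one_div_le_one_div_of_le (by positivity)
      nlinarith [sq_nonneg (√u - √w)])
  simpa using this

lemma psi_le_sub {v : ℝ} (hv : 0 ≤ v) (hv1 : v ≤ 1) : psi v ≤ v - v * √v / 2 := by
  have := psi_cmp le_rfl hv (fun w => w - w * √w / 2)
    (fun w => 1 - (1 * √w + w * (1 / (2 * √w))) / 2) (by fun_prop)
    (fun w hw => (hasDerivAt_id w).sub
      (((hasDerivAt_id w).mul (Real.hasDerivAt_sqrt hw.ne')).div_const 2)) (fun w hw hw1 => by
      unfold dpsi
      have h2 := Real.sqrt_pos.2 hw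
      have h5 := Real.sq_sqrt hw.le
      have h6 : √w ≤ 1 := Real.sqrt_le_one.2 (hw1.trans hv1)
      rw [zero_add]
      have e : w * (1 / (2 * √w)) = √w / 2 := by
        nth_rw 1 [← h5]; field_simp
      rw [e, div_le_iff₀ (by positivity)]
      have : 0 ≤ √w * (1 - √w) * (5 + 3 * √w) := by
        apply mul_nonneg (mul_nonneg h2.le (by linarith)) (by positivity)
      nlinarith)
  simpa [psi_zero] using this

lemma psi_pos {u : ℝ} (hu : 0 < u) : 0 < psi u :=
  lt_of_lt_of_le (mul_pos hu (dpsi_pos u)) (mul_dpsi_le_psi hu.le)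

lemma psi_tendsto : Tendsto psi atTop atTop := by
  have h1 : Tendsto (fun u : ℝ => Real.log (1 + √u)) atTop atTop :=
    Real.tendsto_log_atTop.comp (tendsto_atTop_add_const_left _ _ Real.tendsto_sqrt_atTop)
  have h2 : Tendsto (fun u : ℝ => 2 * (Real.log (1 + √u) + (-1))) atTop atTop :=
    (tendsto_atTop_add_const_right _ _ h1).const_mul_atTop (by norm_num)
  refine tendsto_atTop_mono (fun u => ?_) h2
  unfold psi
  have : √u / (1 + √u) ≤ 1 := by
    rw [div_le_one (one_sqrt_pos u)]; linarith
  linarith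
end Muskat
end Part3

section Part4
namespace Muskat

structure Nice (C : ℝ) (g : E2 → ℝ) (G : E2 → E2) (H : E2 → E2 →L[ℝ] E2) : Prop where
  hC : 0 ≤ C
  hg : ∀ x, HasGradientAt g (G x) x
  hG : ∀ x, HasFDerivAt G (H x) x
  sym : ∀ x a b, ⟪H x a, b⟫ = ⟪H x b, a⟫
  bg : ∀ x, |g x| ≤ C
  bG : ∀ x, ‖G x‖ ≤ C
  bH : ∀ x, ‖H x‖ ≤ C
  lH : ∀ x y, ‖H x - H y‖ ≤ C * ‖x - y‖

variable {C : ℝ} {g : E2 → ℝ} {G : E2 → E2} {H : E2 → E2 →L[ℝ] E2}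

lemma Nice.line (n : Nice C g G H) (x h : E2) (s : ℝ) :
    HasDerivAt (fun s : ℝ => g (x + s • h)) ⟪G (x + s • h), h⟫ s := by
  have h1 : HasDerivAt (fun s : ℝ => x + s • h) h s := by
    simpa using ((hasDerivAt_id s).smul_const h).const_add x
  have := (n.hg (x + s • h)).hasFDerivAt.comp_hasDerivAt s h1
  exact this.congr_deriv (by simp)

lemma Nice.lineG (n : Nice C g G H) (x h : E2) (s : ℝ) :
    HasDerivAt (fun s : ℝ => G (x + s • h)) (H (x + s • h) h) s := by
  have h1 : HasDerivAt (fun s : ℝ => x + s • h) h s := by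
    simpa using ((hasDerivAt_id s).smul_const h).const_add x
  exact (n.hG (x + s • h)).comp_hasDerivAt s h1

lemma Nice.N_le (n : Nice C g G H) (x h : E2) {B : ℝ}
    (hB : ∀ s ∈ Ico (0:ℝ) 1, ‖G (x + s • h) - G x‖ ≤ B) :
    |g (x + h) - g x - ⟪G x, h⟫| ≤ B * ‖h‖ := by
  have h1 : ∀ s : ℝ, HasDerivAt (fun s : ℝ => g (x + s • h) - s * ⟪G x, h⟫)
      (⟪G (x + s • h) - G x, h⟫) s := by
    intro s
    have := (n.line x h s).sub ((hasDerivAt_id s).mul_const ⟪G x, h⟫)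
    exact this.congr_deriv (by rw [inner_sub_left]; simp)
  have := norm_image_sub_le_of_norm_deriv_le_segment_01' (C := B * ‖h‖)
    (fun s _ => (h1 s).hasDerivWithinAt) (fun s hs => by
      refine (norm_inner_le_norm _ _).trans ?_
      gcongr
      exact hB s hs)
  simp only [one_smul, one_mul, zero_smul, zero_mul, add_zero, sub_zero, Real.norm_eq_abs] at this
  rwa [show g (x + h) - g x - ⟪G x, h⟫ = g (x + h) - ⟪G x, h⟫ - g x by ring]

lemma Nice.dl_le' (n : Nice C g G H) (x h : E2) {B : ℝ} (hB : ∀ y, ‖G y‖ ≤ B) :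
    |g (x + h) - g x| ≤ B * ‖h‖ := by
  have := norm_image_sub_le_of_norm_deriv_le_segment_01' (C := B * ‖h‖)
    (fun s _ => (n.line x h s).hasDerivWithinAt) (fun s hs => by
      refine (norm_inner_le_norm _ _).trans ?_
      gcongr
      exact hB _)
  simpa using this

lemma Nice.dl_le (n : Nice C g G H) (x h : E2) : |g (x + h) - g x| ≤ C * ‖h‖ :=
  n.dl_le' x h n.bG

lemma Nice.dG_le' (n : Nice C g G H) (x h : E2) {B : ℝ} (hB : ∀ y, ‖H y‖ ≤ B) :
    ‖G (x + h) - G x‖ ≤ B * ‖h‖ := by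
  have := norm_image_sub_le_of_norm_deriv_le_segment_01' (C := B * ‖h‖)
    (fun s _ => (n.lineG x h s).hasDerivWithinAt) (fun s hs => by
      refine (ContinuousLinearMap.le_opNorm _ _).trans ?_
      gcongr
      exact hB _)
  simpa using this

lemma Nice.dG_le (n : Nice C g G H) (x h : E2) : ‖G (x + h) - G x‖ ≤ C * ‖h‖ :=
  n.dG_le' x h n.bH

lemma Nice.dGP_le (n : Nice C g G H) (x h : E2) :
    ‖G (x + h) - G x - H x h‖ ≤ C * ‖h‖ ^ 2 := by
  have hC := n.hC
  have h1 : ∀ s : ℝ, HasDerivAt (fun s : ℝ => G (x + s • h) - s • H x h)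
      (H (x + s • h) h - H x h) s := by
    intro s
    have := (n.lineG x h s).sub ((hasDerivAt_id s).smul_const (H x h))
    exact this.congr_deriv (by simp)
  have := norm_image_sub_le_of_norm_deriv_le_segment_01' (C := C * ‖h‖ ^ 2)
    (fun s _ => (h1 s).hasDerivWithinAt) (fun s hs => by
      rw [← sub_apply]
      refine (ContinuousLinearMap.le_opNorm _ _).trans ?_
      have := n.lH (x + s • h) x
      rw [add_sub_cancel_left, norm_smul, Real.norm_eq_abs, abs_of_nonneg hs.1] at this
      calc _ ≤ (C * (s * ‖h‖)) * ‖h‖ := by gcongr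
        _ ≤ (C * (1 * ‖h‖)) * ‖h‖ := by gcongr; exact hs.2.le
        _ = _ := by ring)
  simp only [one_smul, zero_smul, add_zero, sub_zero] at this
  rwa [sub_right_comm] at this

lemma Nice.N2_le (n : Nice C g G H) (x h : E2) :
    |g (x + h) - g x - ⟪G x, h⟫| ≤ C * ‖h‖ ^ 2 := by
  have hC := n.hC
  have := n.N_le x h (B := C * ‖h‖) (fun s hs => by
    refine (n.dG_le x (s • h)).trans ?_
    rw [norm_smul, Real.norm_eq_abs, abs_of_nonneg hs.1]
    calc C * (s * ‖h‖) ≤ C * (1 * ‖h‖) := by gcongr; exact hs.2.le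
      _ = _ := by ring)
  linarith [this, show C * ‖h‖ * ‖h‖ = C * ‖h‖ ^ 2 by ring]

lemma Nice.contg (n : Nice C g G H) : Continuous g :=
  continuous_iff_continuousAt.2 fun x => (n.hg x).hasFDerivAt.continuousAt
lemma Nice.contG (n : Nice C g G H) : Continuous G :=
  continuous_iff_continuousAt.2 fun x => (n.hG x).continuousAt
lemma Nice.contH (n : Nice C g G H) : Continuous H := by
  have : LipschitzWith ⟨C, n.hC⟩ H := LipschitzWith.of_dist_le_mul fun x y => by
    rw [dist_eq_norm, dist_eq_norm]; exact n.lH x y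
  exact this.continuous

/-- regularized integrand -/
def Gr (ρ : ℝ) (g : E2 → ℝ) (G : E2 → E2) (x h : E2) : ℝ :=
  (g (x + h) - g x - ⟪G x, h⟫) * KK (g (x + h) - g x) ‖h‖ +
    (if ‖h‖ < ρ then 0 else ⟪G x, h⟫ / ‖h‖ ^ 3)

/-- its directional derivative -/
def Jr (ρ : ℝ) (g : E2 → ℝ) (G : E2 → E2) (H : E2 → E2 →L[ℝ] E2) (x e h : E2) : ℝ :=
  ⟪G (x + h) - G x, e⟫ * kk (g (x + h) - g x) ⟪G x, h⟫ ‖h‖ -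
    ⟪H x h, e⟫ * (KK (g (x + h) - g x) ‖h‖ - if ‖h‖ < ρ then 0 else 1 / ‖h‖ ^ 3)

lemma KK_hasDeriv (a : ℝ) {r : ℝ} (hr : 0 < r) :
    HasDerivAt (fun a => KK a r) (-3 * a * II a r ^ 5) a := by
  have hp : 0 < a ^ 2 + r ^ 2 := by positivity
  have h1 : HasDerivAt (fun a : ℝ => a ^ 2 + r ^ 2) (2 * a) a := by
    simpa using (hasDerivAt_pow 2 a).add_const (r ^ 2)
  have h2 := ((h1.sqrt hp.ne').inv (Real.sqrt_pos.2 hp).ne').pow 3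
  have h3 := Real.sqrt_pos.2 hp
  refine HasDerivAt.congr_deriv (f := fun a => KK a r) h2 ?_
  simp only [Pi.inv_apply, II]
  push_cast
  field_simp

lemma Nice.Gr_deriv (n : Nice C g G H) (ρ : ℝ) (x e h : E2) (hh : h ≠ 0) (s : ℝ) :
    HasDerivAt (fun s : ℝ => Gr ρ g G (x + s • e) h) (Jr ρ g G H (x + s • e) e h) s := by
  have hr : 0 < ‖h‖ := norm_pos_iff.2 hh
  have h1 : HasDerivAt (fun s : ℝ => g (x + s • e + h) - g (x + s • e))
      ⟪G (x + s • e + h) - G (x + s • e), e⟫ s := by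
    have := (n.line (x + h) e s).sub (n.line x e s)
    simp only [add_right_comm x h] at this
    exact this.congr_deriv (by rw [inner_sub_left])
  have h2 : HasDerivAt (fun s : ℝ => ⟪G (x + s • e), h⟫) ⟪H (x + s • e) h, e⟫ s := by
    have := (n.lineG x e s).inner ℝ (hasDerivAt_const s h)
    rw [n.sym]
    simpa using this
  have h3 := (KK_hasDeriv (g (x + s • e + h) - g (x + s • e)) hr).comp s h1
  have h4 := ((h1.sub h2).mul h3).add (f := fun s : ℝ =>
    (g (x + s • e + h) - g (x + s • e) - ⟪G (x + s • e), h⟫) * KK (g (x + s • e + h) - g (x + s • e)) ‖h‖)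
    (g := fun s : ℝ => if ‖h‖ < ρ then 0 else ⟪G (x + s • e), h⟫ / ‖h‖ ^ 3)
    (g' := if ‖h‖ < ρ then 0 else ⟪H (x + s • e) h, e⟫ / ‖h‖ ^ 3) (by
      split_ifs
      · exact hasDerivAt_const _ _
      · exact h2.div_const _)
  unfold Gr
  refine h4.congr_deriv ?_
  unfold Jr kk KK
  simp only [Function.comp, Pi.sub_apply]
  split_ifs <;> ring
end Muskat
end Part4

section Part5
namespace Muskat
variable {C : ℝ} {g : E2 → ℝ} {G : E2 → E2} {H : E2 → E2 →L[ℝ] E2}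

def CJ (C : ℝ) : ℝ := C + 3 * C ^ 3 + 2 * C * (1 + 6 * C ^ 2) + 6 * C ^ 2

lemma abs_inner_le_unit (a : E2) {e : E2} (he : ‖e‖ ≤ 1) : |⟪a, e⟫| ≤ ‖a‖ :=
  (abs_real_inner_le_norm a e).trans (by nlinarith [norm_nonneg a])

lemma Nice.dl2 (n : Nice C g G H) (x h : E2) : |g (x + h) - g x| ≤ 2 * C := by
  have := abs_sub (g (x + h)) (g x)
  linarith [n.bg (x + h), n.bg x]

lemma Nice.c_le (n : Nice C g G H) (x h : E2) : |⟪G x, h⟫| ≤ C * ‖h‖ :=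
  (abs_real_inner_le_norm _ _).trans (by gcongr; exact n.bG x)

lemma Nice.KKd (n : Nice C g G H) (x : E2) {h : E2} (hr : 0 < ‖h‖) :
    |KK (g (x + h) - g x) ‖h‖ - 1 / ‖h‖ ^ 3| ≤ 6 * C / ‖h‖ ^ 4 := by
  rw [← KK_zero hr]
  refine (KK_diff _ _ _ hr).trans ?_
  have := n.dl2 x h
  rw [sub_zero]
  exact div_le_div_of_nonneg_right (by linarith) (by positivity)

lemma Nice.Gr_bound (n : Nice C g G H) {ρ : ℝ} (x : E2) {h : E2} (hh : h ≠ 0) :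
    |Gr ρ g G x h| ≤ (CJ C + 2 * C) * dom ρ h := by
  have hr : 0 < ‖h‖ := norm_pos_iff.2 hh
  have hC := n.hC
  have hK0 := KK_nonneg (g (x + h) - g x) hr
  have hK := KK_le (g (x + h) - g x) hr
  have hC3 : 0 ≤ C ^ 3 := by positivity
  unfold Gr dom CJ
  split_ifs with hρ
  · rw [add_zero, abs_mul, abs_of_nonneg hK0]
    calc _ ≤ (C * ‖h‖ ^ 2) * (1 / ‖h‖ ^ 3) := by gcongr; exact n.N2_le x h
      _ = C * (1 / ‖h‖) := by field_simp
      _ ≤ _ := by refine mul_le_mul_of_nonneg_right ?_ (by positivity); nlinarith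
  · have e : (g (x + h) - g x - ⟪G x, h⟫) * KK (g (x + h) - g x) ‖h‖ + ⟪G x, h⟫ / ‖h‖ ^ 3
        = (g (x + h) - g x) * KK (g (x + h) - g x) ‖h‖ -
          ⟪G x, h⟫ * (KK (g (x + h) - g x) ‖h‖ - 1 / ‖h‖ ^ 3) := by ring
    rw [e]
    refine (abs_sub _ _).trans ?_
    rw [abs_mul, abs_mul, abs_of_nonneg hK0]
    calc _ ≤ (2 * C) * (1 / ‖h‖ ^ 3) + (C * ‖h‖) * (6 * C / ‖h‖ ^ 4) := by
          gcongr
          · exact n.dl2 x h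
          · exact n.c_le x h
          · exact n.KKd x hr
      _ = (2 * C + 6 * C ^ 2) * (1 / ‖h‖ ^ 3) := by field_simp
      _ ≤ _ := by refine mul_le_mul_of_nonneg_right ?_ (by positivity); nlinarith

lemma Nice.Jr_bound (n : Nice C g G H) {ρ : ℝ} (x : E2) {e h : E2} (he : ‖e‖ ≤ 1) (hh : h ≠ 0) :
    |Jr ρ g G H x e h| ≤ CJ C * dom ρ h := by
  have hr : 0 < ‖h‖ := norm_pos_iff.2 hh
  have hC := n.hC
  have hK0 := KK_nonneg (g (x + h) - g x) hr
  have hK := KK_le (g (x + h) - g x) hr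
  have hC3 : 0 ≤ C ^ 3 := by positivity
  have hI0 := (II_pos (g (x + h) - g x) hr).le
  have hI5 := I5_le (g (x + h) - g x) hr
  unfold Jr dom CJ
  split_ifs with hρ
  · have e1 : ⟪G (x + h) - G x, e⟫ * kk (g (x + h) - g x) ⟪G x, h⟫ ‖h‖ -
        ⟪H x h, e⟫ * (KK (g (x + h) - g x) ‖h‖ - 0) =
        ⟪G (x + h) - G x - H x h, e⟫ * KK (g (x + h) - g x) ‖h‖ -
        3 * (g (x + h) - g x - ⟪G x, h⟫) * (g (x + h) - g x) * ⟪G (x + h) - G x, e⟫ *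
          II (g (x + h) - g x) ‖h‖ ^ 5 := by
      rw [inner_sub_left (G (x + h) - G x)]; unfold kk KK; ring
    rw [e1]
    refine (abs_sub _ _).trans ?_
    simp only [abs_mul]
    rw [abs_of_nonneg hK0, abs_of_nonneg (pow_nonneg hI0 5), abs_of_pos (show (0:ℝ) < 3 by norm_num)]
    calc _ ≤ (C * ‖h‖ ^ 2) * (1 / ‖h‖ ^ 3) +
          3 * (C * ‖h‖ ^ 2) * (C * ‖h‖) * (C * ‖h‖) * (1 / ‖h‖ ^ 5) := by
          gcongr
          · exact (abs_inner_le_unit _ he).trans (n.dGP_le x h)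
          · exact n.N2_le x h
          · exact n.dl_le x h
          · exact (abs_inner_le_unit _ he).trans (n.dG_le x h)
      _ = (C + 3 * C ^ 3) * (1 / ‖h‖) := by field_simp
      _ ≤ _ := by refine mul_le_mul_of_nonneg_right ?_ (by positivity); nlinarith
  · refine (abs_sub _ _).trans ?_
    rw [abs_mul, abs_mul]
    have h1 : |⟪G (x + h) - G x, e⟫| ≤ 2 * C :=
      (abs_inner_le_unit _ he).trans ((norm_sub_le _ _).trans (by linarith [n.bG (x + h), n.bG x]))
    have h2 : |⟪H x h, e⟫| ≤ C * ‖h‖ := (abs_inner_le_unit _ he).trans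
      ((ContinuousLinearMap.le_opNorm _ _).trans (by gcongr; exact n.bH x))
    have h3 : |kk (g (x + h) - g x) ⟪G x, h⟫ ‖h‖| ≤ (1 + 6 * C ^ 2) * (1 / ‖h‖ ^ 3) := by
      unfold kk
      refine (abs_sub _ _).trans ?_
      simp only [abs_mul]
      rw [abs_of_nonneg (pow_nonneg hI0 5), abs_of_nonneg (pow_nonneg hI0 3),
        abs_of_pos (show (0:ℝ) < 3 by norm_num)]
      have hN : |g (x + h) - g x - ⟪G x, h⟫| ≤ 2 * (C * ‖h‖) :=
        (abs_sub _ _).trans (by linarith [n.dl_le x h, n.c_le x h])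
      calc _ ≤ 1 / ‖h‖ ^ 3 + 3 * (2 * (C * ‖h‖)) * (C * ‖h‖) * (1 / ‖h‖ ^ 5) := by
            gcongr
            · exact hK
            · exact n.dl_le x h
        _ = _ := by field_simp; ring
    calc _ ≤ (2 * C) * ((1 + 6 * C ^ 2) * (1 / ‖h‖ ^ 3)) + (C * ‖h‖) * (6 * C / ‖h‖ ^ 4) := by
          gcongr
          exact n.KKd x hr
      _ = (2 * C * (1 + 6 * C ^ 2) + 6 * C ^ 2) * (1 / ‖h‖ ^ 3) := by field_simp
      _ ≤ _ := by refine mul_le_mul_of_nonneg_right ?_ (by positivity); nlinarith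

lemma meas_II {a b : E2 → ℝ} (ha : Measurable a) (hb : Measurable b) :
    Measurable fun h => II (a h) (b h) := by
  unfold II; exact (((ha.pow_const 2).add (hb.pow_const 2)).sqrt).inv

lemma Nice.meas_dl (n : Nice C g G H) (x : E2) : Measurable fun h => g (x + h) - g x := by
  have := n.contg
  exact (by fun_prop : Continuous fun h => g (x + h) - g x).measurable

lemma meas_inner (v : E2) : Measurable fun h : E2 => ⟪v, h⟫ :=
  (by fun_prop : Continuous fun h : E2 => ⟪v, h⟫).measurable

lemma Nice.meas_dG (n : Nice C g G H) (x e : E2) : Measurable fun h => ⟪G (x + h) - G x, e⟫ := by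
  have := n.contG
  exact (by fun_prop : Continuous fun h => ⟪G (x + h) - G x, e⟫).measurable

lemma meas_HP (A : E2 →L[ℝ] E2) (e : E2) : Measurable fun h : E2 => ⟪A h, e⟫ :=
  (by fun_prop : Continuous fun h : E2 => ⟪A h, e⟫).measurable

lemma Nice.Gr_meas (n : Nice C g G H) (ρ : ℝ) (x : E2) : Measurable (Gr ρ g G x) := by
  have h1 := meas_II (n.meas_dl x) measurable_norm
  have h2 := n.meas_dl x
  have h3 := meas_inner (G x)
  unfold Gr KK
  refine ((h2.sub h3).mul (h1.pow_const 3)).add ?_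
  exact Measurable.ite (near_meas ρ) measurable_const (h3.div (measurable_norm.pow_const 3))

lemma Nice.Jr_meas (n : Nice C g G H) (ρ : ℝ) (x e : E2) : Measurable (Jr ρ g G H x e) := by
  have h1 := meas_II (n.meas_dl x) measurable_norm
  have h2 := n.meas_dl x
  have h3 := meas_inner (G x)
  have h4 := meas_HP (H x) e
  have h5 := n.meas_dG x e
  unfold Jr KK kk
  refine (h5.mul ((h1.pow_const 3).sub ((((h2.sub h3).const_mul 3).mul h2).mul (h1.pow_const 5)))).sub
    (h4.mul ((h1.pow_const 3).sub ?_))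
  exact Measurable.ite (near_meas ρ) measurable_const (measurable_const.div (measurable_norm.pow_const 3))

lemma Nice.Gr_int (n : Nice C g G H) {ρ : ℝ} (hρ : 0 < ρ) (x : E2) : Integrable (Gr ρ g G x) := by
  refine ((dom_int hρ).const_mul (CJ C + 2 * C)).mono' (n.Gr_meas ρ x).aestronglyMeasurable ?_
  filter_upwards [ae_ne_zero] with h hh using n.Gr_bound x hh

lemma Nice.Jr_int (n : Nice C g G H) {ρ : ℝ} (hρ : 0 < ρ) (x : E2) {e : E2} (he : ‖e‖ ≤ 1) :
    Integrable (Jr ρ g G H x e) := by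
  refine ((dom_int hρ).const_mul (CJ C)).mono' (n.Jr_meas ρ x e).aestronglyMeasurable ?_
  filter_upwards [ae_ne_zero] with h hh using n.Jr_bound x he hh
end Muskat
end Part5

section Part6
namespace Muskat
variable {C : ℝ} {g : E2 → ℝ} {G : E2 → E2} {H : E2 → E2 →L[ℝ] E2}

lemma muskat_eq (g : E2 → ℝ) (x : E2) {h : E2} (hh : h ≠ 0) :
    muskatIntegrand 3 g x h = (g (x + h) - g x - ⟪gradient g x, h⟫) * KK (g (x + h) - g x) ‖h‖ := by
  have hr : 0 < ‖h‖ := norm_pos_iff.2 hh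
  unfold muskatIntegrand KK II
  have h0 : 0 ≤ (g (x + h) - g x) ^ 2 + ‖h‖ ^ 2 := by positivity
  generalize (g (x + h) - g x) ^ 2 + ‖h‖ ^ 2 = A at h0
  rw [div_eq_mul_inv, inv_pow, Real.sqrt_eq_rpow, ← Real.rpow_natCast (A ^ (1 / 2 : ℝ)), ← Real.rpow_mul h0]
  norm_num

def ann (R : ℝ) : Set E2 := {h : E2 | R⁻¹ < ‖h‖ ∧ ‖h‖ < R}
lemma ann_meas (R : ℝ) : MeasurableSet (ann R) :=
  (measurableSet_lt measurable_const measurable_norm).inter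
    (measurableSet_lt measurable_norm measurable_const)

lemma odd_zero (F : E2 → ℝ) (hF : ∀ h, F (-h) = - F h) : ∫ h, F h = 0 := by
  have := integral_neg_eq_self F volume
  simp only [hF, integral_neg] at this
  linarith

lemma Nice.pv (n : Nice C g G H) {ρ : ℝ} (hρ : 0 < ρ) (x : E2) {I : ℝ}
    (hI : HasPV (muskatIntegrand 3 g x) I) : I = ∫ h, Gr ρ g G x h := by
  have hgr : gradient g x = G x := (n.hg x).gradient
  have h1 : Tendsto (fun R : ℝ => ∫ h in ann R, Gr ρ g G x h) atTop (𝓝 (∫ h, Gr ρ g G x h)) := by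
    simp_rw [← integral_indicator (ann_meas _)]
    refine tendsto_integral_filter_of_dominated_convergence (fun h => |Gr ρ g G x h|) ?_ ?_ ?_ ?_
    · exact Eventually.of_forall fun R =>
        ((n.Gr_meas ρ x).indicator (ann_meas R)).aestronglyMeasurable
    · refine Eventually.of_forall fun R => Eventually.of_forall fun h => ?_
      exact norm_indicator_le_norm_self _ _
    · exact (n.Gr_int hρ x).abs
    · filter_upwards [ae_ne_zero] with h hh
      have hr : 0 < ‖h‖ := norm_pos_iff.2 hh
      refine tendsto_const_nhds.congr' ?_
      filter_upwards [eventually_gt_atTop ‖h‖, eventually_gt_atTop ‖h‖⁻¹] with R h1 h2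
      rw [indicator_of_mem]
      exact ⟨inv_lt_of_inv_lt₀ hr h2, h1⟩
  refine tendsto_nhds_unique hI (h1.congr' ?_)
  filter_upwards [eventually_gt_atTop 0] with R hR
  set F : E2 → ℝ := fun h => if ‖h‖ < ρ then 0 else ⟪G x, h⟫ / ‖h‖ ^ 3 with hF
  have hFm : Measurable F := Measurable.ite (near_meas ρ) measurable_const
    ((meas_inner (G x)).div (measurable_norm.pow_const 3))
  have hFi : IntegrableOn F (ann R) := by
    refine ((dom_int hρ).const_mul (C * R)).integrableOn.mono' hFm.aestronglyMeasurable ?_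
    filter_upwards [ae_restrict_mem (ann_meas R)] with h hh
    have hr : 0 < ‖h‖ := (inv_pos.2 hR).trans hh.1
    have hC := n.hC
    simp only [hF, dom]
    split_ifs
    · simp; positivity
    · rw [norm_div, Real.norm_eq_abs, norm_pow, norm_norm, ← mul_one_div]
      gcongr
      exact (n.c_le x h).trans (by gcongr; exact hh.2.le)
  have hF0 : ∫ h in ann R, F h = 0 := by
    rw [← integral_indicator (ann_meas _)]
    apply odd_zero
    intro h
    simp only [indicator, ann, hF, Set.mem_ofPred_eq, norm_neg, inner_neg_right]
    split_ifs <;> simp [neg_div]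
  have h2 : ∫ h in ann R, Gr ρ g G x h - F h = ∫ h in ann R, Gr ρ g G x h := by
    rw [integral_sub (n.Gr_int hρ x).integrableOn hFi, hF0, sub_zero]
  rw [← h2]
  refine setIntegral_congr_fun (ann_meas R) fun h hh => ?_
  have hr : 0 < ‖h‖ := (inv_pos.2 hR).trans hh.1
  simp only [Gr, hF]
  rw [muskat_eq g x (norm_pos_iff.1 hr), hgr]; ring

structure Data (T C : ℝ) (f : ℝ → E2 → ℝ) (G : ℝ → E2 → E2) (H : ℝ → E2 → E2 →L[ℝ] E2) : Prop where
  nice : ∀ t ∈ Icc 0 T, Nice C (f t) (G t) (H t)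
  cont : ∀ t₁ ∈ Icc 0 T, ∀ ε > (0 : ℝ), ∃ δ > (0 : ℝ), ∀ t ∈ Icc 0 T, |t - t₁| < δ → ∀ x : E2,
    |f t x - f t₁ x| ≤ ε ∧ ‖G t x - G t₁ x‖ ≤ ε ∧ ‖H t x - H t₁ x‖ ≤ ε
  decG : ∀ t ∈ Icc 0 T, Tendsto (fun x => ‖G t x‖) (cocompact E2) (𝓝 0)
  decH : ∀ t ∈ Icc 0 T, Tendsto (fun x => ‖H t x‖) (cocompact E2) (𝓝 0)
  diff : ∀ t ∈ Ioo 0 T, ∀ x : E2, DifferentiableAt ℝ (fun s => f s x) t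
  pv : ∀ t ∈ Ioo 0 T, ∀ x : E2, HasPV (muskatIntegrand 3 (f t) x) (deriv (fun s => f s x) t)

section jc
variable {X : Type*} [NormedAddCommGroup X]

lemma joint_cont {T t : ℝ} {u : ℝ → E2 → X} (x : E2) (hc : ContinuousAt (u t) x)
    (h : ∀ ε > (0 : ℝ), ∃ δ > (0 : ℝ), ∀ τ ∈ Icc 0 T, |τ - t| < δ → ∀ x, ‖u τ x - u t x‖ ≤ ε) :
    Tendsto (fun p : ℝ × E2 => u p.1 p.2) (𝓝[Icc 0 T] t ×ˢ 𝓝 x) (𝓝 (u t x)) := by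
  rw [Metric.tendsto_nhds]
  intro ε hε
  obtain ⟨δ, hδ, hd⟩ := h (ε / 2) (by linarith)
  have h1 : ∀ᶠ τ in 𝓝[Icc 0 T] t, ∀ y, ‖u τ y - u t y‖ ≤ ε / 2 := by
    filter_upwards [self_mem_nhdsWithin, mem_nhdsWithin_of_mem_nhds (Metric.ball_mem_nhds t hδ)] with τ h1 h2
    exact hd τ h1 (by simpa [Real.dist_eq] using h2)
  have h2 : ∀ᶠ y in 𝓝 x, dist (u t y) (u t x) < ε / 2 := Metric.tendsto_nhds.1 hc _ (by linarith)
  filter_upwards [h1.prod_mk h2] with p hp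
  have := hp.1 p.2
  rw [← dist_eq_norm] at this
  linarith [dist_triangle (u p.1 p.2) (u t p.2) (u t x), hp.2]
end jc

variable {T : ℝ} {f : ℝ → E2 → ℝ} {G : ℝ → E2 → E2} {H : ℝ → E2 → E2 →L[ℝ] E2}

lemma Data.jf (D : Data T C f G H) {t : ℝ} (ht : t ∈ Icc 0 T) (x : E2) :
    Tendsto (fun p : ℝ × E2 => f p.1 p.2) (𝓝[Icc 0 T] t ×ˢ 𝓝 x) (𝓝 (f t x)) :=
  joint_cont x (D.nice t ht).contg.continuousAt fun ε hε => by
    obtain ⟨δ, h1, h2⟩ := D.cont t ht ε hε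
    exact ⟨δ, h1, fun τ hτ h x => (h2 τ hτ h x).1⟩
lemma Data.jG (D : Data T C f G H) {t : ℝ} (ht : t ∈ Icc 0 T) (x : E2) :
    Tendsto (fun p : ℝ × E2 => G p.1 p.2) (𝓝[Icc 0 T] t ×ˢ 𝓝 x) (𝓝 (G t x)) :=
  joint_cont x (D.nice t ht).contG.continuousAt fun ε hε => by
    obtain ⟨δ, h1, h2⟩ := D.cont t ht ε hε
    exact ⟨δ, h1, fun τ hτ h x => (h2 τ hτ h x).2.1⟩
lemma Data.jH (D : Data T C f G H) {t : ℝ} (ht : t ∈ Icc 0 T) (x : E2) :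
    Tendsto (fun p : ℝ × E2 => H p.1 p.2) (𝓝[Icc 0 T] t ×ˢ 𝓝 x) (𝓝 (H t x)) :=
  joint_cont x (D.nice t ht).contH.continuousAt fun ε hε => by
    obtain ⟨δ, h1, h2⟩ := D.cont t ht ε hε
    exact ⟨δ, h1, fun τ hτ h x => (h2 τ hτ h x).2.2⟩

lemma Data.jJ (D : Data T C f G H) {t : ℝ} (ht : t ∈ Icc 0 T) (ρ : ℝ) (x e : E2) {h : E2} (hh : h ≠ 0) :
    Tendsto (fun p : ℝ × E2 => Jr ρ (f p.1) (G p.1) (H p.1) p.2 e h) (𝓝[Icc 0 T] t ×ˢ 𝓝 x)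
      (𝓝 (Jr ρ (f t) (G t) (H t) x e h)) := by
  have hr : 0 < ‖h‖ := norm_pos_iff.2 hh
  have hs : Tendsto (fun p : ℝ × E2 => (p.1, p.2 + h)) (𝓝[Icc 0 T] t ×ˢ 𝓝 x)
      (𝓝[Icc 0 T] t ×ˢ 𝓝 (x + h)) :=
    tendsto_fst.prodMk (tendsto_snd.add_const h)
  have a1 := D.jf ht x
  have a2 := (D.jf ht (x + h)).comp hs
  have b1 := D.jG ht x
  have b2 := (D.jG ht (x + h)).comp hs
  have c1 := D.jH ht x
  simp only [Function.comp_def] at a2 b2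
  have hdl := a2.sub a1
  have hc : Tendsto (fun p : ℝ × E2 => ⟪G p.1 p.2, h⟫) (𝓝[Icc 0 T] t ×ˢ 𝓝 x) (𝓝 ⟪G t x, h⟫) :=
    b1.inner tendsto_const_nhds
  have hI : Tendsto (fun p : ℝ × E2 => II (f p.1 (p.2 + h) - f p.1 p.2) ‖h‖) (𝓝[Icc 0 T] t ×ˢ 𝓝 x)
      (𝓝 (II (f t (x + h) - f t x) ‖h‖)) := by
    unfold II
    exact (((hdl.pow 2).add_const _).sqrt).inv₀ (sqrt_pos' _ hr).ne'
  have hth := (b2.sub b1).inner (tendsto_const_nhds (x := e)) (𝕜 := ℝ)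
  have hP : Tendsto (fun p : ℝ × E2 => ⟪H p.1 p.2 h, e⟫) (𝓝[Icc 0 T] t ×ˢ 𝓝 x) (𝓝 ⟪H t x h, e⟫) :=
    (((ContinuousLinearMap.apply ℝ E2 h).continuous.tendsto _).comp c1).inner tendsto_const_nhds
  unfold Jr kk KK
  exact (hth.mul ((hI.pow 3).sub ((((hdl.sub hc).const_mul 3).mul hdl).mul (hI.pow 5)))).sub
    (hP.mul ((hI.pow 3).sub tendsto_const_nhds))
end Muskat
end Part6

section Part7
namespace Muskat
variable {C : ℝ} {T : ℝ} {f : ℝ → E2 → ℝ} {G : ℝ → E2 → E2} {H : ℝ → E2 → E2 →L[ℝ] E2}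

lemma Data.Q_tendsto (D : Data T C f G H) {t : ℝ} (ht : t ∈ Icc 0 T) {ρ : ℝ} (hρ : 0 < ρ) (x : E2)
    {e : E2} (he : ‖e‖ ≤ 1) :
    Tendsto (fun p : ℝ × ℝ => ∫ h, (Gr ρ (f p.1) (G p.1) (x + p.2 • e) h - Gr ρ (f p.1) (G p.1) x h) / p.2)
      (𝓝[Icc 0 T] t ×ˢ 𝓝[>] 0) (𝓝 (∫ h, Jr ρ (f t) (G t) (H t) x e h)) := by
  have hmem : ∀ᶠ p : ℝ × ℝ in 𝓝[Icc 0 T] t ×ˢ 𝓝[>] 0, p.1 ∈ Icc 0 T ∧ 0 < p.2 :=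
    (eventually_mem_nhdsWithin (a := t) (s := Icc 0 T)).prod_mk
      (eventually_mem_nhdsWithin (a := (0:ℝ)) (s := Ioi 0))
  refine tendsto_integral_filter_of_dominated_convergence (fun h => CJ C * dom ρ h) ?_ ?_
    ((dom_int hρ).const_mul _) ?_
  · filter_upwards [hmem] with p hp
    have n := D.nice p.1 hp.1
    exact (((n.Gr_meas ρ _).sub (n.Gr_meas ρ _)).div_const _).aestronglyMeasurable
  · filter_upwards [hmem] with p hp
    filter_upwards [ae_ne_zero] with h hh
    have n := D.nice p.1 hp.1
    have h2 := hp.2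
    have := norm_image_sub_le_of_norm_deriv_le_segment' (C := CJ C * dom ρ h) (a := 0) (b := p.2)
      (fun s _ => (n.Gr_deriv ρ x e h hh s).hasDerivWithinAt) (fun s hs => n.Jr_bound _ he hh)
      p.2 (right_mem_Icc.2 h2.le)
    simp only [zero_smul, add_zero, sub_zero] at this
    rw [norm_div, Real.norm_eq_abs p.2, abs_of_pos h2, div_le_iff₀ h2]
    exact this
  · filter_upwards [ae_ne_zero] with h hh
    rw [Metric.tendsto_nhds]
    intro ε hε
    have h1 := Metric.tendsto_nhds.1 (D.jJ ht ρ x e hh) (ε / 2) (by linarith)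
    obtain ⟨p1, hp1, p2, hp2, h3⟩ := eventually_prod_iff.1 h1
    obtain ⟨r, hr, hr2⟩ := Metric.eventually_nhds_iff.1 hp2
    have h4 : ∀ᶠ s : ℝ in 𝓝[>] 0, s < r := mem_nhdsWithin_of_mem_nhds (Iio_mem_nhds hr)
    filter_upwards [hmem, hp1.prod_mk h4] with p hp hp'
    have n := D.nice p.1 hp.1
    have h2 := hp.2
    set J0 := Jr ρ (f t) (G t) (H t) x e h
    have := norm_image_sub_le_of_norm_deriv_le_segment' (C := ε / 2) (a := 0) (b := p.2)
      (fun s _ => ((n.Gr_deriv ρ x e h hh s).sub ((hasDerivAt_id s).mul_const J0)).hasDerivWithinAt)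
      (fun s hs => by
        have : dist (x + s • e) x < r := by
          rw [dist_eq_norm, add_sub_cancel_left, norm_smul, Real.norm_eq_abs, abs_of_nonneg hs.1]
          nlinarith [hs.1, hs.2, hp'.2, norm_nonneg e]
        have := h3 hp'.1 (hr2 this)
        rw [Real.dist_eq] at this
        rw [Real.norm_eq_abs, one_mul]
        exact this.le)
      p.2 (right_mem_Icc.2 h2.le)
    simp only [zero_smul, add_zero, sub_zero, Pi.sub_apply, id, zero_mul] at this
    rw [Real.dist_eq]
    refine lt_of_le_of_lt ?_ (half_lt_self hε)
    rw [show (Gr ρ (f p.1) (G p.1) (x + p.2 • e) h - Gr ρ (f p.1) (G p.1) x h) / p.2 - J0 =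
      (Gr ρ (f p.1) (G p.1) (x + p.2 • e) h - p.2 * J0 - Gr ρ (f p.1) (G p.1) x h) / p.2 by
        field_simp; ring, abs_div, abs_of_pos h2, div_le_iff₀ h2]
    exact this

lemma Data.deriv_eq (D : Data T C f G H) {t : ℝ} (ht : t ∈ Ioo 0 T) {ρ : ℝ} (hρ : 0 < ρ) (x : E2) :
    HasDerivAt (fun s => f s x) (∫ h, Gr ρ (f t) (G t) x h) t := by
  rw [← (D.nice t (Ioo_subset_Icc_self ht)).pv hρ x (D.pv t ht x)]
  exact (D.diff t ht x).hasDerivAt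

lemma Data.contf (D : Data T C f G H) (x : E2) : ContinuousOn (fun s => f s x) (Icc 0 T) := by
  intro t ht
  have h : Tendsto (fun s : ℝ => (s, x)) (𝓝[Icc 0 T] t) (𝓝[Icc 0 T] t ×ˢ 𝓝 x) :=
    tendsto_id.prodMk tendsto_const_nhds
  exact (D.jf ht x).comp h

/-- left derivative of `⟪G, e⟫` in time -/
lemma Data.left_deriv (D : Data T C f G H) {t : ℝ} (ht : t ∈ Ioc 0 T) {ρ : ℝ} (hρ : 0 < ρ) (x : E2)
    {e : E2} (he : ‖e‖ ≤ 1) {η : ℝ} (hη : 0 < η) :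
    ∀ᶠ s in 𝓝[<] t, |⟪G t x, e⟫ - ⟪G s x, e⟫ - (t - s) * ∫ h, Jr ρ (f t) (G t) (H t) x e h|
      ≤ η * (t - s) := by
  have htI : t ∈ Icc 0 T := ⟨ht.1.le, ht.2⟩
  have h1 := Metric.tendsto_nhds.1 (D.Q_tendsto htI hρ x he) η hη
  obtain ⟨p1, hp1, p2, hp2, h3⟩ := eventually_prod_iff.1 h1
  obtain ⟨r, hr, hr2⟩ := Metric.mem_nhdsWithin_iff.1 hp1
  set I := ∫ h, Jr ρ (f t) (G t) (H t) x e h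
  filter_upwards [Ioo_mem_nhdsLT (show max 0 (t - r) < t by simp [ht.1, hr])] with s hs
  have hs0 : 0 < s := (le_max_left _ _).trans_lt hs.1
  have hsr : t - r < s := (le_max_right _ _).trans_lt hs.1
  have hst := hs.2
  have hsT : s ∈ Icc 0 T := ⟨hs0.le, hst.le.trans ht.2⟩
  have key : ∀ᶠ ε : ℝ in 𝓝[>] 0, |((f t (x + ε • e) - f t x) / ε) - ((f s (x + ε • e) - f s x) / ε)
      - (t - s) * I| ≤ η * (t - s) := by
    filter_upwards [hp2, self_mem_nhdsWithin] with ε hε hε0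
    have hsub : Icc s t ⊆ Icc 0 T := Icc_subset_Icc hs0.le ht.2
    obtain ⟨τ, hτ, hτe⟩ := exists_hasDerivAt_eq_slope (fun τ => (f τ (x + ε • e) - f τ x) / ε)
      (fun τ => ((∫ h, Gr ρ (f τ) (G τ) (x + ε • e) h) - ∫ h, Gr ρ (f τ) (G τ) x h) / ε) hst
      ((((D.contf (x + ε • e)).sub (D.contf x)).div_const ε).mono hsub)
      (fun τ hτ => (((D.deriv_eq ⟨hs0.trans hτ.1, hτ.2.trans_le ht.2⟩ hρ (x + ε • e)).sub
        (D.deriv_eq ⟨hs0.trans hτ.1, hτ.2.trans_le ht.2⟩ hρ x)).div_const ε))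
    have hτI : τ ∈ Icc 0 T := hsub (Ioo_subset_Icc_self hτ)
    have n := D.nice τ hτI
    have hp : p1 τ := hr2 ⟨by
      rw [Metric.mem_ball, Real.dist_eq, abs_lt]; constructor <;> linarith [hτ.1, hτ.2], hτI⟩
    have h5 := h3 hp hε
    simp only at h5
    rw [integral_div, integral_sub (n.Gr_int hρ _) (n.Gr_int hρ _), Real.dist_eq, hτe] at h5
    have hts : 0 < t - s := by linarith
    have h6 : ((f t (x + ε • e) - f t x) / ε) - ((f s (x + ε • e) - f s x) / ε) - (t - s) * I =
      (((f t (x + ε • e) - f t x) / ε - (f s (x + ε • e) - f s x) / ε) / (t - s) - I) * (t - s) := by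
      generalize (f t (x + ε • e) - f t x) / ε - (f s (x + ε • e) - f s x) / ε = A
      rw [sub_mul (A / (t - s)), div_mul_cancel₀ _ hts.ne']; ring
    rw [h6, abs_mul, abs_of_pos hts]
    gcongr
  have hlim : ∀ τ ∈ Icc 0 T, Tendsto (fun ε : ℝ => (f τ (x + ε • e) - f τ x) / ε) (𝓝[>] 0)
      (𝓝 ⟪G τ x, e⟫) := by
    intro τ hτ
    have h := ((D.nice τ hτ).line x e 0)
    rw [hasDerivAt_iff_tendsto_slope_zero] at h
    have h2 := h.mono_left (nhdsWithin_mono 0 (show Ioi (0:ℝ) ⊆ {0}ᶜ from fun y hy => ne_of_gt hy))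
    simp only [zero_add, zero_smul, add_zero, smul_eq_mul] at h2
    refine h2.congr fun ε => ?_
    rw [div_eq_inv_mul]
  exact le_of_tendsto (((hlim t htI).sub (hlim s hsT)).sub_const _).abs key
end Muskat
end Part7

section Part8
namespace Muskat

def Dt : (StrongDual ℝ E2) ≃ₗᵢ[ℝ] E2 := (InnerProductSpace.toDual ℝ E2).symm
def gr (g : E2 → ℝ) : E2 → E2 := gradient g
def hs (g : E2 → ℝ) : E2 → E2 →L[ℝ] E2 := fderiv ℝ (gr g)

lemma gr_eq (g : E2 → ℝ) : gr g = Dt ∘ fderiv ℝ g := rfl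

lemma gr_norm (g : E2 → ℝ) (x : E2) : ‖gr g x‖ = ‖iteratedFDeriv ℝ 1 g x‖ := by
  rw [gr_eq, norm_iteratedFDeriv_one, Function.comp, LinearIsometryEquiv.norm_map]

lemma gr_iter (g : E2 → ℝ) (x : E2) (i : ℕ) :
    ‖iteratedFDeriv ℝ i (gr g) x‖ = ‖iteratedFDeriv ℝ (i + 1) g x‖ := by
  rw [gr_eq, LinearIsometryEquiv.norm_iteratedFDeriv_comp_left, norm_iteratedFDeriv_fderiv]

lemma hs_norm (g : E2 → ℝ) (x : E2) : ‖hs g x‖ = ‖iteratedFDeriv ℝ 2 g x‖ := by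
  rw [← gr_iter g x 1, norm_iteratedFDeriv_one, hs]

lemma dhs_norm (g : E2 → ℝ) (x : E2) : ‖fderiv ℝ (hs g) x‖ = ‖iteratedFDeriv ℝ 3 g x‖ := by
  rw [← gr_iter g x 2, ← norm_iteratedFDeriv_fderiv, norm_iteratedFDeriv_one, hs]

lemma gr_contDiff {g : E2 → ℝ} (hg : ContDiff ℝ 3 g) : ContDiff ℝ 2 (gr g) := by
  rw [gr_eq]
  exact Dt.contDiff.comp (hg.fderiv_right (m := 2) (by norm_num))

lemma hs_contDiff {g : E2 → ℝ} (hg : ContDiff ℝ 3 g) : ContDiff ℝ 1 (hs g) :=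
  (gr_contDiff hg).fderiv_right (m := 1) (by norm_num)

lemma gr_sub {g₁ g₂ : E2 → ℝ} (h1 : ContDiff ℝ 3 g₁) (h2 : ContDiff ℝ 3 g₂) :
    gr (g₁ - g₂) = gr g₁ - gr g₂ := by
  ext1 x
  rw [gr_eq, gr_eq, gr_eq]
  simp only [Function.comp, Pi.sub_apply]
  rw [fderiv_sub ((h1.differentiable (by norm_num)) x) ((h2.differentiable (by norm_num)) x), map_sub]

lemma hs_sub {g₁ g₂ : E2 → ℝ} (h1 : ContDiff ℝ 3 g₁) (h2 : ContDiff ℝ 3 g₂) :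
    hs (g₁ - g₂) = hs g₁ - hs g₂ := by
  ext1 x
  unfold hs
  rw [gr_sub h1 h2, fderiv_sub (((gr_contDiff h1).differentiable (by norm_num)) x)
    (((gr_contDiff h2).differentiable (by norm_num)) x)]
  rfl

lemma nice_of {g : E2 → ℝ} (hg : ContDiff ℝ 3 g) {C : ℝ}
    (hb : ∀ i : ℕ, i ≤ 3 → ∀ x, ‖iteratedFDeriv ℝ i g x‖ ≤ C) : Nice C g (gr g) (hs g) where
  hC := (norm_nonneg _).trans (hb 0 (by norm_num) 0)
  hg x := ((hg.differentiable (by norm_num)) x).hasGradientAt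
  hG x := (((gr_contDiff hg).differentiable (by norm_num)) x).hasFDerivAt
  sym x a b := by
    have h1 : hs g x = (Dt : StrongDual ℝ E2 →L[ℝ] E2).comp (fderiv ℝ (fderiv ℝ g) x) := by
      unfold hs
      rw [gr_eq]
      exact LinearIsometryEquiv.comp_fderiv Dt
    have h2 : IsSymmSndFDerivAt ℝ g x :=
      hg.contDiffAt.isSymmSndFDerivAt (by rw [minSmoothness_of_isRCLikeNormedField]; exact_mod_cast (by norm_num : (2:ℕ) ≤ 3))
    have h3 : ∀ a b, ⟪hs g x a, b⟫ = fderiv ℝ (fderiv ℝ g) x a b := by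
      intro a b; rw [h1]; exact InnerProductSpace.toDual_symm_apply
    rw [h3, h3]; exact h2 a b
  bg x := by simpa using hb 0 (by norm_num) x
  bG x := by rw [gr_norm]; exact hb 1 (by norm_num) x
  bH x := by rw [hs_norm]; exact hb 2 (by norm_num) x
  lH x y := by
    refine convex_univ.norm_image_sub_le_of_norm_fderiv_le (𝕜 := ℝ)
      (fun z _ => ((hs_contDiff hg).differentiable (by norm_num)) z) (fun z _ => ?_) (mem_univ _) (mem_univ _)
    rw [dhs_norm]; exact hb 3 le_rfl z

lemma bdd_of_decay {X : Type*} [NormedAddCommGroup X] {u : E2 → X} (hc : Continuous u)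
    (h : Tendsto (fun x => ‖u x‖) (cocompact E2) (𝓝 0)) : ∃ C, ∀ x, ‖u x‖ ≤ C := by
  have h1 : ∀ᶠ x in cocompact E2, ‖u x‖ < 1 := h (Iio_mem_nhds one_pos)
  obtain ⟨K, hK, hK2⟩ := mem_cocompact.1 h1
  obtain ⟨B, hB⟩ := hK.exists_bound_of_continuousOn hc.continuousOn
  refine ⟨max B 1, fun x => ?_⟩
  by_cases hx : x ∈ K
  · exact (hB x hx).trans (le_max_left _ _)
  · exact (le_of_lt (hK2 hx)).trans (le_max_right _ _)

lemma data_of {T : ℝ} {f : ℝ → E2 → ℝ} (S : SmoothDecaySol T f) :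
    ∃ C, Data T C f (fun t => gr (f t)) (fun t => hs (f t)) := by
  obtain ⟨s1, s2, s3, s4, s5⟩ := S
  have hb1 : ∀ t ∈ Icc 0 T, ∃ C, ∀ i : ℕ, i ≤ 3 → ∀ x, ‖iteratedFDeriv ℝ i (f t) x‖ ≤ C := by
    intro t ht
    have : ∀ i : ℕ, ∃ C, i ≤ 3 → ∀ x, ‖iteratedFDeriv ℝ i (f t) x‖ ≤ C := by
      intro i
      by_cases hi : i ≤ 3
      · obtain ⟨C, hC⟩ := bdd_of_decay ((s1 t ht).continuous_iteratedFDeriv (m := i) (by exact_mod_cast hi))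
          (s2 t ht i hi)
        exact ⟨C, fun _ => hC⟩
      · exact ⟨0, fun h => absurd h hi⟩
    choose B hB using this
    refine ⟨B 0 ⊔ B 1 ⊔ B 2 ⊔ B 3, fun i hi x => (hB i hi x).trans ?_⟩
    interval_cases i <;> simp
  have hb : ∃ C, ∀ t ∈ Icc 0 T, t ∈ Icc 0 T → ∀ i : ℕ, i ≤ 3 → ∀ x, ‖iteratedFDeriv ℝ i (f t) x‖ ≤ C := by
    refine isCompact_Icc.induction_on (s := Icc 0 T)
      (p := fun s => ∃ C, ∀ t ∈ s, t ∈ Icc 0 T → ∀ i : ℕ, i ≤ 3 → ∀ x, ‖iteratedFDeriv ℝ i (f t) x‖ ≤ C) ?_ ?_ ?_ ?_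
    · exact ⟨0, fun t ht => absurd ht (notMem_empty _)⟩
    · rintro s t hst ⟨C, hC⟩
      exact ⟨C, fun τ hτ => hC τ (hst hτ)⟩
    · rintro s t ⟨C, hC⟩ ⟨C', hC'⟩
      refine ⟨max C C', fun τ hτ hT i hi x => ?_⟩
      rcases hτ with h | h
      · exact (hC τ h hT i hi x).trans (le_max_left _ _)
      · exact (hC' τ h hT i hi x).trans (le_max_right _ _)
    · intro t ht
      obtain ⟨δ, hδ, hd⟩ := s3 t ht 1 one_pos
      obtain ⟨C, hC⟩ := hb1 t ht
      refine ⟨Metric.ball t δ, mem_nhdsWithin_of_mem_nhds (Metric.ball_mem_nhds t hδ), C + 1,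
        fun τ hτ hT i hi x => ?_⟩
      have h1 := hd τ hT (by simpa [Real.dist_eq] using hτ) i hi x
      have h2 := hC i hi x
      have h3 := norm_add_le (iteratedFDeriv ℝ i (f t) x) (iteratedFDeriv ℝ i (f τ) x - iteratedFDeriv ℝ i (f t) x)
      rw [add_sub_cancel] at h3
      linarith
  obtain ⟨C, hC⟩ := hb
  refine ⟨C, fun t ht => nice_of (s1 t ht) (hC t ht ht), ?_, ?_, ?_, s4, s5⟩
  · intro t₁ ht₁ ε hε
    obtain ⟨δ, hδ, hd⟩ := s3 t₁ ht₁ ε hε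
    refine ⟨δ, hδ, fun t ht h x => ?_⟩
    have c1 := s1 t ht
    have c2 := s1 t₁ ht₁
    have key : ∀ i : ℕ, i ≤ 3 → ‖iteratedFDeriv ℝ i (f t - f t₁) x‖ ≤ ε := by
      intro i hi
      rw [iteratedFDeriv_sub_apply (c1.of_le (by exact_mod_cast hi)).contDiffAt
        (c2.of_le (by exact_mod_cast hi)).contDiffAt]
      exact hd t ht h i hi x
    refine ⟨by simpa using key 0 (by norm_num), ?_, ?_⟩
    · have := key 1 (by norm_num)
      rw [← gr_norm, gr_sub c1 c2] at this
      exact this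
    · have := key 2 (by norm_num)
      rw [← hs_norm, hs_sub c1 c2] at this
      exact this
  · intro t ht
    simp_rw [gr_norm]; exact s2 t ht 1 (by norm_num)
  · intro t ht
    simp_rw [hs_norm]; exact s2 t ht 2 (by norm_num)
end Muskat
end Part8

section Part9
namespace Muskat
variable {C : ℝ} {T : ℝ} {f : ℝ → E2 → ℝ} {G : ℝ → E2 → E2} {H : ℝ → E2 → E2 →L[ℝ] E2}

lemma first_time {T : ℝ} (Bad : ℝ → Prop) (h0 : ¬ Bad 0)
    (ho : ∀ t₀ ∈ Icc 0 T, ¬ Bad t₀ → ∃ δ > 0, ∀ t ∈ Icc 0 T, t₀ ≤ t → t < t₀ + δ → ¬ Bad t)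
    {t : ℝ} (ht : t ∈ Icc 0 T) (hb : Bad t) :
    ∃ t₀ ∈ Ioc 0 T, Bad t₀ ∧ ∀ s ∈ Ico 0 t₀, ¬ Bad s := by
  set S : Set ℝ := {t | t ∈ Icc 0 T ∧ Bad t} with hS
  have hne : S.Nonempty := ⟨t, ht, hb⟩
  have hbd : BddBelow S := ⟨0, fun s hs => hs.1.1⟩
  set t₀ := sInf S
  have h1 : 0 ≤ t₀ := le_csInf hne fun s hs => hs.1.1
  have h2 : t₀ ≤ t := csInf_le hbd ⟨ht, hb⟩
  have h3 : t₀ ∈ Icc 0 T := ⟨h1, h2.trans ht.2⟩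
  have hlt : ∀ s ∈ Ico 0 t₀, ¬ Bad s := fun s hs hbs =>
    absurd (csInf_le hbd ⟨⟨hs.1, hs.2.le.trans h3.2⟩, hbs⟩) (not_le.2 hs.2)
  have hb0 : Bad t₀ := by
    by_contra hn
    obtain ⟨δ, hδ, hd⟩ := ho t₀ h3 hn
    obtain ⟨s, hs, hs2⟩ := exists_lt_of_csInf_lt hne (show sInf S < t₀ + δ from by
      show t₀ < t₀ + δ; linarith)
    exact hd s hs.1 (csInf_le hbd hs) hs2 hs.2
  refine ⟨t₀, ⟨lt_of_le_of_ne h1 ?_, h3.2⟩, hb0, hlt⟩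
  intro h
  rw [← h] at hb0; exact h0 hb0

lemma gap {X : Type*} [NormedAddCommGroup X] {u : E2 → X} (hc : Continuous u)
    (h : Tendsto (fun x => ‖u x‖) (cocompact E2) (𝓝 0)) {B : ℝ} (hB : ∀ x, ‖u x‖ < B) :
    ∃ γ > 0, ∀ x, ‖u x‖ ≤ B - γ := by
  have hB0 : 0 < B := (norm_nonneg _).trans_lt (hB 0)
  have h1 : ∀ᶠ x in cocompact E2, ‖u x‖ < B / 2 := h (Iio_mem_nhds (by linarith))
  obtain ⟨K, hK, hK2⟩ := mem_cocompact.1 h1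
  obtain ⟨x0, hx0, hmax⟩ := (hK.union (isCompact_singleton (x := (0 : E2)))).exists_isMaxOn
    ⟨0, by simp⟩ hc.norm.continuousOn
  refine ⟨min (B / 2) (B - ‖u x0‖), lt_min (by linarith) (by linarith [hB x0]), fun x => ?_⟩
  by_cases hx : x ∈ K
  · have : ‖u x‖ ≤ ‖u x0‖ := hmax (Or.inl hx)
    linarith [min_le_right (B / 2) (B - ‖u x0‖)]
  · have : ‖u x‖ < B / 2 := hK2 hx
    linarith [min_le_left (B / 2) (B - ‖u x0‖)]

lemma slope_bound (D : Data T C f G H) (hT : 0 < T) {M M1 : ℝ} (hM0 : 0 ≤ M) (hM1 : M < M1) (h5 : 5 * M1 ^ 2 < 1)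
    (h0 : ∀ x, ‖G 0 x‖ ≤ M) : ∀ t ∈ Icc 0 T, ∀ x, ‖G t x‖ ≤ M1 := by
  set a := (M1 - M) / (1 + T) with ha
  have ha0 : 0 < a := div_pos (by linarith) (by linarith)
  have haT : a * (1 + T) = M1 - M := by rw [ha]; field_simp
  set B : ℝ → ℝ := fun t => M + a * (1 + t) with hBdef
  have hBM : ∀ t ≤ T, B t ≤ M1 := fun t ht => by simp only [hBdef]; nlinarith
  suffices hgood : ∀ t ∈ Icc 0 T, ∀ x, ‖G t x‖ < B t from
    fun t ht x => (hgood t ht x).le.trans (hBM t ht.2)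
  by_contra hcon
  push Not at hcon
  obtain ⟨t, ht, hbt⟩ := hcon
  obtain ⟨t₀, ht₀, ⟨x₀, hx₀⟩, hlt⟩ := first_time (T := T) (fun t => ∃ x, B t ≤ ‖G t x‖)
    (by push Not; intro x; simp only [hBdef]; linarith [h0 x])
    (by
      intro t₀ ht₀ hn
      push Not at hn
      obtain ⟨γ, hγ, hg⟩ := gap (D.nice t₀ ht₀).contG (D.decG t₀ ht₀) hn
      obtain ⟨δ, hδ, hd⟩ := D.cont t₀ ht₀ (γ / 2) (by linarith)
      refine ⟨δ, hδ, fun t ht h1 h2 => ?_⟩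
      push Not
      intro x
      have e1 := (hd t ht (by rw [abs_lt]; constructor <;> linarith) x).2.1
      have e2 := hg x
      have e3 := norm_add_le (G t₀ x) (G t x - G t₀ x)
      rw [add_sub_cancel] at e3
      have e4 : B t₀ ≤ B t := by simp only [hBdef]; nlinarith
      linarith) ht hbt
  push Not at hlt
  have ht₀I : t₀ ∈ Icc 0 T := ⟨ht₀.1.le, ht₀.2⟩
  have n := D.nice t₀ ht₀I
  have hB0 : 0 < B t₀ := by simp only [hBdef]; nlinarith [ht₀.1]
  have hweak : ∀ x, ‖G t₀ x‖ ≤ B t₀ := by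
    intro x
    have l1 : Tendsto (fun s => ‖G s x‖) (𝓝[<] t₀) (𝓝 ‖G t₀ x‖) := by
      have h : Tendsto (fun s : ℝ => (s, x)) (𝓝[Icc 0 T] t₀) (𝓝[Icc 0 T] t₀ ×ˢ 𝓝 x) :=
        tendsto_id.prodMk tendsto_const_nhds
      have h2 := ((D.jG ht₀I x).comp h).norm
      refine h2.mono_left ?_
      rw [← nhdsWithin_Ico_eq_nhdsLT ht₀.1]
      exact nhdsWithin_mono _ (Ico_subset_Icc_self.trans (Icc_subset_Icc_right ht₀.2))
    refine le_of_tendsto l1 ?_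
    filter_upwards [Ico_mem_nhdsLT ht₀.1] with s hs
    have := hlt s hs x
    have e4 : B s ≤ B t₀ := by simp only [hBdef]; nlinarith [hs.2]
    linarith
  have heq : ‖G t₀ x₀‖ = B t₀ := le_antisymm (hweak x₀) hx₀
  set e : E2 := (B t₀)⁻¹ • G t₀ x₀ with he
  have hen : ‖e‖ ≤ 1 := by
    rw [he, norm_smul, heq, norm_inv, Real.norm_of_nonneg hB0.le, inv_mul_cancel₀ hB0.ne']
  have hth0 : ⟪G t₀ x₀, e⟫ = B t₀ := by
    rw [he, inner_smul_right, real_inner_self_eq_norm_sq, heq]; field_simp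
  have hdth : ∀ h, ⟪G t₀ (x₀ + h) - G t₀ x₀, e⟫ ≤ 0 := by
    intro h
    rw [inner_sub_left, hth0]
    have := (le_abs_self _).trans (abs_inner_le_unit (G t₀ (x₀ + h)) hen)
    linarith [hweak (x₀ + h)]
  have hP : ∀ h, ⟪H t₀ x₀ h, e⟫ = 0 := by
    intro h
    have h1 : HasDerivAt (fun s : ℝ => ⟪G t₀ (x₀ + s • h), e⟫) ⟪H t₀ x₀ h, e⟫ 0 := by
      have := (n.lineG x₀ h 0).inner ℝ (hasDerivAt_const (0:ℝ) e)
      simpa using this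
    refine IsLocalMax.hasDerivAt_eq_zero (f := fun s : ℝ => ⟪G t₀ (x₀ + s • h), e⟫) ?_ h1
    refine Eventually.of_forall fun s => ?_
    have := hdth (s • h)
    rw [inner_sub_left] at this
    simp only [zero_smul, add_zero]
    linarith
  have hJ : ∫ h, Jr 1 (f t₀) (G t₀) (H t₀) x₀ e h ≤ 0 := by
    refine integral_nonpos_of_ae ?_
    filter_upwards [ae_ne_zero] with h hh
    have hr : 0 < ‖h‖ := norm_pos_iff.2 hh
    unfold Jr
    rw [hP h, zero_mul, sub_zero]
    refine mul_nonpos_of_nonpos_of_nonneg (hdth h) ?_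
    have hGM : ∀ y, ‖G t₀ y‖ ≤ M1 := fun y => (hweak y).trans (hBM _ ht₀.2)
    have := kk_lower M1 (f t₀ (x₀ + h) - f t₀ x₀) ⟪G t₀ x₀, h⟫ hr (by linarith) h5
      ((abs_real_inner_le_norm _ _).trans (by gcongr; exact hGM _)) (n.dl_le' x₀ h hGM)
    refine le_trans ?_ this
    have : 0 < 1 - 5 * M1 ^ 2 := by linarith
    positivity
  have hl := D.left_deriv ht₀ one_pos x₀ hen (half_pos ha0)
  obtain ⟨s, hs1, hs2⟩ := (hl.and (Ico_mem_nhdsLT ht₀.1)).exists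
  have e1 := (abs_le.1 hs1).2
  have e2 := (le_abs_self _).trans (abs_inner_le_unit (G s x₀) hen)
  have e3 := hlt s hs2 x₀
  have e4 : 0 < t₀ - s := by linarith [hs2.2]
  have e5 : B t₀ - B s = a * (t₀ - s) := by simp only [hBdef]; ring
  have e6 := mul_nonpos_of_nonneg_of_nonpos e4.le hJ
  nlinarith
end Muskat
end Part9

section Part10
namespace Muskat

def Wm (δ b r : ℝ) : ℝ := δ * psi (b * r)

structure Touch (C M1 δ b : ℝ) (g : E2 → ℝ) (G : E2 → E2) (H : E2 → E2 →L[ℝ] E2) (x y e : E2) : Prop where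
  n : Nice C g G H
  hM0 : 0 ≤ M1
  h5 : 5 * M1 ^ 2 < 1
  hM : ∀ z, ‖G z‖ ≤ M1
  hδ : 0 < δ
  hb : 0 < b
  hW : ∀ z w, ‖G z - G w‖ ≤ Wm δ b ‖z - w‖
  hne : x ≠ y
  he : ‖e‖ = 1
  heq : G x - G y = Wm δ b ‖x - y‖ • e

section
variable {δ b : ℝ}
lemma Wm_mono (hδ : 0 < δ) (hb : 0 < b) {r s : ℝ} (hr : 0 ≤ r) (hrs : r ≤ s) : Wm δ b r ≤ Wm δ b s := by
  unfold Wm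
  exact mul_le_mul_of_nonneg_left (psi_mono (by positivity) (by gcongr)) hδ.le
lemma Wm_le (hδ : 0 < δ) (hb : 0 < b) {r : ℝ} (hr : 0 ≤ r) : Wm δ b r ≤ δ * b * r := by
  unfold Wm
  rw [mul_assoc]
  exact mul_le_mul_of_nonneg_left (psi_le (by positivity)) hδ.le
lemma Wm_tangent (hδ : 0 < δ) (hb : 0 < b) {ξ r : ℝ} (hξ : 0 < ξ) (hr : 0 ≤ r) :
    Wm δ b r ≤ Wm δ b ξ + δ * b * dpsi (b * ξ) * (r - ξ) := by
  unfold Wm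
  have := mul_le_mul_of_nonneg_left (psi_tangent (u := b * ξ) (r := b * r) (by positivity) (by positivity)) hδ.le
  linarith [this, show δ * (psi (b * ξ) + dpsi (b * ξ) * (b * r - b * ξ)) =
    δ * psi (b * ξ) + δ * b * dpsi (b * ξ) * (r - ξ) by ring]
end

namespace Touch
variable {C M1 δ b : ℝ} {g : E2 → ℝ} {G : E2 → E2} {H : E2 → E2 →L[ℝ] E2} {x y e : E2}

lemma ξpos (t : Touch C M1 δ b g G H x y e) : 0 < ‖x - y‖ := norm_pos_iff.2 (sub_ne_zero.2 t.hne)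

lemma M1lt (t : Touch C M1 δ b g G H x y e) : 2 * M1 ≤ 1 := by nlinarith [t.h5, t.hM0]

lemma symm (t : Touch C M1 δ b g G H x y e) : Touch C M1 δ b g G H y x (-e) where
  n := t.n
  hM0 := t.hM0
  h5 := t.h5
  hM := t.hM
  hδ := t.hδ
  hb := t.hb
  hW := t.hW
  hne := t.hne.symm
  he := by rw [norm_neg, t.he]
  heq := by rw [smul_neg, norm_sub_rev, ← t.heq]; abel

/-- `q` is the slope of `W` at `ξ` -/
def q (δ b : ℝ) (x y : E2) : ℝ := δ * b * dpsi (b * ‖x - y‖)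

lemma qpos (t : Touch C M1 δ b g G H x y e) : 0 < q δ b x y := by
  have := t.hδ; have := t.hb; have := dpsi_pos (b * ‖x - y‖)
  unfold q; positivity

lemma q_symm : q δ b y x = q δ b x y := by unfold q; rw [norm_sub_rev]

lemma q_le (t : Touch C M1 δ b g G H x y e) : q δ b x y ≤ δ * b := by
  have := t.hδ; have := t.hb
  unfold q
  nlinarith [dpsi_le_one (b * ‖x - y‖), mul_pos t.hδ t.hb]

lemma qξ_le (t : Touch C M1 δ b g G H x y e) : q δ b x y * ‖x - y‖ ≤ Wm δ b ‖x - y‖ := by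
  have hξ := t.ξpos; have hb := t.hb
  have := mul_le_mul_of_nonneg_left (mul_dpsi_le_psi (u := b * ‖x - y‖) (by positivity)) t.hδ.le
  unfold q Wm; linarith

lemma qξ_le' (t : Touch C M1 δ b g G H x y e) : q δ b x y * ‖x - y‖ ≤ δ := by
  have hξ := t.ξpos; have hb := t.hb
  have := mul_le_mul_of_nonneg_left (mul_dpsi_le (u := b * ‖x - y‖) (by positivity)) t.hδ.le
  unfold q; linarith

lemma W_le_one (t : Touch C M1 δ b g G H x y e) : Wm δ b ‖x - y‖ ≤ 1 := by
  have h0 : ‖G x - G y‖ = |Wm δ b ‖x - y‖| := by rw [t.heq, norm_smul, t.he, mul_one, Real.norm_eq_abs]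
  have := norm_sub_le (G x) (G y)
  linarith [le_abs_self (Wm δ b ‖x - y‖), t.hM x, t.hM y, t.M1lt]

lemma Wpos (t : Touch C M1 δ b g G H x y e) : 0 < Wm δ b ‖x - y‖ :=
  mul_pos t.hδ (psi_pos (mul_pos t.hb t.ξpos))

lemma inn (t : Touch C M1 δ b g G H x y e) : ⟪G x - G y, e⟫ = Wm δ b ‖x - y‖ := by
  rw [t.heq, real_inner_smul_left, real_inner_self_eq_norm_sq, t.he]; ring

lemma inner_le (t : Touch C M1 δ b g G H x y e) (z w : E2) : ⟪G z - G w, e⟫ ≤ Wm δ b ‖z - w‖ :=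
  ((le_abs_self _).trans (abs_inner_le_unit _ t.he.le)).trans (t.hW z w)

/-- longitudinal component -/
def h1 (x y h : E2) : ℝ := ⟪x - y, h⟫ / ‖x - y‖

lemma h1_abs (x y h : E2) : |h1 x y h| ≤ ‖h‖ := by
  unfold h1
  rcases eq_or_ne x y with rfl | hne
  · simp
  have : 0 < ‖x - y‖ := norm_pos_iff.2 (sub_ne_zero.2 hne)
  rw [abs_div, abs_of_pos this, div_le_iff₀ this, mul_comm]
  exact abs_real_inner_le_norm _ _

lemma h1_symm (x y h : E2) : h1 y x h = - h1 x y h := by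
  unfold h1
  rw [norm_sub_rev, ← neg_sub x y, inner_neg_left, neg_div]

lemma norm_add_le' (t : Touch C M1 δ b g G H x y e) (h : E2) :
    ‖x - y + h‖ ≤ ‖x - y‖ + h1 x y h + ‖h‖ ^ 2 / (2 * ‖x - y‖) := by
  have hξ := t.ξpos
  have e1 : ‖x - y + h‖ ^ 2 = ‖x - y‖ ^ 2 + 2 * ⟪x - y, h⟫ + ‖h‖ ^ 2 := norm_add_sq_real _ _
  have e2 : ⟪x - y, h⟫ = ‖x - y‖ * h1 x y h := by unfold h1; field_simp
  rw [e2] at e1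
  set ξ := ‖x - y‖
  set r := ‖h‖
  set l := h1 x y h
  have e3 : ξ + l + r ^ 2 / (2 * ξ) = (‖x - y + h‖ ^ 2 + ξ ^ 2) / (2 * ξ) := by
    rw [e1]; field_simp; ring
  rw [e3, le_div_iff₀ (by positivity)]
  nlinarith [sq_nonneg (‖x - y + h‖ - ξ)]

lemma dth_le (t : Touch C M1 δ b g G H x y e) (h : E2) :
    ⟪G (x + h) - G x, e⟫ ≤ Wm δ b ‖x - y + h‖ - Wm δ b ‖x - y‖ := by
  have a1 := t.inner_le (x + h) y
  have a2 := t.inn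
  rw [show x + h - y = x - y + h by abel] at a1
  rw [inner_sub_left] at a1 a2 ⊢
  linarith

lemma dth_leU (t : Touch C M1 δ b g G H x y e) (h : E2) :
    ⟪G (x + h) - G x, e⟫ ≤ q δ b x y * h1 x y h + q δ b x y * (‖h‖ ^ 2 / (2 * ‖x - y‖)) := by
  refine (t.dth_le h).trans ?_
  have := Wm_tangent t.hδ t.hb t.ξpos (norm_nonneg (x - y + h))
  have h2 := mul_le_mul_of_nonneg_left (t.norm_add_le' h) t.qpos.le
  unfold q at *
  linarith

lemma dth_leU' (t : Touch C M1 δ b g G H x y e) (h : E2) :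
    ⟪G (x + h) - G x, e⟫ ≤ Wm δ b (‖x - y‖ + ‖h‖) - Wm δ b ‖x - y‖ := by
  refine (t.dth_le h).trans ?_
  have := Wm_mono t.hδ t.hb (norm_nonneg (x - y + h)) (norm_add_le _ _)
  linarith

lemma sync (t : Touch C M1 δ b g G H x y e) (h : E2) :
    ⟪G (x + h) - G x, e⟫ ≤ ⟪G (y + h) - G y, e⟫ := by
  have a1 := t.inner_le (x + h) (y + h)
  have a2 := t.inn
  rw [add_sub_add_right_eq_sub] at a1
  rw [inner_sub_left] at a1 a2 ⊢
  rw [inner_sub_left]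
  linarith

lemma P_eq (t : Touch C M1 δ b g G H x y e) (h : E2) : ⟪H x h, e⟫ = q δ b x y * h1 x y h := by
  have d1 : HasDerivAt (fun s : ℝ => ⟪G (x + s • h), e⟫) ⟪H x h, e⟫ 0 := by
    have := (t.n.lineG x h 0).inner ℝ (hasDerivAt_const (0:ℝ) e)
    simpa using this
  have d2 : HasDerivAt (fun s : ℝ => s * (q δ b x y * h1 x y h) +
      s ^ 2 * (q δ b x y * (‖h‖ ^ 2 / (2 * ‖x - y‖)))) (q δ b x y * h1 x y h) 0 := by
    have := ((hasDerivAt_id (0:ℝ)).mul_const (q δ b x y * h1 x y h)).add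
      ((hasDerivAt_pow 2 (0:ℝ)).mul_const (q δ b x y * (‖h‖ ^ 2 / (2 * ‖x - y‖))))
    exact this.congr_deriv (by simp)
  have := IsLocalMax.hasDerivAt_eq_zero (Eventually.of_forall fun s => ?_) (d1.sub d2)
  · linarith
  have := t.dth_leU (s • h)
  rw [inner_sub_left] at this
  have e1 : h1 x y (s • h) = s * h1 x y h := by unfold h1; rw [inner_smul_right]; ring
  rw [e1, norm_smul, mul_pow, Real.norm_eq_abs, sq_abs] at this
  simp only [Pi.sub_apply, zero_smul, add_zero, zero_mul]
  have e2 : q δ b x y * (s ^ 2 * ‖h‖ ^ 2 / (2 * ‖x - y‖)) =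
    s ^ 2 * (q δ b x y * (‖h‖ ^ 2 / (2 * ‖x - y‖))) := by ring
  rw [e2] at this
  norm_num
  linarith

lemma P_abs (t : Touch C M1 δ b g G H x y e) (h : E2) : |⟪H x h, e⟫| ≤ q δ b x y * ‖h‖ := by
  rw [t.P_eq, abs_mul, abs_of_pos t.qpos]
  exact mul_le_mul_of_nonneg_left (h1_abs x y h) t.qpos.le

lemma Py_eq (t : Touch C M1 δ b g G H x y e) (h : E2) : ⟪H y h, e⟫ = q δ b x y * h1 x y h := by
  have := t.symm.P_eq h
  rw [q_symm, h1_symm, inner_neg_right] at this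
  linarith

lemma dl_abs (t : Touch C M1 δ b g G H x y e) (z h : E2) : |g (z + h) - g z| ≤ M1 * ‖h‖ :=
  t.n.dl_le' z h t.hM
lemma c_abs (t : Touch C M1 δ b g G H x y e) (z h : E2) : |⟪G z, h⟫| ≤ M1 * ‖h‖ :=
  (abs_real_inner_le_norm _ _).trans (by gcongr; exact t.hM z)
lemma dl_abs1 (t : Touch C M1 δ b g G H x y e) (z h : E2) : |g (z + h) - g z| ≤ ‖h‖ :=
  (t.dl_abs z h).trans (by nlinarith [norm_nonneg h, t.M1lt])
lemma c_abs1 (t : Touch C M1 δ b g G H x y e) (z h : E2) : |⟪G z, h⟫| ≤ ‖h‖ :=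
  (t.c_abs z h).trans (by nlinarith [norm_nonneg h, t.M1lt])

lemma k_up (t : Touch C M1 δ b g G H x y e) (z : E2) {h : E2} (hr : 0 < ‖h‖) :
    kk (g (z + h) - g z) ⟪G z, h⟫ ‖h‖ ≤ 3 / ‖h‖ ^ 3 :=
  kk_upper _ _ hr (t.c_abs1 z h) (t.dl_abs1 z h)
lemma k_low (t : Touch C M1 δ b g G H x y e) (z : E2) {h : E2} (hr : 0 < ‖h‖) :
    (1 - 5 * M1 ^ 2) / 2 / ‖h‖ ^ 3 ≤ kk (g (z + h) - g z) ⟪G z, h⟫ ‖h‖ :=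
  kk_lower M1 _ _ hr t.hM0 t.h5 (t.c_abs z h) (t.dl_abs z h)

lemma dd1 (n : Nice C g G H) (z w h : E2) {B : ℝ} (hB : ∀ s ∈ Ico (0:ℝ) 1, ‖G (z + s • h) - G (w + s • h)‖ ≤ B) :
    |(g (z + h) - g z) - (g (w + h) - g w)| ≤ B * ‖h‖ := by
  have := norm_image_sub_le_of_norm_deriv_le_segment_01' (C := B * ‖h‖)
    (fun s _ => ((n.line z h s).sub (n.line w h s)).hasDerivWithinAt) (fun s hs => by
      rw [← inner_sub_left]
      refine (norm_inner_le_norm _ _).trans ?_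
      gcongr
      exact hB s hs)
  simp only [Pi.sub_apply, one_smul, zero_smul, add_zero, Real.norm_eq_abs] at this
  rwa [show (g (z + h) - g z) - (g (w + h) - g w) = g (z + h) - g (w + h) - (g z - g w) by ring]

lemma ddl1 (t : Touch C M1 δ b g G H x y e) (h : E2) :
    |(g (x + h) - g x) - (g (y + h) - g y)| ≤ Wm δ b ‖x - y‖ * ‖h‖ :=
  dd1 t.n x y h fun s _ => by
    have := t.hW (x + s • h) (y + s • h)
    rwa [add_sub_add_right_eq_sub] at this

lemma ddl2 (t : Touch C M1 δ b g G H x y e) (h : E2) :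
    |(g (x + h) - g x) - (g (y + h) - g y)| ≤ Wm δ b ‖h‖ * ‖x - y‖ := by
  have := dd1 t.n (y + h) y (x - y) (B := Wm δ b ‖h‖) fun s _ => by
    have := t.hW (y + h + s • (x - y)) (y + s • (x - y))
    rwa [add_sub_add_right_eq_sub, add_sub_cancel_left] at this
  rw [show y + h + (x - y) = x + h by abel, show y + (x - y) = x by abel] at this
  rwa [show (g (x + h) - g x) - (g (y + h) - g y) = g (x + h) - g (y + h) - (g x - g y) by ring]

lemma ddl3 (t : Touch C M1 δ b g G H x y e) (h : E2) :
    |(g (x + h) - g x) - (g (y + h) - g y)| ≤ ‖x - y‖ := by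
  have := dd1 t.n (y + h) y (x - y) (B := 1) fun s _ => by
    refine (norm_sub_le _ _).trans ?_
    linarith [t.hM (y + h + s • (x - y)), t.hM (y + s • (x - y)), t.M1lt]
  rw [show y + h + (x - y) = x + h by abel, show y + (x - y) = x by abel, one_mul] at this
  rwa [show (g (x + h) - g x) - (g (y + h) - g y) = g (x + h) - g (y + h) - (g x - g y) by ring]

lemma dk (t : Touch C M1 δ b g G H x y e) {h : E2} (hr : 0 < ‖h‖) :
    |kk (g (x + h) - g x) ⟪G x, h⟫ ‖h‖ - kk (g (y + h) - g y) ⟪G y, h⟫ ‖h‖|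
      ≤ 45 * Wm δ b ‖x - y‖ / ‖h‖ ^ 3 := by
  refine kk_diff _ _ _ _ _ _ hr (t.c_abs1 y h) (t.dl_abs1 x h) (t.dl_abs1 y h) (t.ddl1 h) ?_
  rw [← inner_sub_left]
  refine (abs_real_inner_le_norm _ _).trans ?_
  gcongr
  exact t.hW x y

lemma mix {α β U k1 k2 l : ℝ} (hα : α ≤ U) (hβ : -β ≤ U) (hαβ : α ≤ β) (h1 : l ≤ k1) (h2 : l ≤ k2) :
    α * k1 - β * k2 ≤ l * (α - β) + U * |k1 - k2| := by
  rcases le_total k2 k1 with h | h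
  · rw [abs_of_nonneg (by linarith)]
    nlinarith [mul_nonneg (sub_nonneg.2 hα) (sub_nonneg.2 h), mul_nonneg (sub_nonneg.2 hαβ) (sub_nonneg.2 h2)]
  · rw [abs_of_nonpos (by linarith)]
    nlinarith [mul_nonneg (sub_nonneg.2 hβ) (sub_nonneg.2 h), mul_nonneg (sub_nonneg.2 hαβ) (sub_nonneg.2 h1)]
end Touch
end Muskat
end Part10

section Part11
namespace Muskat

lemma Jr_neg (ρ : ℝ) (g : E2 → ℝ) (G : E2 → E2) (H : E2 → E2 →L[ℝ] E2) (x e h : E2) :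
    Jr ρ g G H x (-e) h = - Jr ρ g G H x e h := by
  unfold Jr; rw [inner_neg_right, inner_neg_right]; ring

lemma near_iso (ρ : ℝ) (R : E2 ≃ₗᵢ[ℝ] E2) (F : E2 → ℝ) :
    ∫ h in near ρ, F (R h) = ∫ h in near ρ, F h := by
  have := R.measurePreserving.setIntegral_preimage_emb R.toHomeomorph.measurableEmbedding F (near ρ)
  rw [← this]
  congr 2
  ext h
  simp [near]

lemma near_iso_int (ρ : ℝ) (R : E2 ≃ₗᵢ[ℝ] E2) {F : E2 → ℝ} (hF : IntegrableOn F (near ρ)) :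
    IntegrableOn (fun h => F (R h)) (near ρ) := by
  have := (R.measurePreserving.integrableOn_comp_preimage R.toHomeomorph.measurableEmbedding (f := F) (s := near ρ)).2 hF
  have e : R ⁻¹' near ρ = near ρ := by ext h; simp [near]
  rwa [e] at this

lemma near_of_bound {ρ B : ℝ} (hρ : 0 < ρ) {F : E2 → ℝ} (hF : Measurable F)
    (hB : ∀ h : E2, h ≠ 0 → |F h| ≤ B * (1 / ‖h‖)) : IntegrableOn F (near ρ) := by
  refine ((near1 hρ).1.const_mul B).mono' hF.aestronglyMeasurable ?_
  filter_upwards [ae_restrict_of_ae ae_ne_zero] with h hh using hB h hh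

lemma h1_int {v : E2} (hv : ‖v‖ = 1) {ρ : ℝ} (hρ : 0 < ρ) :
    IntegrableOn (fun h : E2 => ⟪v, h⟫ ^ 2 / ‖h‖ ^ 3) (near ρ) ∧
    ∫ h in near ρ, ⟪v, h⟫ ^ 2 / ‖h‖ ^ 3 = Real.pi * ρ := by
  have hintg : ∀ w : E2, ‖w‖ = 1 → IntegrableOn (fun h : E2 => ⟪w, h⟫ ^ 2 / ‖h‖ ^ 3) (near ρ) := by
    intro w hw
    refine near_of_bound (B := 1) hρ (by have := meas_inner w; fun_prop) ?_
    intro h hh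
    have hr : 0 < ‖h‖ := norm_pos_iff.2 hh
    rw [abs_of_nonneg (by positivity), one_mul, div_le_div_iff₀ (by positivity) hr]
    have := abs_real_inner_le_norm w h
    rw [hw, one_mul] at this
    have h2 : ⟪w, h⟫ ^ 2 ≤ ‖h‖ ^ 2 := by rw [← sq_abs ⟪w, h⟫]; gcongr
    nlinarith
  refine ⟨hintg v hv, ?_⟩
  set w : E2 := !₂[-v 1, v 0] with hw
  have hv2 : v 0 ^ 2 + v 1 ^ 2 = 1 := by
    have := EuclideanSpace.real_norm_sq_eq v
    rw [hv, Fin.sum_univ_two] at this; linarith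
  have hw1 : ‖w‖ = 1 := by
    have := EuclideanSpace.real_norm_sq_eq w
    rw [Fin.sum_univ_two] at this
    have e : w 0 ^ 2 + w 1 ^ 2 = 1 := by rw [hw]; simp; linarith
    rw [e] at this
    nlinarith [norm_nonneg w]
  have hsum : ∀ h : E2, ⟪v, h⟫ ^ 2 + ⟪w, h⟫ ^ 2 = ‖h‖ ^ 2 := by
    intro h
    rw [EuclideanSpace.real_norm_sq_eq h, PiLp.inner_apply, PiLp.inner_apply]
    simp only [Fin.sum_univ_two, hw]
    simp
    linear_combination (h 0 ^ 2 + h 1 ^ 2) * hv2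
  have hsw : ∫ h in near ρ, ⟪v, h⟫ ^ 2 / ‖h‖ ^ 3 = ∫ h in near ρ, ⟪w, h⟫ ^ 2 / ‖h‖ ^ 3 := by
    have hR := Submodule.reflection_sub (v := v) (w := w) (by rw [hv, hw1])
    set R := (Submodule.span ℝ {v - w})ᗮ.reflection
    rw [← near_iso ρ R]
    congr 1
    ext h
    have : ⟪w, R h⟫ = ⟪v, h⟫ := by rw [← hR, R.inner_map_map]
    have h3 : ⟪v, R h⟫ = ⟪w, h⟫ := by
      have : R w = v := by rw [← hR, Submodule.reflection_reflection]
      rw [← this, R.inner_map_map]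
    rw [h3, R.norm_map]
  have htot : ∫ h in near ρ, (⟪v, h⟫ ^ 2 / ‖h‖ ^ 3 + ⟪w, h⟫ ^ 2 / ‖h‖ ^ 3) = 2 * Real.pi * ρ := by
    rw [← (near1 hρ).2]
    congr 1
    ext h
    rw [← add_div, hsum]
    rcases eq_or_ne ‖h‖ 0 with h0 | h0
    · rw [h0]; simp
    · field_simp
  rw [integral_add (hintg v hv) (hintg w hw1), ← hsw] at htot
  linarith

namespace Touch
variable {C M1 δ b : ℝ} {g : E2 → ℝ} {G : E2 → E2} {H : E2 → E2 →L[ℝ] E2} {x y e : E2}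

lemma N_abs (t : Touch C M1 δ b g G H x y e) (z h : E2) :
    |g (z + h) - g z - ⟪G z, h⟫| ≤ δ * b * ‖h‖ * ‖h‖ := by
  refine t.n.N_le z h fun s hs => ?_
  have := t.hW (z + s • h) z
  rw [add_sub_cancel_left] at this
  refine this.trans ((Wm_mono t.hδ t.hb (norm_nonneg _) ?_).trans (Wm_le t.hδ t.hb (norm_nonneg h)))
  rw [norm_smul, Real.norm_eq_abs, abs_of_nonneg hs.1]
  nlinarith [norm_nonneg h, hs.2]

/-- the second part of the near form -/
lemma T2_abs (t : Touch C M1 δ b g G H x y e) (z : E2) {h : E2} (hr : 0 < ‖h‖) {P : ℝ}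
    (hP : |P| ≤ q δ b x y * ‖h‖) :
    |P * (kk (g (z + h) - g z) ⟪G z, h⟫ ‖h‖ - KK (g (z + h) - g z) ‖h‖)| ≤
      3 * q δ b x y * |g (z + h) - g z - ⟪G z, h⟫| / ‖h‖ ^ 3 := by
  have hp := (II_pos (g (z + h) - g z) hr).le
  have e1 : kk (g (z + h) - g z) ⟪G z, h⟫ ‖h‖ - KK (g (z + h) - g z) ‖h‖ =
    - (3 * (g (z + h) - g z - ⟪G z, h⟫) * (g (z + h) - g z) * II (g (z + h) - g z) ‖h‖ ^ 5) := by
    unfold kk KK; ring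
  rw [e1, abs_mul, abs_neg, abs_mul, abs_mul, abs_mul, abs_of_nonneg (show 0 ≤ II (g (z + h) - g z) ‖h‖ ^ 5 by positivity)]
  have hq := t.qpos
  calc _ ≤ (q δ b x y * ‖h‖) * (|3| * |g (z + h) - g z - ⟪G z, h⟫| * ‖h‖ * (1 / ‖h‖ ^ 5)) := by
        gcongr
        · exact t.dl_abs1 z h
        · exact I5_le _ hr
    _ = _ := by rw [abs_of_pos (by norm_num : (0:ℝ) < 3)]; field_simp

lemma near_pt (t : Touch C M1 δ b g G H x y e) {h : E2} (hr : 0 < ‖h‖) (hρ : ‖h‖ < ‖x - y‖ / 4) :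
    Jr (‖x - y‖ / 4) g G H x e h - Jr (‖x - y‖ / 4) g G H y e h ≤
      (1 - 5 * M1 ^ 2) / 2 / ‖h‖ ^ 3 * ((⟪G (x + h) - G x, e⟫ - ⟪H x h, e⟫) - (⟪G (y + h) - G y, e⟫ - ⟪H y h, e⟫))
        + 29 * (δ * b) ^ 2 * (1 / ‖h‖) := by
  have hPx := t.P_eq h
  have hPy := t.Py_eq h
  have hξ := t.ξpos
  have hq := t.qpos
  have hmix := mix (α := ⟪G (x + h) - G x, e⟫ - ⟪H x h, e⟫) (β := ⟪G (y + h) - G y, e⟫ - ⟪H y h, e⟫)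
    (U := q δ b x y * (‖h‖ ^ 2 / (2 * ‖x - y‖)))
    (by rw [hPx]; linarith [t.dth_leU h])
    (by
      have := t.symm.dth_leU h
      rw [q_symm, h1_symm, inner_neg_right, norm_sub_rev y x] at this
      rw [hPy]; linarith)
    (by rw [hPx, hPy]; linarith [t.sync h]) (t.k_low x hr) (t.k_low y hr)
  have hdk := t.dk hr
  have hP := t.P_abs h
  have hT1 := abs_le.1 (t.T2_abs x hr hP)
  have hT2 := abs_le.1 (t.T2_abs y hr (P := ⟪H y h, e⟫) (by rw [hPy, ← hPx]; exact hP))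
  have hN : ∀ z, 3 * q δ b x y * |g (z + h) - g z - ⟪G z, h⟫| / ‖h‖ ^ 3 ≤ 3 * (δ * b) ^ 2 * (1 / ‖h‖) := by
    intro z
    have hdb := mul_pos t.hδ t.hb
    calc _ ≤ 3 * (δ * b) * (δ * b * ‖h‖ * ‖h‖) / ‖h‖ ^ 3 := by
          gcongr
          · exact t.q_le
          · exact t.N_abs z h
      _ = _ := by field_simp
  have hU : q δ b x y * (‖h‖ ^ 2 / (2 * ‖x - y‖)) *
      |kk (g (x + h) - g x) ⟪G x, h⟫ ‖h‖ - kk (g (y + h) - g y) ⟪G y, h⟫ ‖h‖| ≤ 23 * (δ * b) ^ 2 * (1 / ‖h‖) := by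
    have hdb := mul_pos t.hδ t.hb
    calc _ ≤ (δ * b) * (‖h‖ ^ 2 / (2 * ‖x - y‖)) * (45 * (δ * b * ‖x - y‖) / ‖h‖ ^ 3) := by
          gcongr
          · exact t.q_le
          · refine hdk.trans ?_
            gcongr
            exact Wm_le t.hδ t.hb hξ.le
      _ = 45 / 2 * (δ * b) ^ 2 * (1 / ‖h‖) := by field_simp
      _ ≤ _ := by gcongr; norm_num
  have h1 := hN x
  have h2 := hN y
  unfold Jr
  rw [if_pos hρ]
  nlinarith [hmix, hT1.2, hT2.1, h1, h2, hU]

lemma far_pt (t : Touch C M1 δ b g G H x y e) {h : E2} (hρ : ‖x - y‖ / 4 ≤ ‖h‖) :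
    Jr (‖x - y‖ / 4) g G H x e h - Jr (‖x - y‖ / 4) g G H y e h ≤
      24 * δ ^ 2 * (b * ‖x - y‖) * √b * (√‖h‖ / ‖h‖ ^ 3) := by
  have hPx := t.P_eq h
  have hPy := t.Py_eq h
  have hξ := t.ξpos
  have hr : 0 < ‖h‖ := by linarith
  have hq := t.qpos
  have hδ := t.hδ
  have hb := t.hb
  have hU : Wm δ b (‖x - y‖ + ‖h‖) - Wm δ b ‖x - y‖ ≤ δ * (√b * √‖h‖ / 2) := by
    unfold Wm
    rw [← mul_sub, mul_add, ← Real.sqrt_mul hb.le]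
    gcongr
    exact psi_add_le (by positivity) (by positivity)
  have hU2 : Wm δ b ‖h‖ ≤ δ * (√b * √‖h‖ / 2) := by
    unfold Wm
    rw [← Real.sqrt_mul hb.le]
    gcongr
    have := psi_add_le (u := 0) (v := b * ‖h‖) le_rfl (by positivity)
    rwa [psi_zero, zero_add, sub_zero] at this
  have hl : 0 ≤ (1 - 5 * M1 ^ 2) / 2 / ‖h‖ ^ 3 := by have := t.h5; apply div_nonneg; linarith; positivity
  have hmix := mix (α := ⟪G (x + h) - G x, e⟫) (β := ⟪G (y + h) - G y, e⟫)
    (U := δ * (√b * √‖h‖ / 2))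
    ((t.dth_leU' h).trans hU)
    (by
      have := t.symm.dth_leU' h
      rw [inner_neg_right, norm_sub_rev y x] at this
      linarith)
    (t.sync h) (hl.trans (t.k_low x hr)) (hl.trans (t.k_low y hr))
  have hdk := t.dk hr
  have hW := Wm_le hδ hb hξ.le
  have hA : δ * (√b * √‖h‖ / 2) * |kk (g (x + h) - g x) ⟪G x, h⟫ ‖h‖ - kk (g (y + h) - g y) ⟪G y, h⟫ ‖h‖| ≤
      45 / 2 * (δ ^ 2 * (b * ‖x - y‖) * √b * (√‖h‖ / ‖h‖ ^ 3)) := by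
    calc _ ≤ δ * (√b * √‖h‖ / 2) * (45 * (δ * b * ‖x - y‖) / ‖h‖ ^ 3) := by
          gcongr
          refine hdk.trans ?_
          gcongr
      _ = _ := by field_simp
  have hB : |⟪H x h, e⟫ * (KK (g (x + h) - g x) ‖h‖ - KK (g (y + h) - g y) ‖h‖)| ≤
      3 / 2 * (δ ^ 2 * (b * ‖x - y‖) * √b * (√‖h‖ / ‖h‖ ^ 3)) := by
    rw [abs_mul]
    calc _ ≤ (δ * b * ‖h‖) * (3 * (δ * (√b * √‖h‖ / 2) * ‖x - y‖) / ‖h‖ ^ 4) := by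
          gcongr
          · refine (t.P_abs h).trans ?_
            gcongr
            exact t.q_le
          · refine (KK_diff _ _ _ hr).trans ?_
            gcongr
            refine (t.ddl2 h).trans ?_
            gcongr
      _ = _ := by field_simp
  have hB' := (abs_le.1 hB).1
  unfold Jr
  rw [if_neg (by linarith), hPy, ← hPx]
  linarith

lemma gain_pt (t : Touch C M1 δ b g G H x y e) {h h' : E2} (hρ : ‖h‖ < ‖x - y‖ / 4)
    (hh : h - h' = (2 * h1 x y h / ‖x - y‖) • (x - y)) (hh1 : h1 x y h' = - h1 x y h) :
    (⟪G (x + h) - G x, e⟫ - ⟪H x h, e⟫) - (⟪G (y + h') - G y, e⟫ - ⟪H y h', e⟫) ≤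
      - (2 * δ * b ^ 2 / (√(2 * (b * ‖x - y‖)) * (1 + √(2 * (b * ‖x - y‖))) ^ 3)) * h1 x y h ^ 2 := by
  have hξ := t.ξpos
  have hδ := t.hδ
  have hb := t.hb
  have ha := abs_le.1 (h1_abs x y h)
  have a1 := t.inner_le (x + h) (y + h')
  have a2 := t.inn
  have e1 : ‖x + h - (y + h')‖ = ‖x - y‖ + 2 * h1 x y h := by
    rw [show x + h - (y + h') = (1 : ℝ) • (x - y) + (h - h') by rw [one_smul]; abel, hh, ← add_smul, norm_smul,
      Real.norm_eq_abs, abs_of_nonneg]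
    · field_simp
    · rw [show 1 + 2 * h1 x y h / ‖x - y‖ = (‖x - y‖ + 2 * h1 x y h) / ‖x - y‖ by field_simp]
      apply div_nonneg _ hξ.le
      linarith
  rw [e1] at a1
  have st := psi_strict (u := b * ‖x - y‖) (v := b * (2 * h1 x y h)) (by positivity) (by
    rw [abs_mul, abs_of_pos hb]
    gcongr
    rw [abs_le]; constructor <;> linarith)
  have st2 := mul_le_mul_of_nonneg_left st hδ.le
  rw [t.P_eq h, t.Py_eq h', hh1]
  unfold q
  unfold Wm at a1 a2
  rw [inner_sub_left] at a1 a2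
  rw [inner_sub_left, inner_sub_left]
  rw [← mul_add] at st2
  set B := 1 / (√(2 * (b * ‖x - y‖)) * (1 + √(2 * (b * ‖x - y‖))) ^ 3) with hB
  have e2 : 2 * δ * b ^ 2 / (√(2 * (b * ‖x - y‖)) * (1 + √(2 * (b * ‖x - y‖))) ^ 3) = 2 * δ * b ^ 2 * B := by
    rw [hB]; ring
  rw [e2]
  nlinarith [a1, a2, st2]

lemma refl_sub (hne : x ≠ y) (h : E2) :
    h - (Submodule.span ℝ {x - y})ᗮ.reflection h = (2 * h1 x y h / ‖x - y‖) • (x - y) := by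
  have hξ : 0 < ‖x - y‖ := norm_pos_iff.2 (sub_ne_zero.2 hne)
  rw [Submodule.reflection_orthogonal_apply, Submodule.reflection_singleton_apply]
  simp only [RCLike.ofReal_real_eq_id, id]
  rw [sub_neg_eq_add, add_sub_cancel, ← smul_assoc]
  congr 1
  unfold h1
  simp
  field_simp

lemma refl_h1 (hne : x ≠ y) (h : E2) :
    h1 x y ((Submodule.span ℝ {x - y})ᗮ.reflection h) = - h1 x y h := by
  have hξ : 0 < ‖x - y‖ := norm_pos_iff.2 (sub_ne_zero.2 hne)
  have e1 : (Submodule.span ℝ {x - y})ᗮ.reflection h = h - (2 * h1 x y h / ‖x - y‖) • (x - y) := by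
    rw [← refl_sub hne]; abel
  rw [e1]
  have : ∀ c : ℝ, h1 x y (h - c • (x - y)) = h1 x y h - c * ‖x - y‖ := by
    intro c
    unfold h1
    rw [inner_sub_right, inner_smul_right, real_inner_self_eq_norm_sq]
    field_simp
  rw [this]
  field_simp
  ring

lemma P_meas (z : E2) : Measurable fun h => ⟪H z h, e⟫ := meas_HP (H z) e

lemma near_total (t : Touch C M1 δ b g G H x y e) :
    ∫ h in near (‖x - y‖ / 4), (Jr (‖x - y‖ / 4) g G H x e h - Jr (‖x - y‖ / 4) g G H y e h) ≤
      46 * δ ^ 2 * b * (b * ‖x - y‖) - (1 - 5 * M1 ^ 2) / 2 * δ * b * √(b * ‖x - y‖) /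
        (1 + √(2 * (b * ‖x - y‖))) ^ 3 := by
  have hξ := t.ξpos
  have hδ := t.hδ
  have hb := t.hb
  have hρ : 0 < ‖x - y‖ / 4 := by positivity
  set ρ := ‖x - y‖ / 4 with hρd
  set lam := (1 - 5 * M1 ^ 2) / 2 with hlam
  have hl : 0 < lam := by have := t.h5; rw [hlam]; linarith
  set R := (Submodule.span ℝ {x - y})ᗮ.reflection with hR
  set A : E2 → E2 → ℝ := fun z h => (⟪G (z + h) - G z, e⟫ - ⟪H z h, e⟫) / ‖h‖ ^ 3 with hA
  have hAint : ∀ z, IntegrableOn (A z) (near ρ) := by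
    intro z
    refine near_of_bound (B := C) hρ (by
      have := t.n.meas_dG z e; have := P_meas (H := H) (e := e) z; rw [hA]; fun_prop) ?_
    intro h hh
    have hr : 0 < ‖h‖ := norm_pos_iff.2 hh
    rw [hA]
    simp only
    rw [← inner_sub_left, abs_div, abs_of_pos (show 0 < ‖h‖ ^ 3 by positivity)]
    calc _ ≤ C * ‖h‖ ^ 2 / ‖h‖ ^ 3 := by
          gcongr
          exact (abs_inner_le_unit _ t.he.le).trans (t.n.dGP_le z h)
      _ = _ := by field_simp
  set c := 2 * δ * b ^ 2 / (√(2 * (b * ‖x - y‖)) * (1 + √(2 * (b * ‖x - y‖))) ^ 3) with hc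
  have hv : ‖(‖x - y‖⁻¹) • (x - y)‖ = 1 := by
    rw [norm_smul, norm_inv, norm_norm]; field_simp
  have hI := h1_int hv hρ
  have hh1 : ∀ h, ⟪(‖x - y‖⁻¹) • (x - y), h⟫ = h1 x y h := by
    intro h; unfold h1; rw [real_inner_smul_left]; field_simp
  simp only [hh1] at hI
  have hgain : (∫ h in near ρ, A x h) - (∫ h in near ρ, A y h) ≤ - c * (Real.pi * ρ) := by
    rw [← near_iso ρ R (A y), ← hI.2, ← integral_const_mul, ← integral_sub (hAint x) (near_iso_int ρ R (hAint y))]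
    refine setIntegral_mono_on ((hAint x).sub (near_iso_int ρ R (hAint y))) (hI.1.const_mul _) (near_meas ρ) ?_
    intro h hh
    simp only [hA, R.norm_map]
    rw [← sub_div, ← mul_div_assoc]
    gcongr
    exact t.gain_pt hh (refl_sub t.hne h) (refl_h1 t.hne h)
  have i1 := (t.n.Jr_int hρ x t.he.le).integrableOn (s := near ρ)
  have i2 := (t.n.Jr_int hρ y t.he.le).integrableOn (s := near ρ)
  have hmono : ∫ h in near ρ, (Jr ρ g G H x e h - Jr ρ g G H y e h) ≤
      ∫ h in near ρ, (lam * (A x h - A y h) + 29 * (δ * b) ^ 2 * (1 / ‖h‖)) := by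
    refine setIntegral_mono_on_ae (i1.sub i2)
      ((((hAint x).sub (hAint y)).const_mul lam).add ((near1 hρ).1.const_mul _)) (near_meas ρ) ?_
    filter_upwards [ae_ne_zero] with h hh hn
    refine (t.near_pt (norm_pos_iff.2 hh) hn).trans (le_of_eq ?_)
    simp only [hA]
    ring
  have hval : ∫ h in near ρ, (lam * (A x h - A y h) + 29 * (δ * b) ^ 2 * (1 / ‖h‖)) =
      lam * ((∫ h in near ρ, A x h) - ∫ h in near ρ, A y h) + 29 * (δ * b) ^ 2 * (2 * Real.pi * ρ) := by
    have hxy : IntegrableOn (fun h => A x h - A y h) (near ρ) := (hAint x).sub (hAint y)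
    rw [integral_add (hxy.const_mul lam) ((near1 hρ).1.const_mul _),
      integral_const_mul, integral_const_mul, (near1 hρ).2]
    congr 2
    exact integral_sub (hAint x) (hAint y)
  rw [hval] at hmono
  refine hmono.trans ?_
  have h1 := mul_le_mul_of_nonneg_left hgain hl.le
  have p1 := Real.pi_gt_d2
  have p2 := Real.pi_lt_d2
  have hs : 0 < √(b * ‖x - y‖) := Real.sqrt_pos.2 (by positivity)
  have hs2 : √(b * ‖x - y‖) ^ 2 = b * ‖x - y‖ := Real.sq_sqrt (by positivity)
  have hB : √(2 * (b * ‖x - y‖)) = √2 * √(b * ‖x - y‖) := Real.sqrt_mul (by norm_num) _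
  have h2 : δ * b * √(b * ‖x - y‖) / (1 + √(2 * (b * ‖x - y‖))) ^ 3 ≤ c * (Real.pi * ρ) := by
    have hD : 0 < 1 + √(2 * (b * ‖x - y‖)) := by positivity
    have s2 : √2 ≤ 1.5 := by rw [Real.sqrt_le_left (by norm_num)]; norm_num
    have s2' : 0 < √2 := by positivity
    have : c * (Real.pi * ρ) = δ * b * √(b * ‖x - y‖) / (1 + √(2 * (b * ‖x - y‖))) ^ 3 * (Real.pi / (2 * √2)) := by
      rw [hc, hρd]
      set D := 1 + √(2 * (b * ‖x - y‖))
      rw [hB]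
      set s := √(b * ‖x - y‖)
      field_simp
      rw [hs2]; ring
    rw [this]
    apply le_mul_of_one_le_right (by positivity)
    rw [le_div_iff₀ (by positivity)]
    linarith
  have h3 := mul_le_mul_of_nonneg_left h2 hl.le
  have h4 : 29 * (δ * b) ^ 2 * (2 * Real.pi * ρ) ≤ 46 * δ ^ 2 * b * (b * ‖x - y‖) := by
    rw [hρd]
    have : 0 < δ ^ 2 * b * (b * ‖x - y‖) := by positivity
    nlinarith
  have e5 : lam * δ * b * √(b * ‖x - y‖) / (1 + √(2 * (b * ‖x - y‖))) ^ 3 =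
    lam * (δ * b * √(b * ‖x - y‖) / (1 + √(2 * (b * ‖x - y‖))) ^ 3) := by ring
  rw [e5]
  linarith

lemma far_total (t : Touch C M1 δ b g G H x y e) :
    ∫ h in far (‖x - y‖ / 4), (Jr (‖x - y‖ / 4) g G H x e h - Jr (‖x - y‖ / 4) g G H y e h) ≤
      604 * δ ^ 2 * b * √(b * ‖x - y‖) := by
  have hξ := t.ξpos
  have hδ := t.hδ
  have hb := t.hb
  have hρ : 0 < ‖x - y‖ / 4 := by positivity
  have i1 := (t.n.Jr_int hρ x t.he.le).integrableOn (s := far (‖x - y‖ / 4))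
  have i2 := (t.n.Jr_int hρ y t.he.le).integrableOn (s := far (‖x - y‖ / 4))
  have hmono := setIntegral_mono_on (i1.sub i2)
    ((far52 hρ).1.const_mul (24 * δ ^ 2 * (b * ‖x - y‖) * √b)) (far_meas _) (fun h hh => t.far_pt hh)
  refine hmono.trans ?_
  rw [integral_const_mul, (far52 hρ).2]
  have hsb : 0 < √b := Real.sqrt_pos.2 hb
  have hsξ : 0 < √‖x - y‖ := Real.sqrt_pos.2 hξ
  have hsξ2 : √‖x - y‖ ^ 2 = ‖x - y‖ := Real.sq_sqrt hξ.le
  have e1 : √(‖x - y‖ / 4) = √‖x - y‖ / 2 := by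
    rw [Real.sqrt_div hξ.le, show (4:ℝ) = 2 ^ 2 by norm_num, Real.sqrt_sq (by norm_num)]
  have e2 : 24 * δ ^ 2 * (b * ‖x - y‖) * √b * (4 * Real.pi / √(‖x - y‖ / 4)) =
      192 * Real.pi * (δ ^ 2 * b * √(b * ‖x - y‖)) := by
    rw [e1, Real.sqrt_mul hb.le]
    field_simp
    rw [hsξ2]; ring
  rw [e2]
  have : 0 ≤ δ ^ 2 * b * √(b * ‖x - y‖) := by positivity
  nlinarith [Real.pi_lt_d2, Real.pi_lt_d4]

lemma S_split (t : Touch C M1 δ b g G H x y e) :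
    (∫ h, Jr (‖x - y‖ / 4) g G H x e h) + ∫ h, Jr (‖x - y‖ / 4) g G H y (-e) h =
    (∫ h in near (‖x - y‖ / 4), (Jr (‖x - y‖ / 4) g G H x e h - Jr (‖x - y‖ / 4) g G H y e h)) +
    ∫ h in far (‖x - y‖ / 4), (Jr (‖x - y‖ / 4) g G H x e h - Jr (‖x - y‖ / 4) g G H y e h) := by
  have hρ : 0 < ‖x - y‖ / 4 := by have := t.ξpos; positivity
  have i1 := (t.n.Jr_int hρ x t.he.le)
  have i2 := (t.n.Jr_int hρ y t.he.le)
  simp only [Jr_neg]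
  rw [integral_neg, ← sub_eq_add_neg, ← integral_sub i1 i2, ← near_compl,
    ]
  exact (integral_add_compl (near_meas _) (i1.sub i2)).symm

/-- Region II -/
lemma region2 (t : Touch C M1 δ b g G H x y e) {N : ℝ} (hN : b * ‖x - y‖ ≤ N) :
    (∫ h, Jr (‖x - y‖ / 4) g G H x e h) + ∫ h, Jr (‖x - y‖ / 4) g G H y (-e) h ≤
    δ * b * √(b * ‖x - y‖) * (δ * (46 * √N + 604) - (1 - 5 * M1 ^ 2) / 2 / (1 + √(2 * N)) ^ 3) := by
  have hξ := t.ξpos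
  have hδ := t.hδ
  have hb := t.hb
  rw [t.S_split]
  have h1 := t.near_total
  have h2 := t.far_total
  set lam := (1 - 5 * M1 ^ 2) / 2 with hlam
  have hl : 0 < lam := by have := t.h5; rw [hlam]; linarith
  have hs : 0 < √(b * ‖x - y‖) := Real.sqrt_pos.2 (by positivity)
  have hs2 : √(b * ‖x - y‖) ^ 2 = b * ‖x - y‖ := Real.sq_sqrt (by positivity)
  have h3 : 46 * δ ^ 2 * b * (b * ‖x - y‖) ≤ 46 * δ ^ 2 * b * (√N * √(b * ‖x - y‖)) := by
    rw [← hs2, Real.sqrt_sq hs.le]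
    gcongr
    rw [sq]
    gcongr
  have h4 : lam * δ * b * √(b * ‖x - y‖) / (1 + √(2 * N)) ^ 3 ≤
      lam * δ * b * √(b * ‖x - y‖) / (1 + √(2 * (b * ‖x - y‖))) ^ 3 := by gcongr
  have e : δ * b * √(b * ‖x - y‖) * (δ * (46 * √N + 604) - lam / (1 + √(2 * N)) ^ 3) =
    46 * δ ^ 2 * b * (√N * √(b * ‖x - y‖)) - lam * δ * b * √(b * ‖x - y‖) / (1 + √(2 * N)) ^ 3 +
    604 * δ ^ 2 * b * √(b * ‖x - y‖) := by ring
  rw [e]; linarith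
end Touch
end Muskat
end Part11

section Part12
namespace Muskat

section
variable {C : ℝ} {g : E2 → ℝ} {G : E2 → E2} {H : E2 → E2 →L[ℝ] E2}

lemma Nice.N_int (n : Nice C g G H) (z h : E2) :
    |g (z + h) - g z - ⟪G z, h⟫| ≤ ‖h‖ * ∫ s in (0:ℝ)..1, ‖G (z + s • h) - G z‖ := by
  have hc := n.contG
  have h1 : ∀ s : ℝ, HasDerivAt (fun s : ℝ => g (z + s • h) - s * ⟪G z, h⟫)
      (⟪G (z + s • h) - G z, h⟫) s := by
    intro s
    have := (n.line z h s).sub ((hasDerivAt_id s).mul_const ⟪G z, h⟫)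
    exact this.congr_deriv (by rw [inner_sub_left]; simp)
  have h2 := intervalIntegral.integral_eq_sub_of_hasDerivAt (a := 0) (b := 1) (fun s _ => h1 s)
    (Continuous.intervalIntegrable (by fun_prop) _ _)
  simp only [one_smul, zero_smul, add_zero, one_mul, zero_mul, sub_zero] at h2
  rw [show g (z + h) - g z - ⟪G z, h⟫ = g (z + h) - ⟪G z, h⟫ - g z by ring, ← h2, mul_comm,
    ← intervalIntegral.integral_mul_const]
  refine (intervalIntegral.abs_integral_le_integral_abs (by norm_num)).trans ?_
  refine intervalIntegral.integral_mono_on (by norm_num) (Continuous.intervalIntegrable (by fun_prop) _ _)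
    (Continuous.intervalIntegrable (by fun_prop) _ _) ?_
  intro s _
  exact abs_real_inner_le_norm _ _

lemma Nice.w_int (n : Nice C g G H) (z : E2) {ρ : ℝ} (hρ : 0 < ρ) :
    IntegrableOn (fun h => ‖G (z + h) - G z‖ / ‖h‖ ^ 2) (near ρ) := by
  have hc := n.contG.measurable
  refine near_of_bound (B := C) hρ (by fun_prop) ?_
  intro h hh
  have hr : 0 < ‖h‖ := norm_pos_iff.2 hh
  rw [abs_of_nonneg (by positivity)]
  calc _ ≤ C * ‖h‖ / ‖h‖ ^ 2 := by gcongr; exact n.dG_le z h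
    _ = _ := by field_simp

lemma Nice.N_near (n : Nice C g G H) (z : E2) {ρ : ℝ} (hρ : 0 < ρ) :
    IntegrableOn (fun h => |g (z + h) - g z - ⟪G z, h⟫| / ‖h‖ ^ 3) (near ρ) := by
  have hc := n.contg
  refine near_of_bound (B := C) hρ (by
    have h1 : Measurable (fun h => g (z + h) - g z - ⟪G z, h⟫) := by
      exact (Continuous.measurable (by fun_prop))
    have h2 : Measurable (fun h => |g (z + h) - g z - ⟪G z, h⟫|) := continuous_abs.measurable.comp h1
    fun_prop) ?_
  intro h hh
  have hr : 0 < ‖h‖ := norm_pos_iff.2 hh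
  rw [abs_of_nonneg (by positivity)]
  calc _ ≤ C * ‖h‖ ^ 2 / ‖h‖ ^ 3 := by gcongr; exact n.N2_le z h
    _ = _ := by field_simp

lemma Nice.hardy (n : Nice C g G H) (z : E2) {ρ : ℝ} (hρ : 0 < ρ) :
    ∫ h in near ρ, |g (z + h) - g z - ⟪G z, h⟫| / ‖h‖ ^ 3 ≤
      ∫ h in near ρ, ‖G (z + h) - G z‖ / ‖h‖ ^ 2 := by
  have hcG := n.contG
  set F : E2 → ℝ := fun h => ‖G (z + h) - G z‖ / ‖h‖ ^ 2 with hF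
  set Q : E2 → ℝ → ℝ := fun h s => ‖G (z + s • h) - G z‖ / ‖h‖ ^ 2 with hQ
  -- joint integrability
  have hjoint : Integrable (Function.uncurry Q) ((volume.restrict (near ρ)).prod (volume.restrict (Ioc (0:ℝ) 1))) := by
    have hd : Integrable (fun p : E2 × ℝ => C * (1 / ‖p.1‖)) ((volume.restrict (near ρ)).prod (volume.restrict (Ioc (0:ℝ) 1))) :=
      Integrable.comp_fst (f := fun h : E2 => C * (1 / ‖h‖)) ((near1 hρ).1.const_mul C) _
    refine hd.mono' ?_ ?_
    · have h1 : Measurable (fun p : E2 × ℝ => ‖G (z + p.2 • p.1) - G z‖) :=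
        Continuous.measurable (by fun_prop)
      have h2 : Measurable (fun p : E2 × ℝ => ‖p.1‖ ^ 2) := Continuous.measurable (by fun_prop)
      exact (h1.div h2).aestronglyMeasurable
    · have ha : ∀ᵐ p ∂((volume.restrict (near ρ)).prod (volume.restrict (Ioc (0:ℝ) 1))), p.1 ≠ 0 :=
        Measure.quasiMeasurePreserving_fst.ae (ae_restrict_of_ae ae_ne_zero)
      have hb : ∀ᵐ p ∂((volume.restrict (near ρ)).prod (volume.restrict (Ioc (0:ℝ) 1))), p.2 ∈ Ioc (0:ℝ) 1 :=
        Measure.quasiMeasurePreserving_snd.ae (ae_restrict_mem measurableSet_Ioc)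
      filter_upwards [ha, hb] with p hp hs
      have hr : 0 < ‖p.1‖ := norm_pos_iff.2 hp
      simp only [Function.uncurry, hQ]
      rw [Real.norm_eq_abs, abs_of_nonneg (by positivity)]
      calc _ ≤ C * ‖p.1‖ / ‖p.1‖ ^ 2 := by
            gcongr
            refine (n.dG_le z (p.2 • p.1)).trans ?_
            have := n.hC
            gcongr
            rw [norm_smul, Real.norm_eq_abs, abs_of_pos hs.1]
            exact mul_le_of_le_one_left hr.le hs.2
        _ = _ := by field_simp
  have hswap := integral_integral_swap hjoint
  have h1 : ∫ h in near ρ, |g (z + h) - g z - ⟪G z, h⟫| / ‖h‖ ^ 3 ≤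
      ∫ h in near ρ, ∫ s in Ioc (0:ℝ) 1, Q h s := by
    refine setIntegral_mono_on_ae (n.N_near z hρ) hjoint.integral_prod_left (near_meas ρ) ?_
    filter_upwards [ae_ne_zero] with h hh _
    have hr : 0 < ‖h‖ := norm_pos_iff.2 hh
    have := n.N_int z h
    rw [intervalIntegral.integral_of_le (by norm_num)] at this
    simp only [hQ]
    rw [integral_div]
    calc _ ≤ _ := div_le_div_of_nonneg_right this (by positivity)
      _ = _ := by field_simp
  refine h1.trans ?_
  rw [hswap]
  have h2 : ∀ s ∈ Ioc (0:ℝ) 1, ∫ h in near ρ, Q h s ≤ ∫ h in near ρ, F h := by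
    intro s hs
    have e1 : ∀ h, Q h s = s ^ 2 * F (s • h) := by
      intro h
      simp only [hQ, hF]
      rw [norm_smul, Real.norm_eq_abs, abs_of_pos hs.1]
      have := hs.1.ne'
      rcases eq_or_ne ‖h‖ 0 with h0 | h0
      · rw [h0]; simp
      · field_simp
    simp only [e1]
    rw [integral_const_mul, Measure.setIntegral_comp_smul_of_pos volume F (near ρ) hs.1, finrank_E2, smul_eq_mul,
      ← mul_assoc, mul_inv_cancel₀ (pow_ne_zero 2 hs.1.ne'), one_mul]
    refine setIntegral_mono_set (n.w_int z hρ) (Eventually.of_forall fun h => by simp only [hF]; positivity) ?_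
    refine (LE.le.eventuallyLE ?_)
    rintro _ ⟨h, hh, rfl⟩
    change ‖s • h‖ < ρ
    change ‖h‖ < ρ at hh
    rw [norm_smul, Real.norm_eq_abs, abs_of_pos hs.1]
    exact (mul_le_of_le_one_left (norm_nonneg _) hs.2).trans_lt hh
  have h3 : ∫ s in Ioc (0:ℝ) 1, ∫ h in near ρ, Q h s ≤ ∫ s in Ioc (0:ℝ) 1, ∫ h in near ρ, F h := by
    refine setIntegral_mono_on hjoint.integral_prod_right (by simp) measurableSet_Ioc h2
  refine h3.trans (le_of_eq ?_)
  simp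
end

namespace Touch
variable {C M1 δ b : ℝ} {g : E2 → ℝ} {G : E2 → E2} {H : E2 → E2 →L[ℝ] E2} {x y e : E2}

lemma sqrt_add_le' (p q : ℝ) (hp : 0 ≤ p) (hq : 0 ≤ q) : √(p + q) ≤ √p + √q := by
  rw [Real.sqrt_le_left (by positivity)]
  nlinarith [Real.sq_sqrt hp, Real.sq_sqrt hq, Real.sqrt_nonneg p, Real.sqrt_nonneg q,
    mul_nonneg (Real.sqrt_nonneg p) (Real.sqrt_nonneg q)]

lemma w_bound (t : Touch C M1 δ b g G H x y e) {h : E2} (hρ : ‖h‖ ≤ ‖x - y‖) {d : ℝ}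
    (hd : d = q δ b x y * (‖h‖ ^ 2 / (2 * ‖x - y‖)) - (⟪G (x + h) - G x, e⟫ - ⟪H x h, e⟫)) :
    0 ≤ d ∧ ‖G (x + h) - G x‖ ≤ 3 * Wm δ b ‖x - y‖ * (√‖h‖ / √‖x - y‖) + √(2 * Wm δ b ‖x - y‖ * d) := by
  have hξ := t.ξpos
  have hq := t.qpos
  have hd0 : 0 ≤ d := by
    have := t.dth_leU h
    rw [hd, t.P_eq]; linarith
  refine ⟨hd0, ?_⟩
  set A := Wm δ b ‖x - y‖ with hA
  have hApos : 0 < A := t.Wpos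
  have hr := norm_nonneg h
  have h1 : ‖G (x + h) - G y‖ ≤ A + q δ b x y * ‖h‖ := by
    refine (t.hW (x + h) y).trans ((Wm_tangent t.hδ t.hb hξ (norm_nonneg _)).trans ?_)
    have : ‖x + h - y‖ ≤ ‖x - y‖ + ‖h‖ := by
      rw [show x + h - y = x - y + h by abel]; exact norm_add_le _ _
    have := mul_le_mul_of_nonneg_left this hq.le
    unfold q at *
    linarith
  have h2 : ‖G (x + h) - G y‖ ^ 2 = A ^ 2 + 2 * A * ⟪G (x + h) - G x, e⟫ + ‖G (x + h) - G x‖ ^ 2 := by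
    rw [show G (x + h) - G y = (G x - G y) + (G (x + h) - G x) by abel, norm_add_sq_real, t.heq, norm_smul, t.he,
      real_inner_smul_left, real_inner_comm, Real.norm_eq_abs, mul_one, sq_abs]
    ring
  have h3 : ‖G (x + h) - G y‖ ^ 2 ≤ (A + q δ b x y * ‖h‖) ^ 2 := by gcongr
  have hP := (abs_le.1 (t.P_abs h)).1
  have hU : 0 ≤ q δ b x y * (‖h‖ ^ 2 / (2 * ‖x - y‖)) := by positivity
  have h4 : ‖G (x + h) - G x‖ ^ 2 ≤ 4 * A * (q δ b x y * ‖h‖) + (q δ b x y * ‖h‖) ^ 2 + 2 * A * d := by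
    nlinarith
  set κ := ‖h‖ / ‖x - y‖ with hκ
  have hκ1 : κ ≤ 1 := by rw [hκ, div_le_one hξ]; exact hρ
  have hκ0 : 0 ≤ κ := by positivity
  have h5 : q δ b x y * ‖h‖ ≤ A * κ := by
    have := mul_le_mul_of_nonneg_right t.qξ_le hκ0
    have e1 : q δ b x y * ‖x - y‖ * κ = q δ b x y * ‖h‖ := by rw [hκ]; field_simp
    linarith
  have hqr : 0 ≤ q δ b x y * ‖h‖ := by positivity
  have h6 : ‖G (x + h) - G x‖ ^ 2 ≤ (3 * A) ^ 2 * κ + 2 * A * d := by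
    have h7 : (q δ b x y * ‖h‖) ^ 2 ≤ (A * κ) ^ 2 := by gcongr
    have h8 : (A * κ) ^ 2 ≤ A ^ 2 * κ := by nlinarith [sq_nonneg A, mul_nonneg (sq_nonneg A) (mul_nonneg hκ0 (sub_nonneg.2 hκ1))]
    nlinarith [mul_le_mul_of_nonneg_left h5 hApos.le, mul_nonneg (sq_nonneg A) hκ0]
  have h9 := Real.le_sqrt_of_sq_le h6
  refine h9.trans ((sqrt_add_le' _ _ (by positivity) (by positivity)).trans ?_)
  rw [Real.sqrt_mul (by positivity), Real.sqrt_sq (by positivity), hκ, Real.sqrt_div hr]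

lemma near_one_pt (t : Touch C M1 δ b g G H x y e) {h : E2} (hr : 0 < ‖h‖) (hρ : ‖h‖ < ‖x - y‖ / 4) :
    ∃ d : ℝ, Jr (‖x - y‖ / 4) g G H x e h ≤ 3 / 2 * (q δ b x y / ‖x - y‖) * (1 / ‖h‖)
        - (1 - 5 * M1 ^ 2) / 2 * d / ‖h‖ ^ 3 + 3 * q δ b x y * (|g (x + h) - g x - ⟪G x, h⟫| / ‖h‖ ^ 3) ∧
      3 * q δ b x y * (‖G (x + h) - G x‖ / ‖h‖ ^ 2) - (1 - 5 * M1 ^ 2) / 2 * d / ‖h‖ ^ 3 ≤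
        9 * q δ b x y / √‖x - y‖ * (√‖h‖ / ‖h‖ ^ 2) +
        9 * q δ b x y ^ 2 / (2 * ((1 - 5 * M1 ^ 2) / 2)) * (1 / ‖h‖) ∧
      d = q δ b x y * (‖h‖ ^ 2 / (2 * ‖x - y‖)) - (⟪G (x + h) - G x, e⟫ - ⟪H x h, e⟫) := by
  have hξ := t.ξpos
  have hq := t.qpos
  obtain ⟨hd0, hw⟩ := t.w_bound (h := h) (by linarith) rfl
  refine ⟨_, ?_, ?_, rfl⟩
  · have hT := (abs_le.1 (t.T2_abs x hr (t.P_abs h))).2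
    have ku := t.k_up x hr
    have kl := t.k_low x hr
    set U := q δ b x y * (‖h‖ ^ 2 / (2 * ‖x - y‖)) with hU
    have hU0 : 0 ≤ U := by positivity
    set k := kk (g (x + h) - g x) ⟪G x, h⟫ ‖h‖
    unfold Jr
    rw [if_pos hρ]
    set d := U - (⟪G (x + h) - G x, e⟫ - ⟪H x h, e⟫) with hd
    have e1 : 3 / 2 * (q δ b x y / ‖x - y‖) * (1 / ‖h‖) = U * (3 / ‖h‖ ^ 3) := by
      rw [hU]; field_simp
    have e2 : (1 - 5 * M1 ^ 2) / 2 * d / ‖h‖ ^ 3 = d * ((1 - 5 * M1 ^ 2) / 2 / ‖h‖ ^ 3) := by ring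
    have e3 : 3 * q δ b x y * (|g (x + h) - g x - ⟪G x, h⟫| / ‖h‖ ^ 3) =
      3 * q δ b x y * |g (x + h) - g x - ⟪G x, h⟫| / ‖h‖ ^ 3 := by ring
    rw [e1, e2, e3]
    have := mul_le_mul_of_nonneg_left ku hU0
    have := mul_le_mul_of_nonneg_left kl hd0
    have : ⟪G (x + h) - G x, e⟫ = U - d + ⟪H x h, e⟫ := by rw [hd]; ring
    rw [this]
    nlinarith
  · set d := q δ b x y * (‖h‖ ^ 2 / (2 * ‖x - y‖)) - (⟪G (x + h) - G x, e⟫ - ⟪H x h, e⟫) with hd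
    set A := Wm δ b ‖x - y‖ with hA
    have hA1 : A ≤ 1 := t.W_le_one
    have hA0 : 0 < A := t.Wpos
    set lam := (1 - 5 * M1 ^ 2) / 2 with hlam
    have hl : 0 < lam := by have := t.h5; rw [hlam]; linarith
    set s := √(2 * A * d) with hs
    have hs2 : s ^ 2 = 2 * A * d := Real.sq_sqrt (by positivity)
    have hs0 : 0 ≤ s := Real.sqrt_nonneg _
    have hsξ : 0 < √‖x - y‖ := Real.sqrt_pos.2 hξ
    have step1 : 3 * q δ b x y * (‖G (x + h) - G x‖ / ‖h‖ ^ 2) ≤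
        9 * q δ b x y / √‖x - y‖ * (√‖h‖ / ‖h‖ ^ 2) + 3 * q δ b x y * s / ‖h‖ ^ 2 := by
      calc _ ≤ 3 * q δ b x y * ((3 * 1 * (√‖h‖ / √‖x - y‖) + s) / ‖h‖ ^ 2) := by
            gcongr
            refine hw.trans ?_
            gcongr
        _ = _ := by field_simp; ring
    have step2 : 3 * q δ b x y * s / ‖h‖ ^ 2 ≤ lam * d / ‖h‖ ^ 3 + 9 * q δ b x y ^ 2 / (2 * lam) * (1 / ‖h‖) := by
      have e1 : 9 * q δ b x y ^ 2 / (2 * lam) * (1 / ‖h‖) * A ≤ 9 * q δ b x y ^ 2 / (2 * lam) * (1 / ‖h‖) :=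
        mul_le_of_le_one_right (by positivity) hA1
      have hdd : d = s ^ 2 / (2 * A) := by rw [hs2]; field_simp
      have e2 : lam * d / ‖h‖ ^ 3 + 9 * q δ b x y ^ 2 / (2 * lam) * (1 / ‖h‖) * A - 3 * q δ b x y * s / ‖h‖ ^ 2 =
        (lam * s - 3 * q δ b x y * A * ‖h‖) ^ 2 / (2 * A * lam * ‖h‖ ^ 3) := by
        rw [hdd]; field_simp; ring
      have e3 : 0 ≤ (lam * s - 3 * q δ b x y * A * ‖h‖) ^ 2 / (2 * A * lam * ‖h‖ ^ 3) := by positivity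
      linarith
    linarith

lemma A_int (t : Touch C M1 δ b g G H x y e) (z : E2) {ρ : ℝ} (hρ : 0 < ρ) :
    IntegrableOn (fun h => (⟪G (z + h) - G z, e⟫ - ⟪H z h, e⟫) / ‖h‖ ^ 3) (near ρ) := by
  refine near_of_bound (B := C) hρ (by
    have := t.n.meas_dG z e; have := P_meas (H := H) (e := e) z; fun_prop) ?_
  intro h hh
  have hr : 0 < ‖h‖ := norm_pos_iff.2 hh
  rw [← inner_sub_left, abs_div, abs_of_pos (show 0 < ‖h‖ ^ 3 by positivity)]
  calc _ ≤ C * ‖h‖ ^ 2 / ‖h‖ ^ 3 := by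
        gcongr
        exact (abs_inner_le_unit _ t.he.le).trans (t.n.dGP_le z h)
    _ = _ := by field_simp

lemma near_one (t : Touch C M1 δ b g G H x y e) :
    ∫ h in near (‖x - y‖ / 4), Jr (‖x - y‖ / 4) g G H x e h ≤
      q δ b x y * Real.pi * (19 + 3 / ((1 - 5 * M1 ^ 2) / 2)) := by
  have hξ := t.ξpos
  have hq := t.qpos
  have hρ : 0 < ‖x - y‖ / 4 := by positivity
  set ρ := ‖x - y‖ / 4 with hρd
  set lam := (1 - 5 * M1 ^ 2) / 2 with hlam
  have hl : 0 < lam := by have := t.h5; rw [hlam]; linarith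
  set D : E2 → ℝ := fun h => (q δ b x y * (‖h‖ ^ 2 / (2 * ‖x - y‖)) - (⟪G (x + h) - G x, e⟫ - ⟪H x h, e⟫)) / ‖h‖ ^ 3 with hD
  have hDint : IntegrableOn D (near ρ) := by
    have h1 : IntegrableOn (fun h : E2 => q δ b x y / (2 * ‖x - y‖) * (1 / ‖h‖) -
        (⟪G (x + h) - G x, e⟫ - ⟪H x h, e⟫) / ‖h‖ ^ 3) (near ρ) :=
      ((near1 hρ).1.const_mul _).sub (t.A_int x hρ)
    refine h1.congr ?_
    filter_upwards [ae_restrict_of_ae ae_ne_zero] with h hh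
    have hr : 0 < ‖h‖ := norm_pos_iff.2 hh
    simp only [hD]
    rw [sub_div]
    congr 1
    field_simp
  set c1 := 3 / 2 * (q δ b x y / ‖x - y‖) with hc1
  set c2 := 9 * q δ b x y / √‖x - y‖ with hc2
  set c3 := 9 * q δ b x y ^ 2 / (2 * lam) with hc3
  have iN := t.n.N_near x hρ
  have iw := t.n.w_int x hρ
  have i1 := (near1 hρ).1
  have i32 := (near32 hρ).1
  have s1 : ∫ h in near ρ, Jr ρ g G H x e h ≤
      ∫ h in near ρ, (c1 * (1 / ‖h‖) - lam * D h + 3 * q δ b x y * (|g (x + h) - g x - ⟪G x, h⟫| / ‖h‖ ^ 3)) := by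
    refine setIntegral_mono_on_ae (t.n.Jr_int hρ x t.he.le).integrableOn
      (((i1.const_mul c1).sub (hDint.const_mul lam)).add (iN.const_mul _)) (near_meas ρ) ?_
    filter_upwards [ae_ne_zero] with h hh hn
    obtain ⟨d, a1, -, rfl⟩ := t.near_one_pt (norm_pos_iff.2 hh) hn
    simp only [hD]
    rw [← mul_div_assoc lam]
    exact a1
  have s2 : ∫ h in near ρ, (3 * q δ b x y * (‖G (x + h) - G x‖ / ‖h‖ ^ 2) - lam * D h) ≤
      ∫ h in near ρ, (c2 * (√‖h‖ / ‖h‖ ^ 2) + c3 * (1 / ‖h‖)) := by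
    refine setIntegral_mono_on_ae ((iw.const_mul _).sub (hDint.const_mul lam))
      ((i32.const_mul c2).add (i1.const_mul c3)) (near_meas ρ) ?_
    filter_upwards [ae_ne_zero] with h hh hn
    obtain ⟨d, -, a2, rfl⟩ := t.near_one_pt (norm_pos_iff.2 hh) hn
    simp only [hD]
    rw [← mul_div_assoc lam]
    exact a2
  have j1 : IntegrableOn (fun h => c1 * (1 / ‖h‖) - lam * D h) (near ρ) := (i1.const_mul c1).sub (hDint.const_mul lam)
  rw [integral_add j1 (iN.const_mul _), integral_sub (i1.const_mul c1) (hDint.const_mul lam),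
    integral_const_mul, integral_const_mul, integral_const_mul, (near1 hρ).2] at s1
  rw [integral_sub (iw.const_mul _) (hDint.const_mul lam), integral_add (i32.const_mul c2) (i1.const_mul c3),
    integral_const_mul, integral_const_mul, integral_const_mul, integral_const_mul, (near1 hρ).2, (near32 hρ).2] at s2
  have hh := mul_le_mul_of_nonneg_left (t.n.hardy x hρ) (show 0 ≤ 3 * q δ b x y by positivity)
  have hsξ : 0 < √‖x - y‖ := Real.sqrt_pos.2 hξ
  have e0 : √ρ = √‖x - y‖ / 2 := by
    rw [hρd, Real.sqrt_div hξ.le, show (4:ℝ) = 2 ^ 2 by norm_num, Real.sqrt_sq (by norm_num)]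
  have e1 : c1 * (2 * Real.pi * ρ) = 3 / 4 * (q δ b x y * Real.pi) := by rw [hc1, hρd]; field_simp
  have e2 : c2 * (4 * Real.pi * √ρ) = 18 * (q δ b x y * Real.pi) := by rw [hc2, e0]; field_simp; ring
  have e3 : c3 * (2 * Real.pi * ρ) ≤ 3 / lam * (q δ b x y * Real.pi) := by
    have : c3 * (2 * Real.pi * ρ) = 9 / 4 / lam * (q δ b x y * Real.pi) * (q δ b x y * ‖x - y‖) := by
      rw [hc3, hρd]; field_simp
    rw [this]
    have h1 : q δ b x y * ‖x - y‖ ≤ 1 := t.qξ_le.trans t.W_le_one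
    have hp := Real.pi_pos
    calc _ ≤ 9 / 4 / lam * (q δ b x y * Real.pi) := mul_le_of_le_one_right (by positivity) h1
      _ ≤ _ := by gcongr; norm_num
  have hp : 0 < q δ b x y * Real.pi := mul_pos hq Real.pi_pos
  rw [mul_add]
  linarith

/-- the ball term -/
def Fb (G : E2 → E2) (x y e h : E2) : ℝ :=
  (near (‖x - y‖ / 4)).indicator (fun k => ⟪G (x - (1/2 : ℝ) • (x - y) + k) - G x, e⟫) (h + (1/2 : ℝ) • (x - y))

lemma Fb_far {h : E2} (hx : x ≠ y) (hh : h ∉ far (‖x - y‖ / 4)) : Fb G x y e h = 0 := by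
  have hξ : 0 < ‖x - y‖ := norm_pos_iff.2 (sub_ne_zero.2 hx)
  unfold Fb
  apply indicator_of_notMem
  intro hk
  change ‖h + (1/2 : ℝ) • (x - y)‖ < _ at hk
  have hh' : ‖h‖ < ‖x - y‖ / 4 := not_le.1 hh
  have e1 : ‖(1/2 : ℝ) • (x - y)‖ = ‖x - y‖ / 2 := by rw [norm_smul]; norm_num; ring
  have := norm_sub_le (h + (1/2 : ℝ) • (x - y)) h
  rw [add_sub_cancel_left, e1] at this
  linarith

lemma far_one_pt (t : Touch C M1 δ b g G H x y e) {h : E2} (hρ : ‖x - y‖ / 4 ≤ ‖h‖) :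
    ⟪G (x + h) - G x, e⟫ * kk (g (x + h) - g x) ⟪G x, h⟫ ‖h‖ ≤
      3 * δ / √‖x - y‖ * (√‖h‖ / ‖h‖ ^ 3) + (1 - 5 * M1 ^ 2) / 2 / (3 * ‖x - y‖ / 4) ^ 3 * Fb G x y e h := by
  have hξ := t.ξpos
  have hr : 0 < ‖h‖ := by linarith
  have hδ := t.hδ
  have hb := t.hb
  have hl : 0 < (1 - 5 * M1 ^ 2) / 2 := by have := t.h5; linarith
  have hU : ⟪G (x + h) - G x, e⟫ ≤ δ * (√‖h‖ / √‖x - y‖) := by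
    refine (t.dth_leU' h).trans ?_
    unfold Wm
    rw [← mul_sub, mul_add]
    gcongr
    refine (psi_add_le' (by positivity) (by positivity)).trans (le_of_eq ?_)
    rw [Real.sqrt_mul hb.le, Real.sqrt_mul hb.le]
    have := Real.sqrt_pos.2 hb
    field_simp
  have hU0 : 0 ≤ δ * (√‖h‖ / √‖x - y‖) := by positivity
  have ku := t.k_up x hr
  have kl := t.k_low x hr
  set k := kk (g (x + h) - g x) ⟪G x, h⟫ ‖h‖
  have e1 : 3 * δ / √‖x - y‖ * (√‖h‖ / ‖h‖ ^ 3) = δ * (√‖h‖ / √‖x - y‖) * (3 / ‖h‖ ^ 3) := by ring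
  rw [e1]
  set U := δ * (√‖h‖ / √‖x - y‖)
  have h3 : 0 ≤ 3 / ‖h‖ ^ 3 := by positivity
  have gen : ∀ m : ℝ, 0 ≤ m → m ≤ k → ⟪G (x + h) - G x, e⟫ * k ≤ U * (3 / ‖h‖ ^ 3) + m * ⟪G (x + h) - G x, e⟫ := by
    intro m hm hmk
    have := mul_le_mul_of_nonneg_right hU (sub_nonneg.2 hmk)
    have := mul_le_mul_of_nonneg_left (show k - m ≤ 3 / ‖h‖ ^ 3 by linarith) hU0
    linarith
  have hk0 : 0 ≤ k := le_trans (by positivity) kl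
  unfold Fb
  by_cases hB : h + (1/2 : ℝ) • (x - y) ∈ near (‖x - y‖ / 4)
  · rw [indicator_of_mem hB, show x - (1/2 : ℝ) • (x - y) + (h + (1/2 : ℝ) • (x - y)) = x + h by abel]
    apply gen _ (by positivity)
    refine le_trans ?_ kl
    gcongr
    have hB' : ‖h + (1/2 : ℝ) • (x - y)‖ < ‖x - y‖ / 4 := hB
    have e1 : ‖(1/2 : ℝ) • (x - y)‖ = ‖x - y‖ / 2 := by rw [norm_smul]; norm_num; ring
    have := norm_sub_le (h + (1/2 : ℝ) • (x - y)) ((1/2 : ℝ) • (x - y))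
    rw [add_sub_cancel_right, e1] at this
    linarith
  · rw [indicator_of_notMem hB, mul_zero, add_zero]
    have := gen 0 le_rfl hk0
    linarith

lemma vol_near {ρ : ℝ} (hρ : 0 < ρ) : (volume : Measure E2).real (near ρ) = Real.pi * ρ ^ 2 := by
  have : near ρ = Metric.ball 0 ρ := by ext h; simp [near]
  rw [this, Measure.real, EuclideanSpace.volume_ball_fin_two]
  simp [ENNReal.toReal_mul, hρ.le, ENNReal.toReal_ofReal Real.pi_pos.le]
  ring

lemma vol_near_fin (ρ : ℝ) : (volume : Measure E2) (near ρ) < ⊤ := by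
  have : near ρ = Metric.ball 0 ρ := by ext h; simp [near]
  rw [this]; exact Metric.isBounded_ball.measure_lt_top

lemma phi_int (t : Touch C M1 δ b g G H x y e) (m : E2) (ρ : ℝ) (z : E2) :
    IntegrableOn (fun k => ⟪G (m + k) - G z, e⟫) (near ρ) := by
  have hc := t.n.contG
  refine Measure.integrableOn_of_bounded (M := 2 * C) (vol_near_fin ρ).ne (Continuous.aestronglyMeasurable (by fun_prop)) ?_
  refine Eventually.of_forall fun k => ?_
  refine (abs_inner_le_unit _ t.he.le).trans ?_
  refine (norm_sub_le _ _).trans ?_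
  linarith [t.n.bG (m + k), t.n.bG z]

lemma Fb_int (t : Touch C M1 δ b g G H x y e) : Integrable (Fb G x y e) ∧
    ∫ h in far (‖x - y‖ / 4), Fb G x y e h =
      ∫ k in near (‖x - y‖ / 4), ⟪G (x - (1/2 : ℝ) • (x - y) + k) - G x, e⟫ := by
  have h1 := (integrable_indicator_iff (near_meas (‖x - y‖ / 4))).2 (t.phi_int (x - (1/2 : ℝ) • (x - y)) (‖x - y‖ / 4) x)
  refine ⟨h1.comp_add_right _, ?_⟩
  rw [setIntegral_eq_integral_of_forall_compl_eq_zero (fun h hh => Fb_far t.hne hh)]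
  unfold Fb
  rw [integral_add_right_eq_self (μ := volume) (fun h => (near (‖x - y‖ / 4)).indicator (fun k => ⟪G (x - (1/2 : ℝ) • (x - y) + k) - G x, e⟫) h),
    integral_indicator (near_meas _)]

lemma far_one (t : Touch C M1 δ b g G H x y e) :
    ∫ h in far (‖x - y‖ / 4), (Jr (‖x - y‖ / 4) g G H x e h - Jr (‖x - y‖ / 4) g G H y e h) ≤
      (δ / ‖x - y‖) * (Real.pi * 72 - 4 * Real.pi / 27 * ((1 - 5 * M1 ^ 2) / 2) * psi (b * ‖x - y‖)) := by
  have hξ := t.ξpos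
  have hδ := t.hδ
  have hb := t.hb
  have hq := t.qpos
  have hρ : 0 < ‖x - y‖ / 4 := by positivity
  have i1 := (t.n.Jr_int hρ x t.he.le).integrableOn (s := far (‖x - y‖ / 4))
  have i2 := (t.n.Jr_int hρ y t.he.le).integrableOn (s := far (‖x - y‖ / 4))
  set ρ := ‖x - y‖ / 4 with hρd
  set lam := (1 - 5 * M1 ^ 2) / 2 with hlam
  set μ := lam / (3 * ‖x - y‖ / 4) ^ 3 with hμ
  set c := 3 * δ / √‖x - y‖ with hc
  obtain ⟨f1, v1⟩ := t.Fb_int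
  obtain ⟨f2, v2⟩ := t.symm.Fb_int
  rw [norm_sub_rev y x] at v2
  have k1 : IntegrableOn (fun h : E2 => 2 * c * (√‖h‖ / ‖h‖ ^ 3) + 3 * (q δ b x y * ‖x - y‖) * (1 / ‖h‖ ^ 3)) (far ρ) :=
    ((far52 hρ).1.const_mul _).add ((far3 hρ).1.const_mul _)
  have k2 : IntegrableOn (fun h : E2 => Fb G x y e h + Fb G y x (-e) h) (far ρ) := f1.integrableOn.add f2.integrableOn
  have hmono : ∫ h in far ρ, (Jr ρ g G H x e h - Jr ρ g G H y e h) ≤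
      ∫ h in far ρ, ((2 * c * (√‖h‖ / ‖h‖ ^ 3) + 3 * (q δ b x y * ‖x - y‖) * (1 / ‖h‖ ^ 3)) +
        μ * (Fb G x y e h + Fb G y x (-e) h)) := by
    refine setIntegral_mono_on (i1.sub i2) (k1.add (k2.const_mul μ)) (far_meas ρ) ?_
    intro h hh
    have hh' : ‖x - y‖ / 4 ≤ ‖h‖ := hh
    have hr : 0 < ‖h‖ := by linarith
    have a1 := t.far_one_pt hh'
    have a2 := t.symm.far_one_pt (h := h) (by rw [norm_sub_rev]; exact hh')
    rw [inner_neg_right, norm_sub_rev y x] at a2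
    have hB : |⟪H x h, e⟫ * (KK (g (x + h) - g x) ‖h‖ - KK (g (y + h) - g y) ‖h‖)| ≤
        3 * (q δ b x y * ‖x - y‖) * (1 / ‖h‖ ^ 3) := by
      rw [abs_mul]
      calc _ ≤ (q δ b x y * ‖h‖) * (3 * ‖x - y‖ / ‖h‖ ^ 4) := by
            gcongr
            · exact t.P_abs h
            · refine (KK_diff _ _ _ hr).trans ?_
              gcongr
              exact t.ddl3 h
        _ = _ := by field_simp
    have hB' := (abs_le.1 hB).1
    simp only [Jr]
    rw [if_neg (by linarith), t.Py_eq, ← t.P_eq]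
    linarith
  rw [integral_add k1 (k2.const_mul μ), integral_add ((far52 hρ).1.const_mul _) ((far3 hρ).1.const_mul _),
    integral_const_mul, integral_const_mul, integral_const_mul, (far52 hρ).2, (far3 hρ).2,
    integral_add f1.integrableOn f2.integrableOn, v1, v2] at hmono
  refine hmono.trans ?_
  have em : y - (1/2 : ℝ) • (y - x) = x - (1/2 : ℝ) • (x - y) := by
    module
  have hball : (∫ k in near ρ, ⟪G (x - (1/2 : ℝ) • (x - y) + k) - G x, e⟫) +
      ∫ k in near ρ, ⟪G (y - (1/2 : ℝ) • (y - x) + k) - G y, -e⟫ = - (Real.pi * ρ ^ 2 * Wm δ b ‖x - y‖) := by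
    rw [em, ← integral_add (t.phi_int _ ρ x) (by
      have := t.symm.phi_int (x - (1/2 : ℝ) • (x - y)) ρ y
      exact this)]
    have : ∀ k, ⟪G (x - (1/2 : ℝ) • (x - y) + k) - G x, e⟫ + ⟪G (x - (1/2 : ℝ) • (x - y) + k) - G y, -e⟫ =
        - Wm δ b ‖x - y‖ := by
      intro k
      rw [← t.inn, inner_neg_right, inner_sub_left, inner_sub_left, inner_sub_left]; ring
    simp only [this]
    rw [setIntegral_const, vol_near hρ, smul_eq_mul]; ring
  rw [hball]
  have hsξ : 0 < √‖x - y‖ := Real.sqrt_pos.2 hξ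
  have hsξ2 : √‖x - y‖ ^ 2 = ‖x - y‖ := Real.sq_sqrt hξ.le
  have e0 : √ρ = √‖x - y‖ / 2 := by
    rw [hρd, Real.sqrt_div hξ.le, show (4:ℝ) = 2 ^ 2 by norm_num, Real.sqrt_sq (by norm_num)]
  have e1 : 2 * c * (4 * Real.pi / √ρ) = 48 * (Real.pi * (δ / ‖x - y‖)) := by
    rw [hc, e0]
    conv_rhs => rw [← hsξ2]
    field_simp
    ring
  have e2 : 3 * (q δ b x y * ‖x - y‖) * (2 * Real.pi / ρ) = 24 * (Real.pi * q δ b x y) := by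
    rw [hρd]; field_simp; ring
  have e3 : μ * -(Real.pi * ρ ^ 2 * Wm δ b ‖x - y‖) = - ((δ / ‖x - y‖) * (4 * Real.pi / 27 * lam * psi (b * ‖x - y‖))) := by
    rw [hμ, hρd]; unfold Wm; field_simp; ring
  have e4 : q δ b x y ≤ δ / ‖x - y‖ := by rw [le_div_iff₀ hξ]; exact t.qξ_le'
  have e5 := mul_le_mul_of_nonneg_left e4 Real.pi_pos.le
  rw [e1, e2, e3]
  linarith

/-- Region I -/
lemma region1 (t : Touch C M1 δ b g G H x y e) :
    (∫ h, Jr (‖x - y‖ / 4) g G H x e h) + ∫ h, Jr (‖x - y‖ / 4) g G H y (-e) h ≤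
    (δ / ‖x - y‖) * (2 * Real.pi * (55 + 3 / ((1 - 5 * M1 ^ 2) / 2)) -
      4 * Real.pi / 27 * ((1 - 5 * M1 ^ 2) / 2) * psi (b * ‖x - y‖)) := by
  have hξ := t.ξpos
  rw [t.S_split]
  have h1 := t.far_one
  have h2 := t.near_one
  have h3 := t.symm.near_one
  have hρ : 0 < ‖x - y‖ / 4 := by positivity
  rw [norm_sub_rev y x, q_symm] at h3
  have i1 := (t.n.Jr_int hρ x t.he.le).integrableOn (s := near (‖x - y‖ / 4))
  have i2 := (t.n.Jr_int hρ y t.he.le).integrableOn (s := near (‖x - y‖ / 4))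
  simp only [Jr_neg] at h3
  rw [integral_neg] at h3
  rw [integral_sub i1 i2]
  set lam := (1 - 5 * M1 ^ 2) / 2 with hlam
  have hl : 0 < lam := by have := t.h5; rw [hlam]; linarith
  have e4 : q δ b x y ≤ δ / ‖x - y‖ := by rw [le_div_iff₀ hξ]; exact t.qξ_le'
  have e5 : q δ b x y * (Real.pi * (19 + 3 / lam)) ≤ δ / ‖x - y‖ * (Real.pi * (19 + 3 / lam)) := by
    have := Real.pi_pos
    exact mul_le_mul_of_nonneg_right e4 (by positivity)
  linarith
end Touch
end Muskat
end Part12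

section Part13
namespace Muskat
section P13
variable {C : ℝ} {T : ℝ} {f : ℝ → E2 → ℝ} {G : ℝ → E2 → E2} {H : ℝ → E2 → E2 →L[ℝ] E2}

lemma psi_add_lin {u v : ℝ} (hu : 0 ≤ u) (hv : 0 ≤ v) : psi (u + v) - psi u ≤ v := by
  have := psi_cmp hu hv (fun w => w) (fun _ => 1) (by fun_prop)
    (fun w _ => hasDerivAt_id w) (fun w _ _ => dpsi_le_one _)
  simpa using this

lemma Wm_drop {δ b b' r : ℝ} (hδ : 0 < δ) (hb' : 0 < b') (h : b' ≤ b) (hr : 0 ≤ r) :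
    Wm δ b r ≤ Wm δ b' r + δ * (b - b') * r := by
  unfold Wm
  have h1 := psi_add_lin (u := b' * r) (v := (b - b') * r) (by positivity)
    (mul_nonneg (by linarith) hr)
  have h2 : b' * r + (b - b') * r = b * r := by ring
  rw [h2] at h1
  nlinarith

lemma psi_near_zero {ε : ℝ} (hε : 0 < ε) : ∃ u0 > 0, ∀ u, 0 < u → u ≤ u0 → (1 - ε) * u < psi u := by
  have hc : ContinuousAt dpsi 0 := by
    unfold dpsi
    refine ContinuousAt.div (by fun_prop) (by fun_prop) (by simp)
  have h0 : dpsi 0 = 1 := by simp [dpsi]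
  have h1 : ∀ᶠ u in 𝓝 (0:ℝ), 1 - ε < dpsi u := hc (Ioi_mem_nhds (by rw [h0]; linarith))
  obtain ⟨r, hr, hr2⟩ := Metric.eventually_nhds_iff.1 h1
  refine ⟨r / 2, by linarith, fun u hu hu2 => ?_⟩
  have h2 := hr2 (y := u) (by rw [Real.dist_eq, sub_zero, abs_of_pos hu]; linarith)
  have h3 := mul_dpsi_le_psi hu.le
  nlinarith

lemma hess_le {δ b : ℝ} {g : E2 → ℝ} {G : E2 → E2} {H : E2 → E2 →L[ℝ] E2} (n : Nice C g G H)
    (hδ : 0 < δ) (hb : 0 < b)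
    (hW : ∀ z w, ‖G z - G w‖ ≤ Wm δ b ‖z - w‖) (x : E2) : ‖H x‖ ≤ δ * b := by
  refine HasFDerivAt.le_of_lip' (n.hG x) (by positivity) (Eventually.of_forall fun y => ?_)
  exact (hW y x).trans (Wm_le hδ hb (norm_nonneg _))

lemma hess_lt {δ b : ℝ} {g : E2 → ℝ} {G : E2 → E2} {H : E2 → E2 →L[ℝ] E2} (n : Nice C g G H)
    (hδ : 0 < δ) (hb : 0 < b)
    (hW : ∀ z w, ‖G z - G w‖ ≤ Wm δ b ‖z - w‖) (x : E2) : ‖H x‖ < δ * b := by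
  have hC := n.hC
  -- choose the scale
  obtain ⟨q, hq, hq1, hq2⟩ : ∃ q > 0, b * q ^ 2 ≤ 1 ∧ C * q < δ * b * √b / 2 := by
    have hp : 0 < δ * b * √b / 2 := by positivity
    refine ⟨min (1 / (1 + b)) (δ * b * √b / 2 / (1 + C)), by positivity, ?_, ?_⟩
    · set q := min (1 / (1 + b)) (δ * b * √b / 2 / (1 + C))
      have h1 : q ≤ 1 / (1 + b) := min_le_left _ _
      have h0 : 0 ≤ q := by positivity
      have h2 : q * (1 + b) ≤ 1 := by rwa [le_div_iff₀ (by positivity)] at h1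
      nlinarith
    · set q := min (1 / (1 + b)) (δ * b * √b / 2 / (1 + C))
      have h1 : q ≤ δ * b * √b / 2 / (1 + C) := min_le_right _ _
      have h0 : 0 < q := by positivity
      have h2 : q * (1 + C) ≤ δ * b * √b / 2 := by rwa [le_div_iff₀ (by positivity)] at h1
      nlinarith
  set s := q ^ 2 with hs
  have hs0 : 0 < s := by positivity
  have hsq : √(b * s) = √b * q := by
    rw [Real.sqrt_mul hb.le, hs, Real.sqrt_sq hq.le]
  have key : ‖H x‖ ≤ δ * b - δ * b * (√b * q) / 2 + C * s := by
    have hnn : 0 ≤ δ * b - δ * b * (√b * q) / 2 + C * s := by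
      have : √b * q ≤ 1 := by rw [← hsq]; exact Real.sqrt_le_one.2 hq1
      have h2 : δ * b * (√b * q) ≤ δ * b * 1 := by gcongr
      have : 0 < δ * b := by positivity
      have : 0 ≤ C * s := by positivity
      linarith
    refine ContinuousLinearMap.opNorm_le_of_unit_norm hnn fun h hh => ?_
    have h1 := n.dGP_le x (s • h)
    have h2 := hW (x + s • h) x
    have h3 : ‖s • h‖ = s := by rw [norm_smul, hh, mul_one, Real.norm_of_nonneg hs0.le]
    rw [add_sub_cancel_left, h3] at h2
    rw [h3] at h1
    have h4 : ‖H x (s • h)‖ ≤ Wm δ b s + C * s ^ 2 := by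
      have := norm_sub_le (G (x + s • h) - G x) (G (x + s • h) - G x - H x (s • h))
      rw [sub_sub_cancel] at this
      linarith
    rw [map_smul, norm_smul, Real.norm_of_nonneg hs0.le] at h4
    have h5 : Wm δ b s ≤ δ * (b * s - b * s * (√b * q) / 2) := by
      unfold Wm
      rw [← hsq]
      exact mul_le_mul_of_nonneg_left (psi_le_sub (by positivity) hq1) hδ.le
    have h6 : s * ‖H x h‖ ≤ s * (δ * b - δ * b * (√b * q) / 2 + C * s) := by nlinarith
    exact le_of_mul_le_mul_left h6 hs0
  have : C * s < δ * b * (√b * q) / 2 := by rw [hs]; nlinarith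
  linarith

lemma far_gap {δ b r0 R0 M1 : ℝ} {G : E2 → E2} (hc : Continuous G)
    (hd : Tendsto (fun x => ‖G x‖) (cocompact E2) (𝓝 0))
    (hδ : 0 < δ) (hb : 0 < b) (hr0 : 0 < r0)
    (hs : ∀ x y, x ≠ y → ‖G x - G y‖ < Wm δ b ‖x - y‖) :
    ∃ γ > 0, ∀ x y, r0 ≤ ‖x - y‖ → ‖x - y‖ ≤ R0 → ‖G x - G y‖ ≤ Wm δ b ‖x - y‖ - γ := by
  have hw0 : 0 < Wm δ b r0 := by
    unfold Wm; exact mul_pos hδ (psi_pos (by positivity))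
  have h1 : ∀ᶠ x in cocompact E2, ‖G x‖ < Wm δ b r0 / 4 := hd (Iio_mem_nhds (by linarith))
  obtain ⟨K, hK, hK2⟩ := mem_cocompact.1 h1
  obtain ⟨R, hR⟩ := hK.isBounded.subset_closedBall 0
  have hout : ∀ x, R < ‖x‖ → ‖G x‖ < Wm δ b r0 / 4 := by
    intro x hx
    refine hK2 fun hxK => ?_
    have := hR hxK
    rw [mem_closedBall_zero_iff] at this
    linarith
  set S : Set (E2 × E2) := (Metric.closedBall 0 (R + R0) ×ˢ Metric.closedBall 0 (R + R0)) ∩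
    {p | r0 ≤ ‖p.1 - p.2‖} with hS
  have hSc : IsCompact S := ((isCompact_closedBall _ _).prod (isCompact_closedBall _ _)).inter_right
    (isClosed_le continuous_const (by fun_prop))
  set F : E2 × E2 → ℝ := fun p => Wm δ b ‖p.1 - p.2‖ - ‖G p.1 - G p.2‖ with hF
  have hFc : Continuous F := by
    have := psi_cont
    simp only [hF, Wm]
    fun_prop
  obtain ⟨γ, hγ, hg⟩ : ∃ γ > 0, ∀ p ∈ S, γ ≤ F p := by
    rcases S.eq_empty_or_nonempty with he | hne
    · exact ⟨1, one_pos, fun p hp => by rw [he] at hp; exact hp.elim⟩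
    · obtain ⟨p, hp, hmin⟩ := hSc.exists_isMinOn hne hFc.continuousOn
      refine ⟨F p, ?_, fun q hq => hmin hq⟩
      have hne : p.1 ≠ p.2 := by
        intro h
        have : r0 ≤ ‖p.1 - p.2‖ := hp.2
        rw [h, sub_self, norm_zero] at this; linarith
      have := hs _ _ hne
      simp only [hF]; linarith
  refine ⟨min γ (Wm δ b r0 / 2), by positivity, fun x y h1 h2 => ?_⟩
  have hm1 := min_le_left γ (Wm δ b r0 / 2)
  have hm2 := min_le_right γ (Wm δ b r0 / 2)
  have hmono := Wm_mono hδ hb hr0.le h1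
  have both : R < ‖x‖ → R < ‖y‖ → ‖G x - G y‖ ≤ Wm δ b ‖x - y‖ - min γ (Wm δ b r0 / 2) := by
    intro hx hy
    have := norm_sub_le (G x) (G y)
    linarith [hout x hx, hout y hy]
  have hxy : ‖x‖ ≤ ‖x - y‖ + ‖y‖ := by
    have := norm_add_le (x - y) y; rwa [sub_add_cancel] at this
  have hyx : ‖y‖ ≤ ‖x - y‖ + ‖x‖ := by
    have := norm_sub_le x (x - y); rw [sub_sub_cancel] at this; linarith
  by_cases hx : ‖x‖ ≤ R + R0
  · by_cases hy : ‖y‖ ≤ R + R0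
    · have := hg (x, y) ⟨⟨by simpa using hx, by simpa using hy⟩, h1⟩
      simp only [hF] at this
      linarith
    · push Not at hy
      exact both (by linarith) (by linarith)
  · push Not at hx
    exact both (by linarith) (by linarith)

lemma open_step (D : Data T C f G H) {δ M1 R0 : ℝ} (hδ : 0 < δ) (hR0 : 0 < R0)
    (hM : ∀ t ∈ Icc 0 T, ∀ x, ‖G t x‖ ≤ M1) (hRM : 2 * M1 < δ * psi R0)
    {b : ℝ → ℝ} (hbc : ∀ t ∈ Icc 0 T, ContinuousAt b t) (hbp : ∀ t ∈ Icc 0 T, 0 < b t)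
    (hba : ∀ s ∈ Icc 0 T, ∀ t ∈ Icc 0 T, s ≤ t → b t ≤ b s)
    {t₀ : ℝ} (ht₀ : t₀ ∈ Icc 0 T)
    (hs : ∀ x y, x ≠ y → ‖G t₀ x - G t₀ y‖ < Wm δ (b t₀) ‖x - y‖) :
    ∃ η > 0, ∀ t ∈ Icc 0 T, t₀ ≤ t → t < t₀ + η →
      ∀ x y, x ≠ y → ‖G t x - G t y‖ < Wm δ (b t) ‖x - y‖ := by
  have n := D.nice t₀ ht₀
  have hb := hbp t₀ ht₀
  have hweak : ∀ z w, ‖G t₀ z - G t₀ w‖ ≤ Wm δ (b t₀) ‖z - w‖ := by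
    intro z w
    by_cases h : z = w
    · rw [h]; simp [Wm, psi_zero]
    · exact (hs z w h).le
  obtain ⟨γ, hγ, hg⟩ := gap n.contH (D.decH t₀ ht₀) (hess_lt n hδ hb hweak)
  obtain ⟨u0, hu0, hu⟩ := psi_near_zero (ε := γ / (4 * δ * b t₀)) (by positivity)
  set r0 := u0 / b t₀ with hr0
  have hr0p : 0 < r0 := by positivity
  obtain ⟨γ', hγ', hg'⟩ := far_gap (R0 := 2 * R0 / b t₀) (M1 := M1) n.contG (D.decG t₀ ht₀) hδ hb hr0p hs
  set ε := min (γ / 4) (γ' / 5) with hε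
  have hεp : 0 < ε := by positivity
  obtain ⟨η1, hη1, hd⟩ := D.cont t₀ ht₀ ε hεp
  set ε2 := min (b t₀ / 2) (min (γ / (4 * δ)) (γ' * b t₀ / (5 * (δ * (2 * R0))))) with hε2
  have hε2p : 0 < ε2 := by positivity
  obtain ⟨η2, hη2, hd2⟩ := Metric.continuousAt_iff.1 (hbc t₀ ht₀) ε2 hε2p
  refine ⟨min η1 η2, by positivity, fun t ht h1 h2 x y hxy => ?_⟩
  have hm1 := min_le_left η1 η2
  have hm2 := min_le_right η1 η2
  have hbt := hbp t ht
  have hbl := hba t₀ ht₀ t ht h1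
  have hdb : b t₀ - b t < ε2 := by
    have := hd2 (x := t) (by rw [Real.dist_eq, abs_of_nonneg (by linarith)]; linarith)
    rw [Real.dist_eq, abs_sub_comm] at this
    exact (le_abs_self _).trans_lt this
  have hdd := fun x => hd t ht (by rw [abs_of_nonneg (by linarith)]; linarith) x
  have hr : 0 < ‖x - y‖ := norm_pos_iff.2 (sub_ne_zero.2 hxy)
  have e1 : ε2 ≤ b t₀ / 2 := min_le_left _ _
  have e2 : ε2 ≤ γ / (4 * δ) := (min_le_right _ _).trans (min_le_left _ _)
  have e3 : ε2 ≤ γ' * b t₀ / (5 * (δ * (2 * R0))) := (min_le_right _ _).trans (min_le_right _ _)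
  have hdrop := Wm_drop hδ hbt hbl hr.le
  by_cases hbig : R0 ≤ b t * ‖x - y‖
  · have h3 : δ * psi R0 ≤ Wm δ (b t) ‖x - y‖ := by
      unfold Wm
      exact mul_le_mul_of_nonneg_left (psi_mono hR0.le hbig) hδ.le
    have := norm_sub_le (G t x) (G t y)
    linarith [hM t ht x, hM t ht y]
  push Not at hbig
  by_cases hsm : ‖x - y‖ ≤ r0
  · have hH : ∀ z, ‖H t z‖ ≤ δ * b t₀ - γ * 3 / 4 := by
      intro z
      have k1 := (hdd z).2.2
      have k2 := hg z
      have k3 := norm_add_le (H t₀ z) (H t z - H t₀ z)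
      rw [add_sub_cancel] at k3
      linarith [min_le_left (γ / 4) (γ' / 5)]
    have k1 := (D.nice t ht).dG_le' y (x - y) hH
    rw [add_sub_cancel] at k1
    have k2 := hu (b t₀ * ‖x - y‖) (by positivity) (by
      rw [hr0, le_div_iff₀ hb] at hsm; linarith)
    have k3 : δ * ((1 - γ / (4 * δ * b t₀)) * (b t₀ * ‖x - y‖)) = (δ * b t₀ - γ / 4) * ‖x - y‖ := by
      field_simp
    have k4 : (δ * b t₀ - γ / 4) * ‖x - y‖ < Wm δ (b t₀) ‖x - y‖ := by
      rw [← k3]; unfold Wm; exact mul_lt_mul_of_pos_left k2 hδ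
    have k5 : δ * (b t₀ - b t) ≤ γ / 4 := by
      have : b t₀ - b t ≤ γ / (4 * δ) := by linarith
      rw [le_div_iff₀ (by positivity)] at this; linarith
    have k6 : δ * (b t₀ - b t) * ‖x - y‖ ≤ γ / 4 * ‖x - y‖ := by gcongr
    have : 0 < γ * ‖x - y‖ := by positivity
    linarith
  · push Not at hsm
    have hup : ‖x - y‖ ≤ 2 * R0 / b t₀ := by
      rw [le_div_iff₀ hb]
      nlinarith
    have k1 := hg' x y hsm.le hup
    have k2 := (hdd x).2.1
    have k3 := (hdd y).2.1
    have k4 : ‖G t x - G t y‖ ≤ ‖G t₀ x - G t₀ y‖ + 2 * ε := by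
      have : G t x - G t y = (G t₀ x - G t₀ y) + ((G t x - G t₀ x) - (G t y - G t₀ y)) := by abel
      rw [this]
      have a1 := norm_add_le (G t₀ x - G t₀ y) ((G t x - G t₀ x) - (G t y - G t₀ y))
      have a2 := norm_sub_le (G t x - G t₀ x) (G t y - G t₀ y)
      linarith
    have k5 : δ * (b t₀ - b t) * ‖x - y‖ ≤ γ' / 5 := by
      have a1 : b t₀ - b t ≤ γ' * b t₀ / (5 * (δ * (2 * R0))) := by linarith
      have a2 : δ * (b t₀ - b t) * ‖x - y‖ ≤
          δ * (γ' * b t₀ / (5 * (δ * (2 * R0)))) * (2 * R0 / b t₀) := by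
        have : 0 ≤ b t₀ - b t := by linarith
        gcongr
      refine a2.trans_eq ?_
      field_simp
    linarith [min_le_right (γ / 4) (γ' / 5)]

end P13
end Muskat
end Part13

section Part14
namespace Muskat
section P14
variable {C : ℝ} {T : ℝ} {f : ℝ → E2 → ℝ} {G : ℝ → E2 → E2} {H : ℝ → E2 → E2 →L[ℝ] E2}

lemma touch_neg {M1 δ b κ N R0 : ℝ} {g : E2 → ℝ} {G : E2 → E2} {H : E2 → E2 →L[ℝ] E2} {x y e : E2}
    (t : Touch C M1 δ b g G H x y e) (hκ0 : 0 < κ) (hN0 : 0 < N)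
    (hN : 2 * Real.pi * (55 + 3 / ((1 - 5 * M1 ^ 2) / 2)) + 1 ≤
      4 * Real.pi / 27 * ((1 - 5 * M1 ^ 2) / 2) * psi N)
    (hκ : κ * √N + δ * (46 * √N + 604) < (1 - 5 * M1 ^ 2) / 2 / (1 + √(2 * N)) ^ 3)
    (hκR : κ * R0 < 1) (hR0 : 0 < R0) (hRM : 2 * M1 < δ * psi R0) :
    (∫ h, Jr (‖x - y‖ / 4) g G H x e h) + ∫ h, Jr (‖x - y‖ / 4) g G H y (-e) h <
      δ * (dpsi (b * ‖x - y‖) * (-κ * b ^ 2 * ‖x - y‖)) := by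
  have hξ := t.ξpos
  have hδ := t.hδ
  have hb := t.hb
  have hu : 0 < b * ‖x - y‖ := by positivity
  have huR : b * ‖x - y‖ < R0 := by
    by_contra hcon
    push Not at hcon
    have h1 : δ * psi R0 ≤ Wm δ b ‖x - y‖ := by
      unfold Wm
      exact mul_le_mul_of_nonneg_left (psi_mono hR0.le hcon) hδ.le
    have h2 := t.inn
    have h3 := (le_abs_self _).trans (abs_inner_le_unit (G x - G y) t.he.le)
    have h4 := norm_sub_le (G x) (G y)
    linarith [t.hM x, t.hM y]
  have hrw : δ * (dpsi (b * ‖x - y‖) * (-κ * b ^ 2 * ‖x - y‖)) =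
      -(κ * δ * b * (b * ‖x - y‖ * dpsi (b * ‖x - y‖))) := by ring
  rw [hrw]
  have hl : 0 < (1 - 5 * M1 ^ 2) / 2 := by linarith [t.h5]
  by_cases hc : b * ‖x - y‖ ≤ N
  · have h1 := t.region2 hc
    have hq : 0 < √(b * ‖x - y‖) := Real.sqrt_pos.2 hu
    have hqN : √(b * ‖x - y‖) ≤ √N := Real.sqrt_le_sqrt hc
    have h2 : δ * b * √(b * ‖x - y‖) * (δ * (46 * √N + 604) - (1 - 5 * M1 ^ 2) / 2 / (1 + √(2 * N)) ^ 3)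
        < δ * b * √(b * ‖x - y‖) * (-(κ * √N)) := by
      refine mul_lt_mul_of_pos_left (by linarith) (by positivity)
    have h3 : b * ‖x - y‖ * dpsi (b * ‖x - y‖) ≤ √(b * ‖x - y‖) * √N := by
      calc b * ‖x - y‖ * dpsi (b * ‖x - y‖) ≤ b * ‖x - y‖ * 1 :=
            mul_le_mul_of_nonneg_left (dpsi_le_one _) hu.le
        _ = √(b * ‖x - y‖) * √(b * ‖x - y‖) := by rw [Real.mul_self_sqrt hu.le, mul_one]
        _ ≤ _ := mul_le_mul_of_nonneg_left hqN hq.le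
    have h4 : κ * δ * b * (b * ‖x - y‖ * dpsi (b * ‖x - y‖)) ≤ κ * δ * b * (√(b * ‖x - y‖) * √N) :=
      mul_le_mul_of_nonneg_left h3 (by positivity)
    have h5 : δ * b * √(b * ‖x - y‖) * (-(κ * √N)) = -(κ * δ * b * (√(b * ‖x - y‖) * √N)) := by ring
    linarith
  · push Not at hc
    have h1 := t.region1
    have h2 : 4 * Real.pi / 27 * ((1 - 5 * M1 ^ 2) / 2) * psi N ≤
        4 * Real.pi / 27 * ((1 - 5 * M1 ^ 2) / 2) * psi (b * ‖x - y‖) :=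
      mul_le_mul_of_nonneg_left (psi_mono hN0.le hc.le) (by have := Real.pi_pos; positivity)
    have h3 : (δ / ‖x - y‖) * (2 * Real.pi * (55 + 3 / ((1 - 5 * M1 ^ 2) / 2)) -
      4 * Real.pi / 27 * ((1 - 5 * M1 ^ 2) / 2) * psi (b * ‖x - y‖)) ≤ (δ / ‖x - y‖) * (-1) :=
      mul_le_mul_of_nonneg_left (by linarith) (by positivity)
    have h4 : κ * δ * b * (b * ‖x - y‖ * dpsi (b * ‖x - y‖)) ≤ κ * δ * b * 1 :=
      mul_le_mul_of_nonneg_left (mul_dpsi_le hu.le) (by positivity)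
    have h5 : κ * δ * b * 1 < δ / ‖x - y‖ := by
      rw [lt_div_iff₀ hξ]
      have : κ * (b * ‖x - y‖) < 1 := (mul_lt_mul_of_pos_left huR hκ0).trans hκR
      nlinarith
    linarith

lemma breakthrough (D : Data T C f G H) {M1 δ κ N R0 : ℝ} (hM10 : 0 ≤ M1) (h5 : 5 * M1 ^ 2 < 1)
    (hM : ∀ t ∈ Icc 0 T, ∀ x, ‖G t x‖ ≤ M1) (hδ : 0 < δ)
    (hκ0 : 0 < κ) (hN0 : 0 < N)
    (hN : 2 * Real.pi * (55 + 3 / ((1 - 5 * M1 ^ 2) / 2)) + 1 ≤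
      4 * Real.pi / 27 * ((1 - 5 * M1 ^ 2) / 2) * psi N)
    (hκ : κ * √N + δ * (46 * √N + 604) < (1 - 5 * M1 ^ 2) / 2 / (1 + √(2 * N)) ^ 3)
    (hκR : κ * R0 < 1) (hR0 : 0 < R0) (hRM : 2 * M1 < δ * psi R0)
    {b : ℝ → ℝ} (hbd : ∀ t ∈ Icc 0 T, HasDerivAt b (-κ * b t ^ 2) t) (hbp : ∀ t ∈ Icc 0 T, 0 < b t)
    (hba : ∀ s ∈ Icc 0 T, ∀ t ∈ Icc 0 T, s ≤ t → b t ≤ b s)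
    (h0 : ∀ x y, x ≠ y → ‖G 0 x - G 0 y‖ < Wm δ (b 0) ‖x - y‖) :
    ∀ t ∈ Icc 0 T, ∀ x y, x ≠ y → ‖G t x - G t y‖ < Wm δ (b t) ‖x - y‖ := by
  by_contra hcon
  push Not at hcon
  obtain ⟨t, ht, hbt⟩ := hcon
  obtain ⟨t₀, ht₀, ⟨x, y, hne, hge⟩, hlt⟩ := first_time (T := T)
    (fun t => ∃ x y, x ≠ y ∧ Wm δ (b t) ‖x - y‖ ≤ ‖G t x - G t y‖)
    (by push Not; exact h0)
    (by
      intro t₀ ht₀ hn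
      push Not at hn
      obtain ⟨η, hη, hd⟩ := open_step D hδ hR0 hM hRM (fun t ht => (hbd t ht).continuousAt) hbp hba ht₀ hn
      refine ⟨η, hη, fun t ht h1 h2 => ?_⟩
      push Not
      exact hd t ht h1 h2) ht hbt
  push Not at hlt
  have ht₀I : t₀ ∈ Icc 0 T := ⟨ht₀.1.le, ht₀.2⟩
  have n := D.nice t₀ ht₀I
  have hb := hbp t₀ ht₀I
  have lG : ∀ z, Tendsto (fun s => G s z) (𝓝[<] t₀) (𝓝 (G t₀ z)) := by
    intro z
    have h : Tendsto (fun s : ℝ => (s, z)) (𝓝[Icc 0 T] t₀) (𝓝[Icc 0 T] t₀ ×ˢ 𝓝 z) :=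
      tendsto_id.prodMk tendsto_const_nhds
    have h2 := (D.jG ht₀I z).comp h
    refine h2.mono_left ?_
    rw [← nhdsWithin_Ico_eq_nhdsLT ht₀.1]
    exact nhdsWithin_mono _ (Ico_subset_Icc_self.trans (Icc_subset_Icc_right ht₀.2))
  have hweak : ∀ z w, ‖G t₀ z - G t₀ w‖ ≤ Wm δ (b t₀) ‖z - w‖ := by
    intro z w
    by_cases hzw : z = w
    · rw [hzw]; simp [Wm, psi_zero]
    have l1 := ((lG z).sub (lG w)).norm
    have l2 : Tendsto (fun s => Wm δ (b s) ‖z - w‖) (𝓝[<] t₀) (𝓝 (Wm δ (b t₀) ‖z - w‖)) := by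
      unfold Wm
      have lb : Tendsto b (𝓝[<] t₀) (𝓝 (b t₀)) := (hbd t₀ ht₀I).continuousAt.tendsto.mono_left nhdsWithin_le_nhds
      exact ((psi_cont.tendsto _).comp (lb.mul_const _)).const_mul δ
    refine le_of_tendsto_of_tendsto l1 l2 ?_
    filter_upwards [Ico_mem_nhdsLT ht₀.1] with s hs
    exact (hlt s hs z w hzw).le
  have hξ : 0 < ‖x - y‖ := norm_pos_iff.2 (sub_ne_zero.2 hne)
  set ξ := ‖x - y‖ with hξd
  set w0 := Wm δ (b t₀) ξ with hw0
  have heq : ‖G t₀ x - G t₀ y‖ = w0 := le_antisymm (hweak x y) hge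
  have hwp : 0 < w0 := by
    rw [hw0]; unfold Wm; exact mul_pos hδ (psi_pos (by positivity))
  set e : E2 := w0⁻¹ • (G t₀ x - G t₀ y) with he
  have hen : ‖e‖ = 1 := by
    rw [he, norm_smul, heq, norm_inv, Real.norm_of_nonneg hwp.le, inv_mul_cancel₀ hwp.ne']
  have tt : Touch C M1 δ (b t₀) (f t₀) (G t₀) (H t₀) x y e :=
    { n := n, hM0 := hM10, h5 := h5, hM := hM t₀ ht₀I, hδ := hδ, hb := hb, hW := hweak, hne := hne,
      he := hen, heq := by
        rw [he, ← hξd, ← hw0, smul_smul, mul_inv_cancel₀ hwp.ne', one_smul] }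
  have hinn := tt.inn
  have hS := touch_neg tt hκ0 hN0 hN hκ hκR hR0 hRM
  rw [← hξd] at hS hinn
  set S1 := ∫ h, Jr (ξ / 4) (f t₀) (G t₀) (H t₀) x e h with hS1
  set S2 := ∫ h, Jr (ξ / 4) (f t₀) (G t₀) (H t₀) y (-e) h with hS2
  set w' := δ * (dpsi (b t₀ * ξ) * (-κ * b t₀ ^ 2 * ξ)) with hw'
  have hwd : HasDerivAt (fun s => Wm δ (b s) ξ) w' t₀ := by
    unfold Wm
    have h1 : HasDerivAt (fun s => b s * ξ) (-κ * b t₀ ^ 2 * ξ) t₀ := (hbd t₀ ht₀I).mul_const ξ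
    have h2 := (psi_deriv (u := b t₀ * ξ) (by positivity))
    exact (HasDerivAt.comp t₀ h2 h1).const_mul δ
  set η := (w' - (S1 + S2)) / 4 with hη
  have hηp : 0 < η := by rw [hη]; linarith
  have E1 := D.left_deriv ht₀ (ρ := ξ / 4) (by positivity) x (e := e) hen.le hηp
  have E2' := D.left_deriv ht₀ (ρ := ξ / 4) (by positivity) y (e := -e) (by rw [norm_neg, hen]) hηp
  have E3 := (hwd.isLittleO.def hηp).filter_mono (nhdsWithin_le_nhds (s := Iio t₀))
  obtain ⟨s, ⟨⟨⟨k1, k2⟩, k3⟩, hs⟩⟩ := (((E1.and E2').and E3).and (Ico_mem_nhdsLT ht₀.1)).exists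
  rw [← hS1] at k1
  rw [← hS2] at k2
  have hst : 0 < t₀ - s := by linarith [hs.2]
  have k4 := hlt s hs x y hne
  have k5 := (le_abs_self _).trans (abs_inner_le_unit (G s x - G s y) hen.le)
  rw [← hξd] at k4
  rw [Real.norm_eq_abs, Real.norm_eq_abs, abs_sub_comm s t₀, abs_of_pos hst, smul_eq_mul] at k3
  have k1' := (abs_le.1 k1).2
  have k2' := (abs_le.1 k2).2
  have k3' := (abs_le.1 k3).2
  simp only [inner_neg_right] at k2'
  rw [inner_sub_left] at k5 hinn
  have fin : (t₀ - s) * (w' - (S1 + S2)) ≤ (t₀ - s) * (3 * η) := by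
    nlinarith
  have : w' - (S1 + S2) = 4 * η := by rw [hη]; ring
  rw [this] at fin
  have := le_of_mul_le_mul_left fin hst
  linarith

/-- The constants, depending only on `M`. -/
lemma constants {M : ℝ} (hM0 : 0 ≤ M) (hM : M < 1 / Real.sqrt 5) :
    ∃ M1 δ κ N R0 : ℝ, M < M1 ∧ 5 * M1 ^ 2 < 1 ∧ 0 < δ ∧ 0 < κ ∧ 0 < N ∧
    (2 * Real.pi * (55 + 3 / ((1 - 5 * M1 ^ 2) / 2)) + 1 ≤
      4 * Real.pi / 27 * ((1 - 5 * M1 ^ 2) / 2) * psi N) ∧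
    (κ * √N + δ * (46 * √N + 604) < (1 - 5 * M1 ^ 2) / 2 / (1 + √(2 * N)) ^ 3) ∧
    κ * R0 < 1 ∧ 0 < R0 ∧ 2 * M1 < δ * psi R0 := by
  obtain ⟨M1, hM1, hM2⟩ := exists_between hM
  have h5 : 5 * M1 ^ 2 < 1 := by
    have hs : 0 < √(5:ℝ) := by positivity
    have h1 : M1 * √5 < 1 := by rwa [lt_div_iff₀ hs] at hM2
    have h2 : √(5:ℝ) ^ 2 = 5 := Real.sq_sqrt (by norm_num)
    have h3 : 0 ≤ M1 * √5 := mul_nonneg (by linarith) hs.le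
    have h4 : (M1 * √5) ^ 2 < 1 := by nlinarith
    rw [mul_pow, h2] at h4; linarith
  have hl : 0 < (1 - 5 * M1 ^ 2) / 2 := by linarith
  set l := (1 - 5 * M1 ^ 2) / 2 with hld
  have hpi := Real.pi_pos
  obtain ⟨N, hN⟩ := ((psi_tendsto.eventually_ge_atTop
    ((2 * Real.pi * (55 + 3 / l) + 1) / (4 * Real.pi / 27 * l))).and (eventually_gt_atTop 0)).exists
  have hN0 : 0 < N := hN.2
  have hN1 := hN.1
  rw [div_le_iff₀ (by positivity)] at hN1
  have hN2 : 0 ≤ √N := Real.sqrt_nonneg _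
  have hQ : 0 < l / (1 + √(2 * N)) ^ 3 := by positivity
  set Q := l / (1 + √(2 * N)) ^ 3 with hQd
  set δ := Q / 3 / (46 * √N + 604) with hδ
  have hδp : 0 < δ := by positivity
  obtain ⟨R0, hR⟩ := ((psi_tendsto.eventually_gt_atTop (2 * M1 / δ)).and (eventually_gt_atTop 0)).exists
  have hR0 : 0 < R0 := hR.2
  have hR1 := hR.1
  rw [div_lt_iff₀ hδp] at hR1
  set κ := min (1 / (2 * R0)) (Q / 3 / (√N + 1)) with hκ
  have hκp : 0 < κ := by positivity
  refine ⟨M1, δ, κ, N, R0, hM1, h5, hδp, hκp, hN0, by rw [← hld]; linarith, ?_, ?_, hR0, by linarith⟩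
  · have h1 : κ ≤ Q / 3 / (√N + 1) := min_le_right _ _
    rw [le_div_iff₀ (by positivity)] at h1
    have h2 : δ * (46 * √N + 604) = Q / 3 := by rw [hδ]; field_simp
    nlinarith
  · have h1 : κ ≤ 1 / (2 * R0) := min_le_left _ _
    rw [le_div_iff₀ (by positivity)] at h1
    linarith

lemma init_ok {δ R0 M1 K b : ℝ} {g : E2 → ℝ} {G : E2 → E2} {H : E2 → E2 →L[ℝ] E2} (n : Nice C g G H)
    (hδ : 0 < δ) (hb : 0 < b) (hR0 : 0 < R0) (hM : ∀ x, ‖G x‖ ≤ M1) (hRM : 2 * M1 < δ * psi R0)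
    (hH : ∀ x, ‖H x‖ ≤ K) (hK : K < δ * b * dpsi R0) :
    ∀ x y, x ≠ y → ‖G x - G y‖ < Wm δ b ‖x - y‖ := by
  intro x y hxy
  have hr : 0 < ‖x - y‖ := norm_pos_iff.2 (sub_ne_zero.2 hxy)
  by_cases hbig : R0 ≤ b * ‖x - y‖
  · have h3 : δ * psi R0 ≤ Wm δ b ‖x - y‖ := by
      unfold Wm
      exact mul_le_mul_of_nonneg_left (psi_mono hR0.le hbig) hδ.le
    have := norm_sub_le (G x) (G y)
    linarith [hM x, hM y]
  · push Not at hbig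
    have k1 := n.dG_le' y (x - y) hH
    rw [add_sub_cancel] at k1
    have k2 := mul_dpsi_le_psi (u := b * ‖x - y‖) (by positivity)
    have k3 := dpsi_anti hbig.le
    have k4 : b * ‖x - y‖ * dpsi R0 ≤ psi (b * ‖x - y‖) :=
      (mul_le_mul_of_nonneg_left k3 (by positivity)).trans k2
    unfold Wm
    have k5 := mul_le_mul_of_nonneg_left k4 hδ.le
    have k6 := mul_lt_mul_of_pos_right hK hr
    linarith

end P14
end Muskat
end Part14

theorem muskat_C11_estimate (M : ℝ) (hM0 : 0 ≤ M) (hM : M < 1 / Real.sqrt 5) :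
    ∃ C > (0 : ℝ), ∀ (T : ℝ) (f : ℝ → E2 → ℝ), 0 < T → SmoothDecaySol T f →
      (∀ x, ‖gradient (f 0) x‖ ≤ M) →
      ∀ K₀ : ℝ, (∀ x, ‖iteratedFDeriv ℝ 2 (f 0) x‖ ≤ K₀) →
      ∀ t ∈ Ioc 0 T, ∀ x : E2, ‖iteratedFDeriv ℝ 2 (f t) x‖ ≤ C * min K₀ (1 / t) := by
  obtain ⟨M1, δ, κ, N, R0, hM1, h5, hδ, hκ0, hN0, hN, hκ, hκR, hR0, hRM⟩ :=
    Muskat.constants hM0 hM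
  have hdp := Muskat.dpsi_pos R0
  have hc1 : 0 < 1 / Muskat.dpsi R0 := by positivity
  have hc2 : 0 < δ / κ := by positivity
  refine ⟨1 / Muskat.dpsi R0 + δ / κ, by positivity, ?_⟩
  intro T f hT S hgrad K₀ hK₀ t ht x
  obtain ⟨C, D⟩ := Muskat.data_of S
  have ht0 : 0 < t := ht.1
  have htI : t ∈ Icc 0 T := ⟨ht.1.le, ht.2⟩
  have h0I : (0:ℝ) ∈ Icc 0 T := ⟨le_rfl, hT.le⟩
  have hK0 : 0 ≤ K₀ := (norm_nonneg _).trans (hK₀ 0)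
  have hslope := Muskat.slope_bound D hT hM0 hM1 h5 hgrad
  have main : ∀ b0 : ℝ, K₀ < δ * b0 * Muskat.dpsi R0 →
      ‖iteratedFDeriv ℝ 2 (f t) x‖ ≤ δ * (1 / (1 / b0 + κ * t)) := by
    intro b0 hb0
    have hb0p : 0 < b0 := by
      by_contra hcon
      push Not at hcon
      have : δ * b0 * Muskat.dpsi R0 ≤ 0 :=
        mul_nonpos_of_nonpos_of_nonneg (mul_nonpos_of_nonneg_of_nonpos hδ.le hcon) hdp.le
      linarith
    set b : ℝ → ℝ := fun s => 1 / (1 / b0 + κ * s) with hb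
    have hden : ∀ s ∈ Icc 0 T, 0 < 1 / b0 + κ * s := fun s hs => by
      have h1 : 0 < 1 / b0 := by positivity
      have h2 : 0 ≤ κ * s := mul_nonneg hκ0.le hs.1
      linarith
    have hbp : ∀ s ∈ Icc 0 T, 0 < b s := fun s hs => one_div_pos.2 (hden s hs)
    have hbd : ∀ s ∈ Icc 0 T, HasDerivAt b (-κ * b s ^ 2) s := by
      intro s hs
      have h1 : HasDerivAt (fun s => 1 / b0 + κ * s) κ s := by
        have := ((hasDerivAt_id s).const_mul κ).const_add (1 / b0)
        exact this.congr_deriv (by simp)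
      have h2 := h1.inv (hden s hs).ne'
      have h3 : b = (fun s => 1 / b0 + κ * s)⁻¹ := by
        funext s; simp [hb]
      rw [h3]
      refine h2.congr_deriv ?_
      simp only [Pi.inv_apply]
      have := (hden s hs).ne'
      field_simp
    have hba : ∀ s ∈ Icc 0 T, ∀ t ∈ Icc 0 T, s ≤ t → b t ≤ b s := by
      intro s hs t _ hst
      refine one_div_le_one_div_of_le (hden s hs) ?_
      have := mul_le_mul_of_nonneg_left hst hκ0.le
      linarith
    have hb00 : b 0 = b0 := by simp [hb]
    have hini : ∀ x y, x ≠ y → ‖Muskat.gr (f 0) x - Muskat.gr (f 0) y‖ < Muskat.Wm δ (b 0) ‖x - y‖ := by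
      rw [hb00]
      exact Muskat.init_ok (D.nice 0 h0I) hδ hb0p hR0 (hslope 0 h0I) hRM
        (fun x => by rw [Muskat.hs_norm]; exact hK₀ x) hb0
    have hB := Muskat.breakthrough D (by linarith) h5 hslope hδ hκ0 hN0 hN hκ hκR hR0 hRM hbd hbp hba
      hini t htI
    have := Muskat.hess_le (D.nice t htI) hδ (hbp t htI) (fun z w => by
      by_cases hzw : z = w
      · rw [hzw]; simp [Muskat.Wm, Muskat.psi_zero]
      · exact (hB z w hzw).le) x
    rwa [Muskat.hs_norm] at this
  have A1 : ‖iteratedFDeriv ℝ 2 (f t) x‖ ≤ 1 / Muskat.dpsi R0 * K₀ := by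
    refine le_of_forall_pos_le_add fun ε hε => ?_
    have hb0p : 0 < (1 / Muskat.dpsi R0 * K₀ + ε) / δ := by positivity
    have h1 := main ((1 / Muskat.dpsi R0 * K₀ + ε) / δ) (by
      have : δ * ((1 / Muskat.dpsi R0 * K₀ + ε) / δ) * Muskat.dpsi R0 = K₀ + ε * Muskat.dpsi R0 := by
        field_simp
      rw [this]
      have : 0 < ε * Muskat.dpsi R0 := by positivity
      linarith)
    refine h1.trans ?_
    have h2 : 1 / (1 / ((1 / Muskat.dpsi R0 * K₀ + ε) / δ) + κ * t) ≤
        1 / (1 / ((1 / Muskat.dpsi R0 * K₀ + ε) / δ)) := by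
      refine one_div_le_one_div_of_le (by positivity) ?_
      have : 0 < κ * t := by positivity
      linarith
    rw [one_div_one_div] at h2
    calc _ ≤ δ * ((1 / Muskat.dpsi R0 * K₀ + ε) / δ) := mul_le_mul_of_nonneg_left h2 hδ.le
      _ = _ := by field_simp
  have A2 : ‖iteratedFDeriv ℝ 2 (f t) x‖ ≤ δ / κ * (1 / t) := by
    have hb0p : 0 < (1 / Muskat.dpsi R0 * K₀ + 1) / δ := by positivity
    have h1 := main ((1 / Muskat.dpsi R0 * K₀ + 1) / δ) (by
      have : δ * ((1 / Muskat.dpsi R0 * K₀ + 1) / δ) * Muskat.dpsi R0 = K₀ + Muskat.dpsi R0 := by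
        field_simp
      rw [this]
      linarith)
    refine h1.trans ?_
    have h2 : 1 / (1 / ((1 / Muskat.dpsi R0 * K₀ + 1) / δ) + κ * t) ≤ 1 / (κ * t) := by
      refine one_div_le_one_div_of_le (by positivity) ?_
      have : 0 < 1 / ((1 / Muskat.dpsi R0 * K₀ + 1) / δ) := by positivity
      linarith
    calc _ ≤ δ * (1 / (κ * t)) := mul_le_mul_of_nonneg_left h2 hδ.le
      _ = _ := by field_simp
  rcases min_choice K₀ (1 / t) with h | h <;> rw [h]
  · have : 0 ≤ δ / κ * K₀ := by positivity
    rw [add_mul]; linarith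
  · have : 0 ≤ 1 / Muskat.dpsi R0 * (1 / t) := by positivity
    rw [add_mul]; linarith
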